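/- A 7-dimensional indecomposable 4-step real nilpotent Lie algebra admits a purely coclosed G2-structure if and only if it is not isomorphic to any of the following four Lie algebras: 1357E (de³ = e^{12}, de⁵ = e^{23}, de⁶ = e^{24}, de⁷ = e^{25}+e^{46}), 1457A (de³ = e^{12}, de⁴ = e^{13}, de⁷ = e^{14}+e^{56}), 1457B (de³ = e^{12}, de⁴ = e^{13}, de⁷ = e^{14}+e^{23}+e^{56}), and 1357N(−2) (de³ = e^{12}, de⁵ = e^{13}+e^{24}, de⁶ = e^{14}, de⁷ = e^{15}−2e^{23}+e^{34}+e^{46}); in each of the four presentations all unlisted de^i vanish. (Theorem '4step-indecomposable-pure' of the paper.) -/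

import Mathlib

set_option synthInstance.maxHeartbeats 1000000
set_option maxHeartbeats 1000000

open ExteriorAlgebra Module

noncomputable section

/-- The degree-`k` homogeneous component of the exterior algebra of `V`. -/
def degPart (V : Type*) [AddCommGroup V] [Module ℝ V] (k : ℕ) :
    Submodule ℝ (ExteriorAlgebra ℝ V) :=
  LinearMap.range (ExteriorAlgebra.ι ℝ : V →ₗ[ℝ] ExteriorAlgebra ℝ V) ^ k

/-- `c` is the interior product (contraction) with the vector `X : V`, acting on the exterior
algebra `Λ V*` of the dual of `V`: it is an odd antiderivation which on a 1-form `α` gives the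
scalar `α(X)`. -/
def IsContraction {V : Type*} [AddCommGroup V] [Module ℝ V] (X : V)
    (c : ExteriorAlgebra ℝ (Dual ℝ V) →ₗ[ℝ] ExteriorAlgebra ℝ (Dual ℝ V)) : Prop :=
  (∀ k, ∀ x ∈ degPart (Dual ℝ V) k, ∀ y,
      c (x * y) = c x * y + ((-1 : ℝ)) ^ k • (x * c y)) ∧
  (∀ α : Dual ℝ V, c (ExteriorAlgebra.ι ℝ α) = algebraMap ℝ _ (α X))

variable {g : Type*} [LieRing g] [LieAlgebra ℝ g]

/-- `d` is the Chevalley–Eilenberg differential of `g` on `Λ g*`, expressed with respect to a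
basis `b` of `g`: it raises degree by one, is an odd derivation, and on 1-forms it is given by
`dα = -Σ_{i<j} α([b i, b j]) bⁱ ∧ bʲ` (which encodes `dα(x,y) = -α([x,y])`). -/
def IsCEDifferential {n : ℕ} (b : Basis (Fin n) ℝ g)
    (d : ExteriorAlgebra ℝ (Dual ℝ g) →ₗ[ℝ] ExteriorAlgebra ℝ (Dual ℝ g)) : Prop :=
  (∀ k, ∀ x ∈ degPart (Dual ℝ g) k, d x ∈ degPart (Dual ℝ g) (k + 1)) ∧
  (∀ k, ∀ x ∈ degPart (Dual ℝ g) k, ∀ y,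
      d (x * y) = d x * y + ((-1 : ℝ)) ^ k • (x * d y)) ∧
  (∀ α : Dual ℝ g, d (ExteriorAlgebra.ι ℝ α) =
    (-(2⁻¹ : ℝ)) • ∑ i, ∑ j, α ⁅b i, b j⁆ •
      (ExteriorAlgebra.ι ℝ (b.dualBasis i) * ExteriorAlgebra.ι ℝ (b.dualBasis j)))

/-- The 4-form `∗φ = e^{1234}+e^{1256}+e^{1367}+e^{1457}+e^{2357}-e^{2467}+e^{3456}` built out
of a family `f` of seven 1-forms (indexed from 0). -/
def starPhiForm {W : Type*} [AddCommGroup W] [Module ℝ W] (f : Fin 7 → W) :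
    ExteriorAlgebra ℝ W :=
  let e : Fin 7 → ExteriorAlgebra ℝ W := fun i => ExteriorAlgebra.ι ℝ (f i)
  e 0 * e 1 * e 2 * e 3 + e 0 * e 1 * e 4 * e 5 + e 0 * e 2 * e 5 * e 6 +
    e 0 * e 3 * e 4 * e 6 + e 1 * e 2 * e 4 * e 6 - e 1 * e 3 * e 5 * e 6 +
    e 2 * e 3 * e 4 * e 5

/-- The 3-form `φ = e^{127}+e^{347}+e^{567}+e^{135}-e^{146}-e^{236}-e^{245}` built out of a
family `f` of seven 1-forms (indexed from 0). -/
def phiG2Form {W : Type*} [AddCommGroup W] [Module ℝ W] (f : Fin 7 → W) :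
    ExteriorAlgebra ℝ W :=
  let e : Fin 7 → ExteriorAlgebra ℝ W := fun i => ExteriorAlgebra.ι ℝ (f i)
  e 0 * e 1 * e 6 + e 2 * e 3 * e 6 + e 4 * e 5 * e 6 + e 0 * e 2 * e 4 -
    e 0 * e 3 * e 5 - e 1 * e 2 * e 5 - e 1 * e 3 * e 4

/-- A 7-dimensional real Lie algebra admits a coclosed G₂-structure if there is a basis
`f¹,…,f⁷` of `g*` for which the 4-form `∗φ` is closed for the Chevalley–Eilenberg
differential. -/
def AdmitsCoclosedG2 (g : Type*) [LieRing g] [LieAlgebra ℝ g] : Prop :=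
  ∃ (b : Basis (Fin 7) ℝ g)
    (d : ExteriorAlgebra ℝ (Dual ℝ g) →ₗ[ℝ] ExteriorAlgebra ℝ (Dual ℝ g)),
    IsCEDifferential b d ∧
    ∃ f : Basis (Fin 7) ℝ (Dual ℝ g), d (starPhiForm fun i => f i) = 0

/-- A 7-dimensional real Lie algebra admits a purely coclosed G₂-structure if there is a basis
`f¹,…,f⁷` of `g*` for which `∗φ` is closed and moreover `φ ∧ dφ = 0`. -/
def AdmitsPurelyCoclosedG2 (g : Type*) [LieRing g] [LieAlgebra ℝ g] : Prop :=
  ∃ (b : Basis (Fin 7) ℝ g)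
    (d : ExteriorAlgebra ℝ (Dual ℝ g) →ₗ[ℝ] ExteriorAlgebra ℝ (Dual ℝ g)),
    IsCEDifferential b d ∧
    ∃ f : Basis (Fin 7) ℝ (Dual ℝ g),
      d (starPhiForm fun i => f i) = 0 ∧
      (phiG2Form fun i => f i) * d (phiG2Form fun i => f i) = 0

/-- A Lie algebra is decomposable if it is the direct sum of two nonzero ideals. -/
def Decomposable (g : Type*) [LieRing g] [LieAlgebra ℝ g] : Prop :=
  ∃ I J : LieIdeal ℝ g, I ≠ ⊥ ∧ J ≠ ⊥ ∧ I ⊓ J = ⊥ ∧ I ⊔ J = ⊤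

/-- Shorthand for the 1-form `eⁱ` (the `i`-th dual basis vector) in `Λ g*`. -/
def ef {g : Type*} [LieRing g] [LieAlgebra ℝ g] (b : Basis (Fin 7) ℝ g) (i : Fin 7) :
    ExteriorAlgebra ℝ (Dual ℝ g) :=
  ExteriorAlgebra.ι ℝ (b.dualBasis i)

/-- `g` has the structure equations of the Lie algebra `1357E`:
`de³ = e^{12}`, `de⁵ = e^{23}`, `de⁶ = e^{24}`, `de⁷ = e^{25} + e^{46}`, other `deⁱ = 0`. -/
def HasStructure1357E (g : Type*) [LieRing g] [LieAlgebra ℝ g] : Prop :=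
  ∃ (b : Basis (Fin 7) ℝ g)
    (d : ExteriorAlgebra ℝ (Dual ℝ g) →ₗ[ℝ] ExteriorAlgebra ℝ (Dual ℝ g)),
    IsCEDifferential b d ∧
    d (ef b 0) = 0 ∧ d (ef b 1) = 0 ∧ d (ef b 3) = 0 ∧
    d (ef b 2) = ef b 0 * ef b 1 ∧
    d (ef b 4) = ef b 1 * ef b 2 ∧
    d (ef b 5) = ef b 1 * ef b 3 ∧
    d (ef b 6) = ef b 1 * ef b 4 + ef b 3 * ef b 5

/-- `g` has the structure equations of the Lie algebra `1457A`:
`de³ = e^{12}`, `de⁴ = e^{13}`, `de⁷ = e^{14} + e^{56}`, other `deⁱ = 0`. -/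
def HasStructure1457A (g : Type*) [LieRing g] [LieAlgebra ℝ g] : Prop :=
  ∃ (b : Basis (Fin 7) ℝ g)
    (d : ExteriorAlgebra ℝ (Dual ℝ g) →ₗ[ℝ] ExteriorAlgebra ℝ (Dual ℝ g)),
    IsCEDifferential b d ∧
    d (ef b 0) = 0 ∧ d (ef b 1) = 0 ∧ d (ef b 4) = 0 ∧ d (ef b 5) = 0 ∧
    d (ef b 2) = ef b 0 * ef b 1 ∧
    d (ef b 3) = ef b 0 * ef b 2 ∧
    d (ef b 6) = ef b 0 * ef b 3 + ef b 4 * ef b 5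

/-- `g` has the structure equations of the Lie algebra `1457B`:
`de³ = e^{12}`, `de⁴ = e^{13}`, `de⁷ = e^{14} + e^{23} + e^{56}`, other `deⁱ = 0`. -/
def HasStructure1457B (g : Type*) [LieRing g] [LieAlgebra ℝ g] : Prop :=
  ∃ (b : Basis (Fin 7) ℝ g)
    (d : ExteriorAlgebra ℝ (Dual ℝ g) →ₗ[ℝ] ExteriorAlgebra ℝ (Dual ℝ g)),
    IsCEDifferential b d ∧
    d (ef b 0) = 0 ∧ d (ef b 1) = 0 ∧ d (ef b 4) = 0 ∧ d (ef b 5) = 0 ∧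
    d (ef b 2) = ef b 0 * ef b 1 ∧
    d (ef b 3) = ef b 0 * ef b 2 ∧
    d (ef b 6) = ef b 0 * ef b 3 + ef b 1 * ef b 2 + ef b 4 * ef b 5

/-- `g` has the structure equations of the Lie algebra `1357N(-2)`:
`de³ = e^{12}`, `de⁵ = e^{13} + e^{24}`, `de⁶ = e^{14}`,
`de⁷ = e^{15} - 2e^{23} + e^{34} + e^{46}`, other `deⁱ = 0`. -/
def HasStructure1357Nminus2 (g : Type*) [LieRing g] [LieAlgebra ℝ g] : Prop :=
  ∃ (b : Basis (Fin 7) ℝ g)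
    (d : ExteriorAlgebra ℝ (Dual ℝ g) →ₗ[ℝ] ExteriorAlgebra ℝ (Dual ℝ g)),
    IsCEDifferential b d ∧
    d (ef b 0) = 0 ∧ d (ef b 1) = 0 ∧ d (ef b 3) = 0 ∧
    d (ef b 2) = ef b 0 * ef b 1 ∧
    d (ef b 4) = ef b 0 * ef b 2 + ef b 1 * ef b 3 ∧
    d (ef b 5) = ef b 0 * ef b 3 ∧
    d (ef b 6) = ef b 0 * ef b 4 - (2 : ℝ) • (ef b 1 * ef b 2) + ef b 2 * ef b 3 +
      ef b 3 * ef b 5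



/-! ### Contraction operators and monomials attached to a basis -/

/-- Contraction of a form with the vector `x`. -/
def contr (x : g) : ExteriorAlgebra ℝ (Dual ℝ g) →ₗ[ℝ] ExteriorAlgebra ℝ (Dual ℝ g) :=
  CliffordAlgebra.contractLeft (Dual.eval ℝ g x)

theorem contr_ι_mul (x : g) (α : Dual ℝ g) (y : ExteriorAlgebra ℝ (Dual ℝ g)) :
    contr x (ExteriorAlgebra.ι ℝ α * y) = α x • y - ExteriorAlgebra.ι ℝ α * contr x y :=
  CliffordAlgebra.contractLeft_ι_mul ..

theorem contr_ι (x : g) (α : Dual ℝ g) :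
    contr x (ExteriorAlgebra.ι ℝ α) = algebraMap ℝ _ (α x) :=
  CliffordAlgebra.contractLeft_ι ..

theorem contr_one (x : g) : contr x 1 = 0 := CliffordAlgebra.contractLeft_one ..

theorem contr_algebraMap (x : g) (r : ℝ) : contr x (algebraMap ℝ _ r) = 0 :=
  CliffordAlgebra.contractLeft_algebraMap ..

theorem contr_comm (x y : g) (a : ExteriorAlgebra ℝ (Dual ℝ g)) :
    contr x (contr y a) = -contr y (contr x a) :=
  CliffordAlgebra.contractLeft_comm ..

theorem ι_anticomm (α β : Dual ℝ g) :
    ExteriorAlgebra.ι ℝ α * ExteriorAlgebra.ι ℝ β =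
      -(ExteriorAlgebra.ι ℝ β * ExteriorAlgebra.ι ℝ α) :=
  eq_neg_of_add_eq_zero_left (by
    have := ExteriorAlgebra.ι_sq_zero (R := ℝ) (α + β)
    rw [map_add, add_mul, mul_add, mul_add, ExteriorAlgebra.ι_sq_zero,
      ExteriorAlgebra.ι_sq_zero] at this
    simpa only [zero_add, add_zero] using this)

section Frame

variable {n : ℕ} (v : Basis (Fin n) ℝ g)

/-- The `i`-th dual basis form, as an element of the exterior algebra. -/
def fm (i : Fin n) : ExteriorAlgebra ℝ (Dual ℝ g) := ExteriorAlgebra.ι ℝ (v.dualBasis i)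

theorem fm_sq (i : Fin n) : fm v i * fm v i = 0 := ExteriorAlgebra.ι_sq_zero _

theorem fm_sq_assoc (i : Fin n) (x) : fm v i * (fm v i * x) = 0 := by
  rw [← mul_assoc, fm_sq, zero_mul]

theorem fm_anticomm (i j : Fin n) : fm v i * fm v j = -(fm v j * fm v i) := ι_anticomm _ _

theorem fm_swap {i j : Fin n} (_ : j < i) : fm v i * fm v j = -(fm v j * fm v i) :=
  fm_anticomm v i j

theorem fm_anticomm_assoc (i j : Fin n) (x) :
    fm v i * (fm v j * x) = -(fm v j * (fm v i * x)) := by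
  rw [← mul_assoc, fm_anticomm, neg_mul, mul_assoc]

theorem fm_swap_assoc {i j : Fin n} (_ : j < i) (x) :
    fm v i * (fm v j * x) = -(fm v j * (fm v i * x)) := fm_anticomm_assoc v i j x

theorem contr_fm_mul (k i : Fin n) (x) :
    contr (v k) (fm v i * x) = (if k = i then x else 0) - fm v i * contr (v k) x := by
  rw [fm, contr_ι_mul, Basis.dualBasis_apply_self]
  split_ifs <;> simp

theorem contr_fm (k i : Fin n) : contr (v k) (fm v i) = if k = i then 1 else 0 := by
  rw [fm, contr_ι, Basis.dualBasis_apply_self]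
  split_ifs <;> simp

/-! ### The Chevalley–Eilenberg differential -/

/-- The 2-form `-½ ∑ α([vᵢ, vⱼ]) vⁱ ∧ vʲ`. -/
def dForm (α : Dual ℝ g) : ExteriorAlgebra ℝ (Dual ℝ g) :=
  (-(2⁻¹ : ℝ)) • ∑ i, ∑ j, α ⁅v i, v j⁆ • (fm v i * fm v j)

/-- The operator `∑ₖ dvᵏ ∧ ι(vₖ)` on forms. -/
def ceOp : ExteriorAlgebra ℝ (Dual ℝ g) →ₗ[ℝ] ExteriorAlgebra ℝ (Dual ℝ g) :=
  ∑ k, LinearMap.mulLeft ℝ (dForm v (v.dualBasis k)) ∘ₗ contr (v k)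

theorem ceOp_apply (x) : ceOp v x = ∑ k, dForm v (v.dualBasis k) * contr (v k) x := by
  simp [ceOp]

theorem ι_mul_dForm (α β : Dual ℝ g) :
    ExteriorAlgebra.ι ℝ α * dForm v β = dForm v β * ExteriorAlgebra.ι ℝ α := by
  simp only [dForm, mul_smul_comm, smul_mul_assoc, Finset.mul_sum, Finset.sum_mul, fm]
  congr 1
  refine Finset.sum_congr rfl fun i _ => Finset.sum_congr rfl fun j _ => ?_
  congr 1
  rw [← mul_assoc, ι_anticomm, neg_mul, mul_assoc, ι_anticomm α, mul_neg, neg_neg, mul_assoc]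

theorem dForm_sum_smul (α : Dual ℝ g) :
    ∑ k, α (v k) • dForm v (v.dualBasis k) = dForm v α := by
  have h : ∀ x : g, α x = ∑ k, α (v k) * v.dualBasis k x := fun x => by
    conv_lhs => rw [← v.sum_repr x]
    simp only [map_sum, map_smul, smul_eq_mul, Basis.dualBasis_apply, mul_comm]
  simp only [dForm, Finset.smul_sum, smul_smul]
  rw [Finset.sum_comm]
  refine Finset.sum_congr rfl fun i _ => ?_
  rw [Finset.sum_comm]
  refine Finset.sum_congr rfl fun j _ => ?_
  rw [← Finset.sum_smul, h ⁅v i, v j⁆, Finset.mul_sum]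
  congr 1
  exact Finset.sum_congr rfl fun k _ => by ring

theorem ceOp_ι_mul (α : Dual ℝ g) (y) :
    ceOp v (ExteriorAlgebra.ι ℝ α * y) =
      dForm v α * y - ExteriorAlgebra.ι ℝ α * ceOp v y := by
  simp only [ceOp_apply, contr_ι_mul, mul_sub, Finset.sum_sub_distrib, Finset.mul_sum]
  congr 1
  · rw [← dForm_sum_smul, Finset.sum_mul]
    exact Finset.sum_congr rfl fun k _ => by rw [mul_smul_comm, smul_mul_assoc]
  · exact Finset.sum_congr rfl fun k _ => by
      rw [← mul_assoc, ← ι_mul_dForm, mul_assoc]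

theorem ceOp_algebraMap (r : ℝ) : ceOp v (algebraMap ℝ _ r) = 0 := by
  simp [ceOp_apply, contr_algebraMap]

theorem ceOp_ι (α : Dual ℝ g) : ceOp v (ExteriorAlgebra.ι ℝ α) = dForm v α := by
  simpa [ceOp_apply, contr_one] using ceOp_ι_mul v α 1

theorem dForm_mem (α : Dual ℝ g) : dForm v α ∈ degPart (Dual ℝ g) 2 := by
  refine Submodule.smul_mem _ _ (Submodule.sum_mem _ fun i _ => Submodule.sum_mem _ fun j _ =>
    Submodule.smul_mem _ _ ?_)
  rw [degPart, pow_two]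
  exact Submodule.mul_mem_mul ⟨_, rfl⟩ ⟨_, rfl⟩

theorem isCEDifferential_ceOp : IsCEDifferential v (ceOp v) := by
  refine ⟨fun k x hx => ?_, fun k x hx y => ?_, fun α => ceOp_ι v α⟩
  · induction hx using Submodule.pow_induction_on_left' with
    | algebraMap r => rw [ceOp_algebraMap]; exact Submodule.zero_mem _
    | add x y i hx hy ihx ihy => rw [map_add]; exact Submodule.add_mem _ ihx ihy
    | mem_mul m hm i x hx ih =>
      obtain ⟨α, rfl⟩ := hm
      rw [ceOp_ι_mul]
      refine Submodule.sub_mem _ ?_ ?_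
      · have := Submodule.mul_mem_mul (dForm_mem v α) hx
        rwa [degPart, ← pow_add, add_comm 2] at this
      · have := Submodule.mul_mem_mul
          (LinearMap.mem_range_self (ExteriorAlgebra.ι ℝ : Dual ℝ g →ₗ[ℝ] _) α) ih
        rwa [degPart, ← pow_succ'] at this
  · induction hx using Submodule.pow_induction_on_left' generalizing y with
    | algebraMap r => simp [ceOp_algebraMap, ← Algebra.smul_def]
    | add x x' i hx hx' ihx ihx' =>
      rw [add_mul, map_add, ihx, ihx', map_add, add_mul, add_mul, smul_add]; abel
    | mem_mul m hm i x hx ih =>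
      obtain ⟨α, rfl⟩ := hm
      rw [mul_assoc, ceOp_ι_mul, ih, ceOp_ι_mul, sub_mul, mul_add, Nat.succ_eq_add_one, pow_succ,
        mul_neg_one, neg_smul, mul_smul_comm]
      simp only [mul_assoc]
      abel

theorem IsCEDifferential.map_one {v : Basis (Fin n) ℝ g} {d} (h : IsCEDifferential v d) :
    d 1 = 0 := by
  have := h.2.1 0 1 (by rw [degPart, pow_zero]; exact Submodule.one_le.mp le_rfl) 1
  simpa using this

theorem IsCEDifferential.map_ι_mul {v : Basis (Fin n) ℝ g} {d} (h : IsCEDifferential v d)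
    (α : Dual ℝ g) (y) :
    d (ExteriorAlgebra.ι ℝ α * y) = d (ExteriorAlgebra.ι ℝ α) * y - ExteriorAlgebra.ι ℝ α * d y :=
        by
  have := h.2.1 1 (ExteriorAlgebra.ι ℝ α) (by rw [degPart, pow_one]; exact ⟨α, rfl⟩) y
  simpa [sub_eq_add_neg] using this

theorem dForm_eq_of_basis (b : Basis (Fin n) ℝ g) (α : Dual ℝ g) : dForm b α = dForm v α := by
  have hb : ∀ i, fm b i = ∑ p, b.dualBasis i (v p) • fm v p := fun i => by
    have : b.dualBasis i = ∑ p, b.dualBasis i (v p) • v.dualBasis p := by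
      refine v.ext fun q => ?_
      simp [LinearMap.sum_apply, Finsupp.single_apply]
    rw [fm, this, map_sum]
    simp [fm, Finsupp.single_apply]
  have hv : ∀ p, v p = ∑ i, b.dualBasis i (v p) • b i := fun p => by
    conv_lhs => rw [← b.sum_repr (v p)]
    simp
  simp only [dForm]
  congr 1
  have hα : ∀ p q, α ⁅v p, v q⁆ =
      ∑ i, ∑ j, α ⁅b i, b j⁆ * (b.dualBasis i (v p) * b.dualBasis j (v q)) := by
    intro p q
    conv_lhs => rw [hv p, hv q]
    simp only [sum_lie, lie_sum, smul_lie, lie_smul, map_sum, map_smul, smul_eq_mul, Finset.mul_sum]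
    rw [Finset.sum_comm]
    exact Finset.sum_congr rfl fun i _ => Finset.sum_congr rfl fun j _ => by ring
  calc _ = ∑ i, ∑ j, ∑ p, ∑ q, (α ⁅b i, b j⁆ * (b.dualBasis i (v p) * b.dualBasis j (v q))) •
          (fm v p * fm v q) := by
        simp only [hb, Finset.sum_mul_sum, Finset.smul_sum, smul_mul_smul_comm, smul_smul]
    _ = ∑ i, ∑ p, ∑ j, ∑ q, (α ⁅b i, b j⁆ * (b.dualBasis i (v p) * b.dualBasis j (v q))) •
          (fm v p * fm v q) := Finset.sum_congr rfl fun i _ => Finset.sum_comm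
    _ = ∑ p, ∑ i, ∑ q, ∑ j, (α ⁅b i, b j⁆ * (b.dualBasis i (v p) * b.dualBasis j (v q))) •
          (fm v p * fm v q) := by
        rw [Finset.sum_comm]
        exact Finset.sum_congr rfl fun i _ => Finset.sum_congr rfl fun j _ => Finset.sum_comm
    _ = ∑ p, ∑ q, ∑ i, ∑ j, (α ⁅b i, b j⁆ * (b.dualBasis i (v p) * b.dualBasis j (v q))) •
          (fm v p * fm v q) := Finset.sum_congr rfl fun p _ => Finset.sum_comm
    _ = _ := by simp only [hα, Finset.sum_smul]

theorem IsCEDifferential.eq_ceOp {b : Basis (Fin n) ℝ g} {d} (h : IsCEDifferential b d) :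
    d = ceOp v := by
  refine LinearMap.ext fun x => ?_
  induction x using CliffordAlgebra.left_induction with
  | algebraMap r =>
    rw [ceOp_algebraMap, Algebra.algebraMap_eq_smul_one, map_smul, h.map_one, smul_zero]
  | add x y hx hy => rw [map_add, map_add, hx, hy]
  | ι_mul x α ih =>
    have h1 := h.map_ι_mul α x
    have h2 := ceOp_ι_mul v α x
    rw [ih, h.2.2] at h1
    exact h1.trans (h2.trans (by rw [← dForm_eq_of_basis v b]; rfl)).symm

theorem contr_contr_fm_mul_fm (p q i j : Fin n) :
    contr (v q) (contr (v p) (fm v i * fm v j)) =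
      (if q = j then if p = i then 1 else 0 else 0) -
        (if p = j then if q = i then 1 else 0 else 0) := by
  rw [contr_fm_mul, contr_fm, map_sub]
  congr 1
  · split_ifs with h h' <;> simp_all [contr_fm]
  · split_ifs with h h' <;> simp_all [contr_fm]

theorem contr_contr_dForm (α : Dual ℝ g) (p q : Fin n) :
    contr (v q) (contr (v p) (dForm v α)) = algebraMap ℝ _ (-α ⁅v p, v q⁆) := by
  simp only [dForm, map_smul, map_sum, contr_contr_fm_mul_fm, smul_sub, Finset.sum_sub_distrib]
  simp only [smul_ite, smul_zero, Finset.sum_ite_eq, Finset.mem_univ, if_true]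
  rw [← lie_skew (v q) (v p), map_neg, Algebra.algebraMap_eq_smul_one]
  module
end Frame

/-! ### The G₂ forms in an adapted frame -/

/-- The structure constants of the G₂ 3-form `φ`. -/
def phiCoeff : Fin 7 → Fin 7 → Fin 7 → ℝ :=
  ![![![0, 0, 0, 0, 0, 0, 0], ![0, 0, 0, 0, 0, 0, 1], ![0, 0, 0, 0, 1, 0, 0],
      ![0, 0, 0, 0, 0, -1, 0], ![0, 0, -1, 0, 0, 0, 0], ![0, 0, 0, 1, 0, 0, 0],
      ![0, -1, 0, 0, 0, 0, 0]],
    ![![0, 0, 0, 0, 0, 0, -1], ![0, 0, 0, 0, 0, 0, 0], ![0, 0, 0, 0, 0, -1, 0],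
      ![0, 0, 0, 0, -1, 0, 0], ![0, 0, 0, 1, 0, 0, 0], ![0, 0, 1, 0, 0, 0, 0],
      ![1, 0, 0, 0, 0, 0, 0]],
    ![![0, 0, 0, 0, -1, 0, 0], ![0, 0, 0, 0, 0, 1, 0], ![0, 0, 0, 0, 0, 0, 0],
      ![0, 0, 0, 0, 0, 0, 1], ![1, 0, 0, 0, 0, 0, 0], ![0, -1, 0, 0, 0, 0, 0],
      ![0, 0, 0, -1, 0, 0, 0]],
    ![![0, 0, 0, 0, 0, 1, 0], ![0, 0, 0, 0, 1, 0, 0], ![0, 0, 0, 0, 0, 0, -1],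
      ![0, 0, 0, 0, 0, 0, 0], ![0, -1, 0, 0, 0, 0, 0], ![-1, 0, 0, 0, 0, 0, 0],
      ![0, 0, 1, 0, 0, 0, 0]],
    ![![0, 0, 1, 0, 0, 0, 0], ![0, 0, 0, -1, 0, 0, 0], ![-1, 0, 0, 0, 0, 0, 0],
      ![0, 1, 0, 0, 0, 0, 0], ![0, 0, 0, 0, 0, 0, 0], ![0, 0, 0, 0, 0, 0, 1],
      ![0, 0, 0, 0, 0, -1, 0]],
    ![![0, 0, 0, -1, 0, 0, 0], ![0, 0, -1, 0, 0, 0, 0], ![0, 1, 0, 0, 0, 0, 0],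
      ![1, 0, 0, 0, 0, 0, 0], ![0, 0, 0, 0, 0, 0, -1], ![0, 0, 0, 0, 0, 0, 0],
      ![0, 0, 0, 0, 1, 0, 0]],
    ![![0, 1, 0, 0, 0, 0, 0], ![-1, 0, 0, 0, 0, 0, 0], ![0, 0, 0, 1, 0, 0, 0],
      ![0, 0, -1, 0, 0, 0, 0], ![0, 0, 0, 0, 0, 1, 0], ![0, 0, 0, 0, -1, 0, 0],
      ![0, 0, 0, 0, 0, 0, 0]]]

section Adapted

variable (v : Basis (Fin 7) ℝ g)

/-- The volume form of a frame. -/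
def volForm : ExteriorAlgebra ℝ (Dual ℝ g) :=
  fm v 0 * (fm v 1 * (fm v 2 * (fm v 3 * (fm v 4 * (fm v 5 * fm v 6)))))

/-- The 4-form `∗φ` of a frame. -/
def starForm : ExteriorAlgebra ℝ (Dual ℝ g) := starPhiForm fun i => v.dualBasis i

/-- The 3-form `φ` of a frame. -/
def phiForm : ExteriorAlgebra ℝ (Dual ℝ g) := phiG2Form fun i => v.dualBasis i

theorem starForm_eq : starForm v =
    fm v 0 * (fm v 1 * (fm v 2 * fm v 3)) + fm v 0 * (fm v 1 * (fm v 4 * fm v 5)) +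
    fm v 0 * (fm v 2 * (fm v 5 * fm v 6)) + fm v 0 * (fm v 3 * (fm v 4 * fm v 6)) +
    fm v 1 * (fm v 2 * (fm v 4 * fm v 6)) - fm v 1 * (fm v 3 * (fm v 5 * fm v 6)) +
    fm v 2 * (fm v 3 * (fm v 4 * fm v 5)) := by
  simp only [starForm, starPhiForm, fm, mul_assoc]

theorem phiForm_eq : phiForm v =
    fm v 0 * (fm v 1 * fm v 6) + fm v 2 * (fm v 3 * fm v 6) + fm v 4 * (fm v 5 * fm v 6) +
    fm v 0 * (fm v 2 * fm v 4) - fm v 0 * (fm v 3 * fm v 5) - fm v 1 * (fm v 2 * fm v 5) -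
    fm v 1 * (fm v 3 * fm v 4) := by
  simp only [phiForm, phiG2Form, fm, mul_assoc]

theorem fm_mul_fm_mul_starForm (i j : Fin 7) :
    fm v i * (fm v j * starForm v) = ∑ l, phiCoeff i j l • contr (v l) (volForm v) := by
  rw [starForm_eq, volForm]
  fin_cases i <;> fin_cases j <;>
  simp [phiCoeff, Fin.sum_univ_seven, contr_fm_mul, contr_fm, mul_add, mul_sub, fm_sq,
    fm_sq_assoc, fm_swap, fm_swap_assoc]

theorem phiForm_mul_contr (k : Fin 7) :
    phiForm v * contr (v k) (phiForm v) = (2 : ℝ) • (fm v k * starForm v) := by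
  rw [starForm_eq, phiForm_eq]
  fin_cases k <;>
  simp [contr_fm_mul, contr_fm, mul_add, mul_sub, add_mul, sub_mul, mul_assoc, fm_sq,
    fm_sq_assoc, fm_swap, fm_swap_assoc] <;>
  module
end Adapted

section Adapted

variable (v : Basis (Fin 7) ℝ g)

theorem volForm_ne_zero : volForm v ≠ 0 := by
  intro h
  have : contr (v 6) (contr (v 5) (contr (v 4) (contr (v 3) (contr (v 2) (contr (v 1)
      (contr (v 0) (volForm v))))))) = 1 := by
    simp [volForm, contr_fm_mul, contr_fm]
  rw [h] at this
  simp at this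

theorem fm_mul_volForm (k : Fin 7) : fm v k * volForm v = 0 := by
  rw [volForm]
  fin_cases k <;> simp [fm_sq, fm_sq_assoc, fm_swap_assoc]

theorem fm_mul_contr_volForm (k l : Fin 7) :
    fm v k * contr (v l) (volForm v) = if l = k then volForm v else 0 := by
  have := contr_fm_mul v l k (volForm v)
  rw [fm_mul_volForm, map_zero] at this
  exact (sub_eq_zero.mp this.symm).symm

theorem fm_mul_fm_mul_contr (i j k : Fin 7) (x) :
    fm v i * (fm v j * contr (v k) x) = contr (v k) (fm v i * (fm v j * x)) -
      (if k = i then fm v j * x else 0) + (if k = j then fm v i * x else 0) := by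
  rw [contr_fm_mul, contr_fm_mul, mul_sub, mul_ite, mul_zero]
  abel

/-- The `k`-th coordinate of `∑ φᵢⱼₗ [vᵢ, vⱼ]`. -/
def crossCoeff (k l : Fin 7) : ℝ :=
  ∑ i, ∑ j, phiCoeff i j l * v.dualBasis k ⁅v i, v j⁆

theorem ceOp_eq_sum (x) : ceOp v x = (-(2⁻¹ : ℝ)) • ∑ k, ∑ i, ∑ j,
    v.dualBasis k ⁅v i, v j⁆ • (fm v i * (fm v j * contr (v k) x)) := by
  simp only [ceOp_apply, dForm, smul_mul_assoc, Finset.sum_mul, Finset.smul_sum, mul_assoc]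

theorem ceOp_starForm (htr : ∀ j, ∑ k, v.dualBasis k ⁅v k, v j⁆ = 0) :
    ceOp v (starForm v) = (-(2⁻¹ : ℝ)) • ∑ k, ∑ l, crossCoeff v k l •
      contr (v k) (contr (v l) (volForm v)) := by
  have htr' : ∀ j, ∑ k, v.dualBasis k ⁅v j, v k⁆ = 0 := fun j => by
    rw [← neg_eq_zero, ← Finset.sum_neg_distrib, ← htr j]
    exact Finset.sum_congr rfl fun k _ => by rw [← lie_skew, map_neg, neg_neg]
  rw [ceOp_eq_sum]
  refine congrArg ((-(2⁻¹ : ℝ)) • ·) ?_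
  have h1 : ∑ k, ∑ i, ∑ j, v.dualBasis k ⁅v i, v j⁆ • (if k = i then fm v j * starForm v else 0)
      = 0 := by
    simp only [smul_ite, smul_zero]
    rw [Finset.sum_congr rfl fun k _ => Finset.sum_comm, Finset.sum_comm]
    simp only [Finset.sum_ite_eq, Finset.mem_univ, if_true, ← Finset.sum_smul, htr, zero_smul,
      Finset.sum_const_zero]
  have h2 : ∑ k, ∑ i, ∑ j, v.dualBasis k ⁅v i, v j⁆ • (if k = j then fm v i * starForm v else 0)
      = 0 := by
    simp only [smul_ite, smul_zero]
    rw [Finset.sum_comm]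
    simp only [Finset.sum_ite_eq, Finset.mem_univ, if_true, ← Finset.sum_smul, htr', zero_smul,
      Finset.sum_const_zero]
  simp only [fm_mul_fm_mul_contr, smul_add, smul_sub, Finset.sum_add_distrib,
    Finset.sum_sub_distrib, h1, h2, sub_zero, add_zero, fm_mul_fm_mul_starForm, map_sum, map_smul,
    Finset.smul_sum, crossCoeff, Finset.sum_smul, smul_smul]
  refine Finset.sum_congr rfl fun k _ => ?_
  rw [Finset.sum_congr rfl fun i _ => Finset.sum_comm, Finset.sum_comm]
  exact Finset.sum_congr rfl fun l _ => Finset.sum_congr rfl fun i _ =>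
    Finset.sum_congr rfl fun j _ => by rw [mul_comm]

theorem ceOp_starForm_eq_zero (htr : ∀ j, ∑ k, v.dualBasis k ⁅v k, v j⁆ = 0)
    (hs : ∀ k l, crossCoeff v k l = crossCoeff v l k) : ceOp v (starForm v) = 0 := by
  rw [ceOp_starForm v htr]
  set S := ∑ k, ∑ l, crossCoeff v k l • contr (v k) (contr (v l) (volForm v)) with hS
  have : S = -S := by
    conv_lhs => rw [hS, Finset.sum_comm]
    rw [hS]
    simp only [← Finset.sum_neg_distrib]
    refine Finset.sum_congr rfl fun k _ => Finset.sum_congr rfl fun l _ => ?_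
    rw [contr_comm, hs, smul_neg]
  have h2 : (2 : ℝ) • S = 0 := by
    rw [two_smul]
    nth_rewrite 1 [this]
    exact neg_add_cancel S
  rw [(smul_eq_zero.mp h2).resolve_left two_ne_zero, smul_zero]

theorem crossCoeff_symm (htr : ∀ j, ∑ k, v.dualBasis k ⁅v k, v j⁆ = 0)
    (h0 : ceOp v (starForm v) = 0) (p q : Fin 7) : crossCoeff v p q = crossCoeff v q p := by
  rw [ceOp_starForm v htr] at h0
  have h1 := congrArg (fun x => fm v q * (fm v p * x)) h0
  simp only [mul_smul_comm, Finset.mul_sum, fm_mul_fm_mul_contr, fm_mul_contr_volForm,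
    mul_zero] at h1
  have h2 : ∀ k l, contr (v k) (fm v q * if l = p then volForm v else 0) = 0 := fun k l => by
    split_ifs <;> simp [fm_mul_volForm]
  simp only [h2, zero_sub, smul_add, smul_neg, smul_ite, smul_zero,
    Finset.sum_add_distrib, Finset.sum_neg_distrib, ← ite_and] at h1
  have h3 : ∀ (F : Fin 7 → Fin 7 → ExteriorAlgebra ℝ (Dual ℝ g)) a b,
      (∑ x, ∑ y, if x = a ∧ y = b then F x y else 0) = F a b := by
    intro F a b
    rw [Fintype.sum_eq_single a, Fintype.sum_eq_single b] <;> simp +contextual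
  rw [h3 (fun x y => crossCoeff v x y • volForm v), h3 (fun x y => crossCoeff v x y • volForm v),
    ← smul_neg, ← smul_add, neg_add_eq_sub, ← sub_smul, smul_smul, smul_eq_zero,
    or_iff_left (volForm_ne_zero v)] at h1
  linarith

theorem phiForm_mul_ceOp_phiForm : phiForm v * ceOp v (phiForm v) =
    -(∑ k, crossCoeff v k k) • volForm v := by
  have hcomm : ∀ i j x, phiForm v * (fm v i * (fm v j * x)) = fm v i * (fm v j * (phiForm v * x)) :=
      by
    intro i j x
    rw [phiForm_eq]
    have h2 : ∀ a y, fm v a * (fm v i * (fm v j * y)) = fm v i * (fm v j * (fm v a * y)) := by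
      intro a y
      rw [fm_anticomm_assoc v a i, fm_anticomm_assoc v a j, mul_neg, neg_neg]
    have h3 : ∀ a b c, fm v a * (fm v b * fm v c) * (fm v i * (fm v j * x)) =
        fm v i * (fm v j * (fm v a * (fm v b * fm v c) * x)) := by
      intro a b c
      simp only [mul_assoc]
      rw [h2 c, h2 b, h2 a]
    simp only [add_mul, sub_mul, mul_add, mul_sub, h3]
  have hk : ∀ i j k, fm v i * (fm v j * (fm v k * starForm v)) = phiCoeff i j k • volForm v := by
    intro i j k
    rw [fm_anticomm_assoc v j k, mul_neg, fm_anticomm_assoc v i k, neg_neg, fm_mul_fm_mul_starForm]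
    simp [Finset.mul_sum, fm_mul_contr_volForm]
  simp only [ceOp_eq_sum, mul_smul_comm, Finset.mul_sum, hcomm, phiForm_mul_contr, hk, crossCoeff]
  simp only [Finset.smul_sum, Finset.sum_smul, smul_smul, ← Finset.sum_neg_distrib]
  refine Finset.sum_congr rfl fun k _ => Finset.sum_congr rfl fun i _ =>
    Finset.sum_congr rfl fun j _ => ?_
  congr 1
  ring

end Adapted

/-! ### The criterion for purely coclosed structures -/

theorem sum_dualBasis_lie_eq_zero [LieRing.IsNilpotent g] (v : Basis (Fin 7) ℝ g) (j : Fin 7) :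
    ∑ k, v.dualBasis k ⁅v k, v j⁆ = 0 := by
  obtain ⟨m, hm⟩ := LieAlgebra.nilpotent_ad_of_nilpotent_algebra ℝ g
  have h := (LinearMap.isNilpotent_trace_of_isNilpotent (R := ℝ) ⟨m, hm (v j)⟩).eq_zero
  rw [LinearMap.trace_eq_matrix_trace ℝ v, Matrix.trace] at h
  rw [← neg_eq_zero, ← Finset.sum_neg_distrib, ← h]
  refine Finset.sum_congr rfl fun k _ => ?_
  rw [← lie_skew, map_neg, neg_neg]
  simp [LinearMap.toMatrix_apply]

theorem admitsPurelyCoclosedG2_of_basis [LieRing.IsNilpotent g] (v : Basis (Fin 7) ℝ g)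
    (hs : ∀ k l, crossCoeff v k l = crossCoeff v l k) (ht : ∑ k, crossCoeff v k k = 0) :
    AdmitsPurelyCoclosedG2 g := by
  refine ⟨v, ceOp v, isCEDifferential_ceOp v, v.dualBasis, ?_, ?_⟩
  · exact ceOp_starForm_eq_zero v (sum_dualBasis_lie_eq_zero v) hs
  · have := phiForm_mul_ceOp_phiForm v
    rwa [ht, neg_zero, zero_smul] at this

theorem AdmitsPurelyCoclosedG2.exists_basis [LieRing.IsNilpotent g]
    (h : AdmitsPurelyCoclosedG2 g) :
    ∃ v : Basis (Fin 7) ℝ g, ∀ k l, crossCoeff v k l = crossCoeff v l k := by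
  obtain ⟨b, d, hd, f, hf, -⟩ := h
  have : FiniteDimensional ℝ g := Module.Finite.of_basis b
  obtain ⟨v, rfl⟩ : ∃ v : Basis (Fin 7) ℝ g, v.dualBasis = f := by
    refine ⟨f.dualBasis.map (Module.evalEquiv ℝ g).symm, ?_⟩
    refine Basis.eq_of_apply_eq fun i => ?_
    refine Basis.ext (f.dualBasis.map (Module.evalEquiv ℝ g).symm) fun j => ?_
    rw [Basis.dualBasis_apply_self, Basis.map_apply, Module.apply_evalEquiv_symm_apply,
      Basis.dualBasis_apply_self]
    exact if_congr eq_comm rfl rfl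
  rw [hd.eq_ceOp v] at hf
  exact ⟨v, crossCoeff_symm v (sum_dualBasis_lie_eq_zero v) hf⟩

theorem admitsPurelyCoclosedG2_of_coeff [LieRing.IsNilpotent g] (v : Basis (Fin 7) ℝ g)
    (W : Fin 7 → Fin 7 → ℝ)
    (hw : ∀ l, ∑ i, ∑ j, phiCoeff i j l • ⁅v i, v j⁆ = ∑ k, W l k • v k)
    (hs : ∀ k l, W k l = W l k) (ht : ∑ k, W k k = 0) : AdmitsPurelyCoclosedG2 g := by
  have h : ∀ k l, crossCoeff v k l = W l k := fun k l => by
    have := congrArg (v.dualBasis k) (hw l)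
    simp only [map_sum, map_smul, smul_eq_mul, Basis.dualBasis_apply_self, mul_ite, mul_one,
      mul_zero, Finset.sum_ite_eq', Finset.mem_univ, if_true] at this
    exact this
  refine admitsPurelyCoclosedG2_of_basis v (fun k l => ?_) ?_
  · rw [h, h, hs]
  · simpa only [h] using ht

theorem sum_phiCoeff_lie (Y : Fin 7 → g) (l : Fin 7) :
    ∑ i, ∑ j, phiCoeff i j l • ⁅Y i, Y j⁆ = (2 : ℝ) •
      (![⁅Y 1, Y 6⁆ + ⁅Y 2, Y 4⁆ - ⁅Y 3, Y 5⁆, -⁅Y 0, Y 6⁆ - ⁅Y 2, Y 5⁆ - ⁅Y 3, Y 4⁆,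
        ⁅Y 3, Y 6⁆ - ⁅Y 0, Y 4⁆ + ⁅Y 1, Y 5⁆, -⁅Y 2, Y 6⁆ + ⁅Y 0, Y 5⁆ + ⁅Y 1, Y 4⁆,
        ⁅Y 5, Y 6⁆ + ⁅Y 0, Y 2⁆ - ⁅Y 1, Y 3⁆, -⁅Y 4, Y 6⁆ - ⁅Y 0, Y 3⁆ - ⁅Y 1, Y 2⁆,
        ⁅Y 0, Y 1⁆ + ⁅Y 2, Y 3⁆ + ⁅Y 4, Y 5⁆] : Fin 7 → g) l := by
  have hs : ∀ i j, j < i → ⁅Y i, Y j⁆ = -⁅Y j, Y i⁆ := fun i j _ => (lie_skew _ _).symm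
  fin_cases l <;> simp [phiCoeff, Fin.sum_univ_seven, hs, -lie_skew] <;> module

/-- A rescaled frame whose cross products are symmetric with respect to the rescaled metric and
have no component along the first two vectors gives a purely coclosed G₂-structure. -/
theorem admitsPurelyCoclosedG2_of_frame [LieRing.IsNilpotent g] (hdim : finrank ℝ g = 7)
    {x₁ x₂ x₃ x₄ x₅ x₆ x₇ : g}
    (hspan : ⊤ ≤ Submodule.span ℝ (Set.range ![x₁, x₂, x₃, x₄, x₅, x₆, x₇]))
    (d₁ d₂ d₃ d₄ d₅ d₆ d₇ : ℝ) (hd₁ : d₁ ≠ 0) (hd₂ : d₂ ≠ 0) (hd₃ : d₃ ≠ 0) (hd₄ : d₄ ≠ 0)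
    (hd₅ : d₅ ≠ 0) (hd₆ : d₆ ≠ 0) (hd₇ : d₇ ≠ 0)
    (m₃₇ m₄₄ m₄₅ m₄₆ m₄₇ m₅₅ m₅₆ m₅₇ m₆₆ m₆₇ m₇₇ : ℝ)
    (h₁ : (d₁ * d₂ * d₇) • ⁅x₂, x₇⁆ + (d₁ * d₃ * d₅) • ⁅x₃, x₅⁆ - (d₁ * d₄ * d₆) • ⁅x₄, x₆⁆ = 0)
    (h₂ : (d₁ * d₂ * d₇) • ⁅x₁, x₇⁆ + (d₂ * d₃ * d₆) • ⁅x₃, x₆⁆ + (d₂ * d₄ * d₅) • ⁅x₄, x₅⁆ = 0)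
    (h₃ : (d₃ * d₄ * d₇) • ⁅x₄, x₇⁆ - (d₁ * d₃ * d₅) • ⁅x₁, x₅⁆ + (d₂ * d₃ * d₆) • ⁅x₂, x₆⁆ =
      m₃₇ • x₇)
    (h₄ : -(d₃ * d₄ * d₇) • ⁅x₃, x₇⁆ + (d₁ * d₄ * d₆) • ⁅x₁, x₆⁆ + (d₂ * d₄ * d₅) • ⁅x₂, x₅⁆ =
      m₄₄ • x₄ + m₄₅ • x₅ + m₄₆ • x₆ + m₄₇ • x₇)
    (h₅ : (d₅ * d₆ * d₇) • ⁅x₆, x₇⁆ + (d₁ * d₃ * d₅) • ⁅x₁, x₃⁆ - (d₂ * d₄ * d₅) • ⁅x₂, x₄⁆ =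
      m₄₅ • x₄ + m₅₅ • x₅ + m₅₆ • x₆ + m₅₇ • x₇)
    (h₆ : -(d₅ * d₆ * d₇) • ⁅x₅, x₇⁆ - (d₁ * d₄ * d₆) • ⁅x₁, x₄⁆ - (d₂ * d₃ * d₆) • ⁅x₂, x₃⁆ =
      m₄₆ • x₄ + m₅₆ • x₅ + m₆₆ • x₆ + m₆₇ • x₇)
    (h₇ : (d₁ * d₂ * d₇) • ⁅x₁, x₂⁆ + (d₃ * d₄ * d₇) • ⁅x₃, x₄⁆ + (d₅ * d₆ * d₇) • ⁅x₅, x₆⁆ =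
      m₃₇ • x₃ + m₄₇ • x₄ + m₅₇ • x₅ + m₆₇ • x₆ + m₇₇ • x₇)
    (htr : m₄₄ / d₄ ^ 2 + m₅₅ / d₅ ^ 2 + m₆₆ / d₆ ^ 2 + m₇₇ / d₇ ^ 2 = 0) :
    AdmitsPurelyCoclosedG2 g := by
  let x : Basis (Fin 7) ℝ g := basisOfTopLeSpanOfCardEqFinrank _ hspan (by simp [hdim])
  let d : Fin 7 → ℝˣ := ![.mk0 d₁ hd₁, .mk0 d₂ hd₂, .mk0 d₃ hd₃, .mk0 d₄ hd₄, .mk0 d₅ hd₅,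
    .mk0 d₆ hd₆, .mk0 d₇ hd₇]
  have hv : ∀ i, x.unitsSMul d i = (![d₁ • x₁, d₂ • x₂, d₃ • x₃, d₄ • x₄, d₅ • x₅, d₆ • x₆,
      d₇ • x₇] : Fin 7 → g) i := fun i => by
    rw [Basis.unitsSMul_apply, coe_basisOfTopLeSpanOfCardEqFinrank]
    fin_cases i <;> rfl
  refine admitsPurelyCoclosedG2_of_coeff (x.unitsSMul d)
    ![0, 0, ![0, 0, 0, 0, 0, 0, 2 * m₃₇ / (d₃ * d₇)],
      ![0, 0, 0, 2 * m₄₄ / (d₄ * d₄), 2 * m₄₅ / (d₄ * d₅), 2 * m₄₆ / (d₄ * d₆),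
        2 * m₄₇ / (d₄ * d₇)],
      ![0, 0, 0, 2 * m₄₅ / (d₄ * d₅), 2 * m₅₅ / (d₅ * d₅), 2 * m₅₆ / (d₅ * d₆),
        2 * m₅₇ / (d₅ * d₇)],
      ![0, 0, 0, 2 * m₄₆ / (d₄ * d₆), 2 * m₅₆ / (d₅ * d₆), 2 * m₆₆ / (d₆ * d₆),
        2 * m₆₇ / (d₆ * d₇)],
      ![0, 0, 2 * m₃₇ / (d₃ * d₇), 2 * m₄₇ / (d₄ * d₇), 2 * m₅₇ / (d₅ * d₇), 2 * m₆₇ / (d₆ * d₇),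
        2 * m₇₇ / (d₇ * d₇)]] ?_ ?_ ?_
  · intro l
    rw [sum_phiCoeff_lie]
    simp only [hv, Fin.sum_univ_seven]
    fin_cases l
    · apply smul_right_injective g hd₁
      simp [-smul_eq_zero, -lie_skew]
      linear_combination (norm := module) (2 : ℝ) • h₁
    · apply smul_right_injective g hd₂
      simp [-smul_eq_zero, -lie_skew]
      linear_combination (norm := module) (-2 : ℝ) • h₂
    · apply smul_right_injective g hd₃
      simp [-smul_eq_zero, -lie_skew]
      linear_combination (norm := skip) (2 : ℝ) • h₃
      match_scalars <;> field_simp <;> ring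
    · apply smul_right_injective g hd₄
      simp [-smul_eq_zero, -lie_skew]
      linear_combination (norm := skip) (2 : ℝ) • h₄
      match_scalars <;> field_simp <;> ring
    · apply smul_right_injective g hd₅
      simp [-smul_eq_zero, -lie_skew]
      linear_combination (norm := skip) (2 : ℝ) • h₅
      match_scalars <;> field_simp <;> ring
    · apply smul_right_injective g hd₆
      simp [-smul_eq_zero, -lie_skew]
      linear_combination (norm := skip) (2 : ℝ) • h₆
      match_scalars <;> field_simp <;> ring
    · apply smul_right_injective g hd₇
      simp [-smul_eq_zero, -lie_skew]
      linear_combination (norm := skip) (2 : ℝ) • h₇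
      match_scalars <;> field_simp <;> ring
  · intro k l
    fin_cases k <;> fin_cases l <;> rfl
  · simp only [Fin.sum_univ_seven]
    simp
    linear_combination 2 * htr

/-- The vectors `x₁, …, x₇` span, `x₇` is central, and the other brackets are `⁅xᵢ, xⱼ⁆ = bᵢⱼ`. -/
structure HasBrackets (x₁ x₂ x₃ x₄ x₅ x₆ x₇ : g) (b₁₂ b₁₃ b₁₄ b₁₅ b₁₆ b₂₃ b₂₄ b₂₅ b₂₆ b₃₄ b₃₅ b₃₆
    b₄₅ b₄₆ b₅₆ : g) : Prop where
  span : ∀ S : Submodule ℝ g, x₁ ∈ S → x₂ ∈ S → x₃ ∈ S → x₄ ∈ S → x₅ ∈ S → x₆ ∈ S → x₇ ∈ S → S = ⊤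
  l₁₂ : ⁅x₁, x₂⁆ = b₁₂
  l₁₃ : ⁅x₁, x₃⁆ = b₁₃
  l₁₄ : ⁅x₁, x₄⁆ = b₁₄
  l₁₅ : ⁅x₁, x₅⁆ = b₁₅
  l₁₆ : ⁅x₁, x₆⁆ = b₁₆
  l₂₃ : ⁅x₂, x₃⁆ = b₂₃
  l₂₄ : ⁅x₂, x₄⁆ = b₂₄
  l₂₅ : ⁅x₂, x₅⁆ = b₂₅
  l₂₆ : ⁅x₂, x₆⁆ = b₂₆
  l₃₄ : ⁅x₃, x₄⁆ = b₃₄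
  l₃₅ : ⁅x₃, x₅⁆ = b₃₅
  l₃₆ : ⁅x₃, x₆⁆ = b₃₆
  l₄₅ : ⁅x₄, x₅⁆ = b₄₅
  l₄₆ : ⁅x₄, x₆⁆ = b₄₆
  l₅₆ : ⁅x₅, x₆⁆ = b₅₆
  central : ∀ y : g, ⁅y, x₇⁆ = 0

namespace HasBrackets

variable {x₁ x₂ x₃ x₄ x₅ x₆ x₇ : g} {b₁₂ b₁₃ b₁₄ b₁₅ b₁₆ b₂₃ b₂₄ b₂₅ b₂₆ b₃₄ b₃₅ b₃₆
    b₄₅ b₄₆ b₅₆ : g}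

theorem rules (H : HasBrackets x₁ x₂ x₃ x₄ x₅ x₆ x₇ b₁₂ b₁₃ b₁₄ b₁₅ b₁₆ b₂₃ b₂₄ b₂₅ b₂₆ b₃₄ b₃₅ b₃₆
    b₄₅ b₄₆ b₅₆) :
    ((⁅x₁, x₂⁆ = b₁₂ ∧ ⁅x₁, x₃⁆ = b₁₃ ∧ ⁅x₁, x₄⁆ = b₁₄ ∧ ⁅x₁, x₅⁆ = b₁₅ ∧ ⁅x₁, x₆⁆ = b₁₆) ∧
      (⁅x₂, x₃⁆ = b₂₃ ∧ ⁅x₂, x₄⁆ = b₂₄ ∧ ⁅x₂, x₅⁆ = b₂₅ ∧ ⁅x₂, x₆⁆ = b₂₆) ∧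
      (⁅x₃, x₄⁆ = b₃₄ ∧ ⁅x₃, x₅⁆ = b₃₅ ∧ ⁅x₃, x₆⁆ = b₃₆) ∧
      (⁅x₄, x₅⁆ = b₄₅ ∧ ⁅x₄, x₆⁆ = b₄₆) ∧ ⁅x₅, x₆⁆ = b₅₆) ∧
    ((⁅x₂, x₁⁆ = -b₁₂ ∧ ⁅x₃, x₁⁆ = -b₁₃ ∧ ⁅x₄, x₁⁆ = -b₁₄ ∧ ⁅x₅, x₁⁆ = -b₁₅ ∧ ⁅x₆, x₁⁆ = -b₁₆) ∧
      (⁅x₃, x₂⁆ = -b₂₃ ∧ ⁅x₄, x₂⁆ = -b₂₄ ∧ ⁅x₅, x₂⁆ = -b₂₅ ∧ ⁅x₆, x₂⁆ = -b₂₆) ∧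
      (⁅x₄, x₃⁆ = -b₃₄ ∧ ⁅x₅, x₃⁆ = -b₃₅ ∧ ⁅x₆, x₃⁆ = -b₃₆) ∧
      (⁅x₅, x₄⁆ = -b₄₅ ∧ ⁅x₆, x₄⁆ = -b₄₆) ∧ ⁅x₆, x₅⁆ = -b₅₆) ∧
    (∀ y : g, ⁅y, x₇⁆ = 0) ∧ ∀ y : g, ⁅x₇, y⁆ = 0 := by
  obtain ⟨-, rfl, rfl, rfl, rfl, rfl, rfl, rfl, rfl, rfl, rfl, rfl, rfl, rfl, rfl, rfl, hc⟩ := H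
  refine ⟨by simp, by simp, hc, fun y => ?_⟩
  rw [← lie_skew, hc, neg_zero]

theorem _root_.mem_of_add_smul_mem {V : Type*} [AddCommGroup V] [Module ℝ V] {S : Submodule ℝ V}
    {x y : V} (c : ℝ) (h : x + c • y ∈ S) (hy : y ∈ S) : x ∈ S :=
  (S.add_mem_iff_left (S.smul_mem c hy)).1 h

theorem _root_.top_le_span_range {y₁ y₂ y₃ y₄ y₅ y₆ y₇ : g} (h : ∀ S : Submodule ℝ g,
    y₁ ∈ S → y₂ ∈ S → y₃ ∈ S → y₄ ∈ S → y₅ ∈ S → y₆ ∈ S → y₇ ∈ S → S = ⊤) :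
    ⊤ ≤ Submodule.span ℝ (Set.range ![y₁, y₂, y₃, y₄, y₅, y₆, y₇]) := by
  have hm : ∀ i, ![y₁, y₂, y₃, y₄, y₅, y₆, y₇] i ∈
      Submodule.span ℝ (Set.range ![y₁, y₂, y₃, y₄, y₅, y₆, y₇]) :=
    fun i => Submodule.subset_span (Set.mem_range_self i)
  exact (h _ (hm 0) (hm 1) (hm 2) (hm 3) (hm 4) (hm 5) (hm 6)).ge

section Witness

set_option linter.unusedSimpArgs false

variable [LieRing.IsNilpotent g]

theorem admits_A₀ (hdim : finrank ℝ g = 7) {t h a w : ℝ} (K D₃ D₇ σ ρ : ℝ)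
    (hK : K ≠ 0) (hD₃ : D₃ ≠ 0) (hD₇ : D₇ ≠ 0) (e₁ : K * D₇ = K + h + t)
    (e₂ : σ * (K + h + t + h) = a) (e₃ : ρ * (K + h + t - h * D₃) = w * D₃)
    (e₄ : D₃ * K * D₇ - D₃ * t * D₇ - K * D₇ + D₃ * h = 0)
    (H : HasBrackets x₁ x₂ x₃ x₄ x₅ x₆ x₇ x₄ x₅ x₆ 0 x₇ (t • x₆ + w • x₇) (a • x₇) ((h + t) • x₇) 0
        (h • x₇) 0 0 0 0 0) :
    AdmitsPurelyCoclosedG2 g := by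
  have hs : ⊤ ≤ Submodule.span ℝ (Set.range ![x₁, x₂ + (-σ) • x₃ + (-ρ) • x₄, x₃, x₄, x₅, x₆, x₇])
      := by
    refine top_le_span_range fun S s1 s2 s3 s4 s5 s6 s7 => ?_
    have h2 := mem_of_add_smul_mem _ (mem_of_add_smul_mem _ s2 s4) s3
    exact H.span S s1 h2 s3 s4 s5 s6 s7
  have R := H.rules
  refine admitsPurelyCoclosedG2_of_frame hdim hs K 1 D₃ 1 1 1 D₇ hK one_ne_zero hD₃ one_ne_zero
      one_ne_zero one_ne_zero hD₇ 0 0 0 0 (K + h + t) (D₃ * K) 0 (-D₇ * K * σ) (-D₃ * t - K) (-D₇ *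
      K * ρ) (D₃ * D₇ * h)
    ?_ ?_ ?_ ?_ ?_ ?_ ?_ (by field_simp; linear_combination e₄)
  all_goals simp only [lie_add, add_lie, lie_smul, smul_lie, R, lie_self, smul_zero, zero_smul,
    neg_zero, add_zero, zero_add, sub_zero, sub_self]
  all_goals clear R hs H hdim
  all_goals match_scalars
  all_goals first | ring1 | grind

theorem admits_A₁ (hdim : finrank ℝ g = 7) {t a : ℝ} (s₀ r q s : ℝ)
    (ha : a ≠ 0) (e₁ : a * s₀ = t) (e₂ : a * r = -2 * t)
    (e₃ : -a * q + a * s = -1 + 2 * s₀ * t) (e₄ : -a * q - a * r * s₀ - a * s + r * t = a)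
    (H : HasBrackets x₁ x₂ x₃ x₄ x₅ x₆ x₇ x₄ x₅ x₆ 0 x₇ (t • x₆) (a • x₇) ((2 * t) • x₇) 0 (t • x₇)
        x₇ 0 0 0 0) :
    AdmitsPurelyCoclosedG2 g := by
  have hs : ⊤ ≤ Submodule.span ℝ (Set.range ![x₁, x₂ + (-r) • x₄, x₃ + (-s₀) • x₂ + (-s) • x₄, x₅ +
      (-q) • x₆, x₆, x₄, x₇]) := by
    refine top_le_span_range fun S s1 s2 s3 s4 s5 s6 s7 => ?_
    have h2 := mem_of_add_smul_mem _ s2 s6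
    have h3 := mem_of_add_smul_mem _ (mem_of_add_smul_mem _ s3 s6) h2
    have h5 := mem_of_add_smul_mem _ s4 s5
    exact H.span S s1 h2 h3 s6 h5 s5 s7
  have R := H.rules
  refine admitsPurelyCoclosedG2_of_frame hdim hs (-a) (-1) 1 1 1 1 1 (neg_ne_zero.2 ha)
      (neg_ne_zero.2 one_ne_zero) one_ne_zero one_ne_zero one_ne_zero one_ne_zero one_ne_zero 0 0
      (-a) 0 0 (-a * q + a * s) t (2 * t) 0 a (1 - 2 * s₀ * t)
    ?_ ?_ ?_ ?_ ?_ ?_ ?_ (by linear_combination e₃)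
  all_goals simp only [lie_add, add_lie, lie_smul, smul_lie, R, lie_self, smul_zero, zero_smul,
    neg_zero, add_zero, zero_add, sub_zero, sub_self]
  all_goals clear R hs H hdim
  all_goals match_scalars
  all_goals first | ring1 | grind

theorem admits_B_r (hdim : finrank ℝ g = 7) {p : ℝ}
    (H : HasBrackets x₁ x₂ x₃ x₄ x₅ x₆ x₇ x₄ x₅ (p • x₇) 0 0 0 x₆ 0 x₇ 0 x₇ 0 0 0 0) :
    AdmitsPurelyCoclosedG2 g := by
  have hs : ⊤ ≤ Submodule.span ℝ (Set.range ![x₁, x₂ + (-1 - p) • x₅, x₃, x₆ + (-1 - p * (1 + p)) •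
      x₇, x₄ + (-p) • x₃, x₇, x₅ + (-1 : ℝ) • x₇]) := by
    refine top_le_span_range fun S s1 s2 s3 s4 s5 s6 s7 => ?_
    have h4 := mem_of_add_smul_mem _ s5 s3
    have h5 := mem_of_add_smul_mem _ s7 s6
    have h2 := mem_of_add_smul_mem _ s2 h5
    have h6 := mem_of_add_smul_mem _ s4 s6
    exact H.span S s1 h2 s3 h4 h5 h6 s6
  have R := H.rules
  refine admitsPurelyCoclosedG2_of_frame hdim hs 1 1 1 1 1 1 1 one_ne_zero one_ne_zero one_ne_zero
      one_ne_zero one_ne_zero one_ne_zero one_ne_zero p 1 0 0 0 0 0 1 (-1) 0 0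
    ?_ ?_ ?_ ?_ ?_ ?_ ?_ (by norm_num)
  all_goals simp only [lie_add, add_lie, lie_smul, smul_lie, R, lie_self, smul_zero, zero_smul,
    neg_zero, add_zero, zero_add, sub_zero, sub_self]
  all_goals clear R hs H hdim
  all_goals match_scalars
  all_goals ring1

theorem admits_B_q (hdim : finrank ℝ g = 7) {q s : ℝ} (m u : ℝ)
    (hq : q ≠ 0) (hm : m ≠ 0) (hms : s - m ≠ 0) (e : (s - m) * (u - q) = q * s)
    (H : HasBrackets x₁ x₂ x₃ x₄ x₅ x₆ x₇ x₄ x₅ 0 (q • x₇) 0 0 x₆ (s • x₇) x₇ (s • x₇) 0 0 0 0 0) :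
    AdmitsPurelyCoclosedG2 g := by
  have hu : u = q + q * s / (s - m) := by field_simp; linear_combination e
  have hs : ⊤ ≤ Submodule.span ℝ (Set.range ![x₁, x₂, x₃ + (u) • x₄, x₄, x₅ + (-m) • x₆, x₆, x₇]) :=
      by
    refine top_le_span_range fun S s1 s2 s3 s4 s5 s6 s7 => ?_
    have h3 := mem_of_add_smul_mem _ s3 s4
    have h5 := mem_of_add_smul_mem _ s5 s6
    exact H.span S s1 s2 h3 s4 h5 s6 s7
  have R := H.rules
  refine admitsPurelyCoclosedG2_of_frame hdim hs 1 1 1 m 1 q (m * (s - m)) one_ne_zero one_ne_zero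
      one_ne_zero hm one_ne_zero hq (mul_ne_zero hm hms) 0 0 0 0 (m * (s - m)) 1 0 0 (-q * u) 0 (m *
      (m * (s - m)) * s)
    ?_ ?_ ?_ ?_ ?_ ?_ ?_ (by rw [hu]; field_simp; ring)
  all_goals simp only [lie_add, add_lie, lie_smul, smul_lie, R, lie_self, smul_zero, zero_smul,
    neg_zero, add_zero, zero_add, sub_zero, sub_self]
  all_goals clear R hs H hdim
  all_goals match_scalars
  all_goals ring1

theorem admits_B_s (hdim : finrank ℝ g = 7) {s : ℝ}
    (h : s ≠ 0)
    (H : HasBrackets x₁ x₂ x₃ x₄ x₅ x₆ x₇ x₄ x₅ 0 0 0 0 x₆ (s • x₇) x₇ (s • x₇) 0 0 0 0 0) :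
    AdmitsPurelyCoclosedG2 g := by
  have hs : ⊤ ≤ Submodule.span ℝ (Set.range ![x₁, x₂, x₃ + (-1 : ℝ) • x₄, x₄, x₆, x₅ + (-s) • x₆,
      x₇]) := by
    refine top_le_span_range fun S s1 s2 s3 s4 s5 s6 s7 => ?_
    have h3 := mem_of_add_smul_mem _ s3 s4
    have h5 := mem_of_add_smul_mem _ s6 s5
    exact H.span S s1 s2 h3 s4 h5 s5 s7
  have R := H.rules
  refine admitsPurelyCoclosedG2_of_frame hdim hs 1 1 1 (2 * s) 1 1 (2 * s) one_ne_zero one_ne_zero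
      one_ne_zero (by positivity) one_ne_zero one_ne_zero (by positivity) 0 0 0 0 (2 * s) (-s) 1 0 0
      0 (4 * s ^ 3)
    ?_ ?_ ?_ ?_ ?_ ?_ ?_ (by field_simp; ring)
  all_goals simp only [lie_add, add_lie, lie_smul, smul_lie, R, lie_self, smul_zero, zero_smul,
    neg_zero, add_zero, zero_add, sub_zero, sub_self]
  all_goals clear R hs H hdim
  all_goals match_scalars
  all_goals ring1

theorem admits_B_p (hdim : finrank ℝ g = 7) {p : ℝ}
    (H : HasBrackets x₁ x₂ x₃ x₄ x₅ x₆ x₇ x₄ x₅ (p • x₇) 0 0 0 x₆ 0 x₇ 0 0 0 0 0 0) :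
    AdmitsPurelyCoclosedG2 g := by
  have hs : ⊤ ≤ Submodule.span ℝ (Set.range ![x₁ + (-1 : ℝ) • x₆, x₂, x₃ + (-1 : ℝ) • x₄, x₄ + (2 *
      p) • x₅, x₆ + (p) • x₇, x₅, x₇]) := by
    refine top_le_span_range fun S s1 s2 s3 s4 s5 s6 s7 => ?_
    have h4 := mem_of_add_smul_mem _ s4 s6
    have h3 := mem_of_add_smul_mem _ s3 h4
    have h6 := mem_of_add_smul_mem _ s5 s7
    have h1 := mem_of_add_smul_mem _ s1 h6
    exact H.span S h1 s2 h3 h4 s6 h6 s7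
  have R := H.rules
  refine admitsPurelyCoclosedG2_of_frame hdim hs 1 1 1 1 1 1 1 one_ne_zero one_ne_zero one_ne_zero
      one_ne_zero one_ne_zero one_ne_zero one_ne_zero 0 0 0 0 1 (-1) 1 0 0 (-2 * p) 1
    ?_ ?_ ?_ ?_ ?_ ?_ ?_ (by norm_num)
  all_goals simp only [lie_add, add_lie, lie_smul, smul_lie, R, lie_self, smul_zero, zero_smul,
    neg_zero, add_zero, zero_add, sub_zero, sub_self]
  all_goals clear R hs H hdim
  all_goals match_scalars
  all_goals ring1

theorem admits_III (hdim : finrank ℝ g = 7) {A B e γ μ : ℝ} (K D₃ D₇ u u' y : ℝ)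
    (hK : K ≠ 0) (hD₃ : D₃ ≠ 0) (hD₇ : D₇ ≠ 0) (e₁ : D₇ = 1 + e * K)
    (e₂ : (K + 1) * u = -γ) (e₃ : ((e * B - A) * D₃ - D₇) * u' = D₃ * μ)
    (e₄ : y = -(e * B - A) * D₃ + D₇ * (A * D₃ + 1 - (B * D₃ - 1) / K))
    (H : HasBrackets x₁ x₂ x₃ x₄ x₅ x₆ x₇ x₄ (B • x₆) x₅ x₇ 0 (A • x₅ + γ • x₆ + μ • x₇) x₆ 0 (e •
        x₇) ((e * B - A) • x₇) 0 0 0 0 0) :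
    AdmitsPurelyCoclosedG2 g := by
  have hs : ⊤ ≤ Submodule.span ℝ (Set.range ![x₁, x₂ + (u') • x₄ + (y) • x₅, x₃ + (u) • x₄, x₄, x₆,
      x₅, x₇]) := by
    refine top_le_span_range fun S s1 s2 s3 s4 s5 s6 s7 => ?_
    have h2 := mem_of_add_smul_mem _ (mem_of_add_smul_mem _ s2 s6) s4
    have h3 := mem_of_add_smul_mem _ s3 s4
    exact H.span S s1 h2 h3 s4 s6 s5 s7
  have R := H.rules
  refine admitsPurelyCoclosedG2_of_frame hdim hs 1 1 D₃ 1 K 1 D₇ one_ne_zero one_ne_zero hD₃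
      one_ne_zero hK one_ne_zero hD₇ 0 0 0 0 D₇ (B * D₃ * K - K) (D₃ * K * u) 0 (-A * D₃ - 1) (D₇ *
      u') ((e * B - A) * D₃ * D₇ + D₇ * y)
    ?_ ?_ ?_ ?_ ?_ ?_ ?_ (by rw [e₄]; field_simp; ring)
  all_goals simp only [lie_add, add_lie, lie_smul, smul_lie, R, lie_self, smul_zero, zero_smul,
    neg_zero, add_zero, zero_add, sub_zero, sub_self]
  all_goals clear R hs H hdim
  all_goals match_scalars
  all_goals first | ring1 | grind

theorem admits_IV (hdim : finrank ℝ g = 7) {k : ℝ} (ρ : ℝ)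
    (h₀ : ρ ≠ 0) (h₁ : ρ - 1 ≠ 0) (h₂ : 1 + ρ ≠ 0) (h₃ : k * ρ - 1 ≠ 0)
    (H : HasBrackets x₁ x₂ x₃ x₄ x₅ x₆ x₇ x₃ x₄ x₆ x₇ 0 x₅ x₇ (k • x₆) 0 0 0 0 0 0 0) :
    AdmitsPurelyCoclosedG2 g := by
  have hs : ⊤ ≤ Submodule.span ℝ (Set.range ![x₁, x₂, x₃, x₇, x₄, x₅, x₆]) := by
    refine top_le_span_range fun S s1 s2 s3 s4 s5 s6 s7 => ?_
    exact H.span S s1 s2 s3 s5 s6 s7 s4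
  have R := H.rules
  refine admitsPurelyCoclosedG2_of_frame hdim hs 1 ρ 1 ((1 + ρ) / (ρ - 1)) 1 1 ((k * ρ - 1) / ρ)
      one_ne_zero h₀ one_ne_zero
    (div_ne_zero h₂ h₁) one_ne_zero one_ne_zero (div_ne_zero h₃ h₀) (k * ρ - 1) ((1 + ρ) / (ρ - 1) *
        (1 + ρ)) 0 0 0 1 0 0 (-ρ) 0 0
    ?_ ?_ ?_ ?_ ?_ ?_ ?_ (by field_simp; ring)
  all_goals simp only [lie_add, add_lie, lie_smul, smul_lie, R, lie_self, smul_zero, zero_smul,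
    neg_zero, add_zero, zero_add, sub_zero, sub_self]
  all_goals clear R hs H hdim
  all_goals match_scalars
  all_goals first | ring1 | field_simp

theorem admits_I₀ (hdim : finrank ℝ g = 7) {s : ℝ}
    (H : HasBrackets x₁ x₂ x₃ x₄ x₅ x₆ x₇ x₃ x₄ x₇ 0 0 (s • x₇) 0 x₄ x₇ 0 x₇ 0 0 0 0) :
    AdmitsPurelyCoclosedG2 g := by
  have hs : ⊤ ≤ Submodule.span ℝ (Set.range ![x₁ + (-s / 2) • x₃, x₂, x₃, x₅, x₄, x₆, x₇]) := by
    refine top_le_span_range fun S s1 s2 s3 s4 s5 s6 s7 => ?_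
    have h1 := mem_of_add_smul_mem _ s1 s3
    exact H.span S h1 s2 s3 s5 s4 s6 s7
  have R := H.rules
  refine admitsPurelyCoclosedG2_of_frame hdim hs 1 1 1 2 1 (s ^ 2 / 2 + 3) (s ^ 2 / 2 + 2)
      one_ne_zero one_ne_zero
    one_ne_zero two_ne_zero one_ne_zero (by positivity) (by positivity) (s ^ 2 / 2 + 2) 0 0 0 0 (-1)
        0 0 0 0 ((s ^ 2 / 2 + 2) * (s ^ 2 / 2 + 2))
    ?_ ?_ ?_ ?_ ?_ ?_ ?_ (by field_simp; ring)
  all_goals simp only [lie_add, add_lie, lie_smul, smul_lie, R, lie_self, smul_zero, zero_smul,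
    neg_zero, add_zero, zero_add, sub_zero, sub_self]
  all_goals clear R hs H hdim
  all_goals match_scalars
  all_goals ring1

theorem admits_I₁ (hdim : finrank ℝ g = 7) {s : ℝ}
    (H : HasBrackets x₁ x₂ x₃ x₄ x₅ x₆ x₇ x₃ x₄ x₇ 0 0 (s • x₇) 0 x₄ 0 0 x₇ 0 0 0 x₇) :
    AdmitsPurelyCoclosedG2 g := by
  have hs : ⊤ ≤ Submodule.span ℝ (Set.range ![x₁, x₂ + (-s) • x₅, x₃ + (2 : ℝ) • x₆ + (2 : ℝ) • x₇,
      x₇, x₆, x₅ + (-2 * s) • x₄, x₄]) := by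
    refine top_le_span_range fun S s1 s2 s3 s4 s5 s6 s7 => ?_
    have h3 := mem_of_add_smul_mem _ (mem_of_add_smul_mem _ s3 s4) s5
    have h5 := mem_of_add_smul_mem _ s6 s7
    have h2 := mem_of_add_smul_mem _ s2 h5
    exact H.span S s1 h2 h3 s7 h5 s5 s4
  have R := H.rules
  refine admitsPurelyCoclosedG2_of_frame hdim hs 1 1 1 1 (-2) 1 1 one_ne_zero one_ne_zero
      one_ne_zero one_ne_zero (by norm_num) one_ne_zero one_ne_zero 1 0 0 0 0 0 0 (-2) 0 0 0
    ?_ ?_ ?_ ?_ ?_ ?_ ?_ (by norm_num)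
  all_goals simp only [lie_add, add_lie, lie_smul, smul_lie, R, lie_self, smul_zero, zero_smul,
    neg_zero, add_zero, zero_add, sub_zero, sub_self]
  all_goals clear R hs H hdim
  all_goals match_scalars
  all_goals ring1

end Witness

end HasBrackets

namespace HasBrackets

set_option linter.unusedSimpArgs false

variable {x₁ x₂ x₃ x₄ x₅ x₆ x₇ : g} [LieRing.IsNilpotent g]

theorem admits_A_zero (hdim : finrank ℝ g = 7) {t h a w : ℝ}
    (H : HasBrackets x₁ x₂ x₃ x₄ x₅ x₆ x₇ x₄ x₅ x₆ 0 x₇ (t • x₆ + w • x₇) (a • x₇)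
      ((h + t) • x₇) 0 (h • x₇) 0 0 0 0 0) : AdmitsPurelyCoclosedG2 g := by
  obtain ⟨K, hK⟩ : ∃ K, K = 2 * (|h| + |t|) + 1 := ⟨_, rfl⟩
  have h1 := neg_abs_le h
  have h2 := le_abs_self h
  have t1 := neg_abs_le t
  have t2 := le_abs_self t
  have hh := abs_nonneg h
  have ht := abs_nonneg t
  have p₁ : 0 < K + h + t := by linarith
  have p₂ : 0 < K + h + t + h := by linarith
  have p₃ : 0 < K - t := by linarith
  have p₀ : 0 < K := by linarith
  obtain ⟨Q, hQ⟩ : ∃ Q, Q = (K - t) * (K + h + t) + h * K := ⟨_, rfl⟩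
  have p₄ : 0 < Q := by
    have h3 : (2 * |h| + |t| + 1) * (|h| + |t| + 1) ≤ (K - t) * (K + h + t) :=
      mul_le_mul (by linarith) (by linarith) (by positivity) p₃.le
    have h4 : -|h| * K ≤ h * K := mul_le_mul_of_nonneg_right h1 p₀.le
    rw [hQ]
    rw [hK] at h4 ⊢
    rw [hK] at h3
    nlinarith [mul_nonneg hh ht]
  have e : K + h + t - h * (K * (K + h + t) / Q) = (K + h + t) ^ 2 * (K - t) / Q := by
    field_simp
    rw [hQ]
    ring
  have p₅ : 0 < K + h + t - h * (K * (K + h + t) / Q) := by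
    rw [e]
    positivity
  refine H.admits_A₀ hdim K (K * (K + h + t) / Q) ((K + h + t) / K) (a / (K + h + t + h))
    (w * (K * (K + h + t) / Q) / (K + h + t - h * (K * (K + h + t) / Q))) p₀.ne'
    (by positivity) (by positivity) (by field_simp) (div_mul_cancel₀ _ p₂.ne')
    ((div_mul_cancel₀ _ p₅.ne').trans (by ring)) ?_
  field_simp
  rw [hQ]
  ring

theorem normalize_A {t h a κ w : ℝ} (hκ : κ ≠ 0)
    (H : HasBrackets x₁ x₂ x₃ x₄ x₅ x₆ x₇ x₄ x₅ x₆ 0 x₇ (t • x₆ + w • x₇) (a • x₇)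
      ((h + t) • x₇) 0 (h • x₇) (κ • x₇) 0 0 0 0) :
    ∃ (y₁ y₂ y₃ y₄ y₅ y₆ y₇ : g) (a' : ℝ),
      HasBrackets y₁ y₂ y₃ y₄ y₅ y₆ y₇ y₄ y₅ y₆ 0 y₇ (t • y₆) (a' • y₇)
      ((2 * t) • y₇) 0 (t • y₇) y₇ 0 0 0 0 := by
  have R := H.rules
  refine ⟨x₁, κ • (x₂ + ((t - h) / κ) • x₃ + (w / κ) • x₅), x₃, κ • (x₄ + ((t - h) / κ) • x₅),
    x₅, κ • x₆, κ • x₇, κ * a + (t - h) * (h + 2 * t), ?_, ?_, ?_, ?_, ?_, ?_, ?_, ?_, ?_, ?_, ?_,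
    ?_, ?_, ?_, ?_, ?_, ?_⟩
  · intro S s1 s2 s3 s4 s5 s6 s7
    rw [S.smul_mem_iff hκ] at s2 s4 s6 s7
    exact H.span S s1 (mem_of_add_smul_mem _ (mem_of_add_smul_mem _ s2 s5) s3) s3
      (mem_of_add_smul_mem _ s4 s5) s5 s6 s7
  all_goals simp only [lie_add, add_lie, lie_smul, smul_lie, R, lie_self, smul_zero, zero_smul,
    neg_zero, add_zero, zero_add, sub_zero, sub_self, implies_true]
  all_goals clear R H
  all_goals match_scalars
  all_goals field_simp
  all_goals ring1

theorem admits_B (hdim : finrank ℝ g = 7) {p q r s : ℝ}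
    (H : HasBrackets x₁ x₂ x₃ x₄ x₅ x₆ x₇ x₄ x₅ (p • x₇) (q • x₇) 0 0 x₆ (s • x₇) x₇ (s • x₇)
      (r • x₇) 0 0 0 0) : AdmitsPurelyCoclosedG2 g := by
  have R := H.rules
  by_cases hr : r = 0
  · have key : ∀ α β : ℝ, HasBrackets (x₁ + β • x₃) (x₂ + α • x₃) x₃ (x₄ + α • x₅) x₅
        (x₆ + (2 * α * s) • x₇) x₇ (x₄ + α • x₅) x₅ ((p + α * q + β * s) • x₇) (q • x₇) 0 0
        (x₆ + (2 * α * s) • x₇) (s • x₇) x₇ (s • x₇) 0 0 0 0 0 := by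
      intro α β
      refine ⟨?_, ?_, ?_, ?_, ?_, ?_, ?_, ?_, ?_, ?_, ?_, ?_, ?_, ?_, ?_, ?_, ?_⟩
      · intro S s1 s2 s3 s4 s5 s6 s7
        exact H.span S (mem_of_add_smul_mem _ s1 s3) (mem_of_add_smul_mem _ s2 s3) s3
          (mem_of_add_smul_mem _ s4 s5) s5 (mem_of_add_smul_mem _ s6 s7) s7
      all_goals simp only [lie_add, add_lie, lie_smul, smul_lie, R, lie_self, smul_zero, zero_smul,
        neg_zero, add_zero, zero_add, sub_zero, sub_self, implies_true, hr]
      all_goals clear R H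
      all_goals module
    by_cases hq : q = 0
    · by_cases hs : s = 0
      · subst hr hq hs
        simp only [zero_smul] at H
        exact H.admits_B_p hdim
      · have := key 0 (-p / s)
        rw [show p + 0 * q + -p / s * s = 0 by field_simp; ring, hq] at this
        simp only [zero_smul _ x₇] at this
        exact this.admits_B_s hdim hs
    · have := key (-p / q) 0
      rw [show p + -p / q * q + 0 * s = 0 by field_simp; ring, zero_smul _ x₇] at this
      by_cases h1 : s - 1 = 0
      · exact this.admits_B_q hdim 2 (q + q * s / (s - 2)) hq two_ne_zero
          (fun h => by linarith) (by
          have : s - 2 ≠ 0 := by intro h; linarith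
          field_simp; ring)
      · exact this.admits_B_q hdim 1 (q + q * s / (s - 1)) hq one_ne_zero h1 (by field_simp; ring)
  · have key : HasBrackets (x₁ + (-q / r) • x₃) (r • (x₂ + (-s / r) • x₃)) (r • x₃)
        (r • (x₄ + (-s / r) • x₅)) (r • x₅) (r ^ 2 • (x₆ + (-s ^ 2 / r) • x₇)) (r ^ 3 • x₇)
        (r • (x₄ + (-s / r) • x₅)) (r • x₅) (((p + (-s / r) * q) / r ^ 2) • (r ^ 3 • x₇)) 0 0 0
        (r ^ 2 • (x₆ + (-s ^ 2 / r) • x₇)) 0 (r ^ 3 • x₇) 0 (r ^ 3 • x₇) 0 0 0 0 := by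
      refine ⟨?_, ?_, ?_, ?_, ?_, ?_, ?_, ?_, ?_, ?_, ?_, ?_, ?_, ?_, ?_, ?_, ?_⟩
      · intro S s1 s2 s3 s4 s5 s6 s7
        rw [S.smul_mem_iff (by positivity)] at s2 s3 s4 s5 s6 s7
        exact H.span S (mem_of_add_smul_mem _ s1 s3) (mem_of_add_smul_mem _ s2 s3) s3
          (mem_of_add_smul_mem _ s4 s5) s5 (mem_of_add_smul_mem _ s6 s7) s7
      all_goals simp only [lie_add, add_lie, lie_smul, smul_lie, R, lie_self, smul_zero, zero_smul,
        neg_zero, add_zero, zero_add, sub_zero, sub_self, implies_true]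
      all_goals clear R H
      all_goals match_scalars
      all_goals field_simp
      all_goals ring1
    exact key.admits_B_r hdim

theorem admits_III_of (hdim : finrank ℝ g = 7) {A B e γ μ : ℝ}
    (H : HasBrackets x₁ x₂ x₃ x₄ x₅ x₆ x₇ x₄ (B • x₆) x₅ x₇ 0 (A • x₅ + γ • x₆ + μ • x₇) x₆ 0
      (e • x₇) ((e * B - A) • x₇) 0 0 0 0 0) : AdmitsPurelyCoclosedG2 g := by
  obtain ⟨K, hK, hK1, hD⟩ : ∃ K : ℝ, K ≠ 0 ∧ K + 1 ≠ 0 ∧ 1 + e * K ≠ 0 := by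
    by_cases h : 1 + e * 1 = 0
    · exact ⟨2, two_ne_zero, by norm_num, fun h' => by linarith⟩
    · exact ⟨1, one_ne_zero, by norm_num, h⟩
  obtain ⟨D, hD0, hD'⟩ : ∃ D : ℝ, D ≠ 0 ∧ (e * B - A) * D - (1 + e * K) ≠ 0 := by
    by_cases h : (e * B - A) * 1 - (1 + e * K) = 0
    · exact ⟨-1, by norm_num, fun h' => hD (by linarith)⟩
    · exact ⟨1, one_ne_zero, h⟩
  exact H.admits_III hdim K D (1 + e * K) (-γ / (K + 1)) (D * μ / ((e * B - A) * D - (1 + e * K))) _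
    hK hD0 hD rfl (mul_div_cancel₀ _ hK1) (mul_div_cancel₀ _ hD') rfl

theorem admits_IV_of (hdim : finrank ℝ g = 7) {k : ℝ}
    (H : HasBrackets x₁ x₂ x₃ x₄ x₅ x₆ x₇ x₃ x₄ x₆ x₇ 0 x₅ x₇ (k • x₆) 0 0 0 0 0 0 0) :
    AdmitsPurelyCoclosedG2 g := by
  by_cases h : k * 2 - 1 = 0
  · exact H.admits_IV hdim 3 (by norm_num) (by norm_num) (by norm_num) fun h' => by linarith
  · exact H.admits_IV hdim 2 (by norm_num) (by norm_num) (by norm_num) h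

end HasBrackets

namespace HasBrackets

set_option linter.unusedSimpArgs false

variable {x₁ x₂ x₃ x₄ x₅ x₆ x₇ : g} {b₁₂ b₁₃ b₁₄ b₁₅ b₁₆ b₂₃ b₂₄ b₂₅ b₂₆ b₃₄ b₃₅ b₃₆
    b₄₅ b₄₆ b₅₆ : g}

theorem exists_basis_eq (hdim : finrank ℝ g = 7)
    (H : HasBrackets x₁ x₂ x₃ x₄ x₅ x₆ x₇ b₁₂ b₁₃ b₁₄ b₁₅ b₁₆ b₂₃ b₂₄ b₂₅ b₂₆ b₃₄ b₃₅ b₃₆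
      b₄₅ b₄₆ b₅₆) : ∃ b : Basis (Fin 7) ℝ g, b 0 = x₁ ∧ b 1 = x₂ ∧ b 2 = x₃ ∧ b 3 = x₄ ∧ b 4 = x₅ ∧
      b 5 = x₆ ∧ b 6 = x₇ := by
  refine ⟨basisOfTopLeSpanOfCardEqFinrank _ (top_le_span_range H.span) (by simp [hdim]), ?_⟩
  simp

theorem dForm_eq {b : Basis (Fin 7) ℝ g}
    (H : HasBrackets (b 0) (b 1) (b 2) (b 3) (b 4) (b 5) (b 6) b₁₂ b₁₃ b₁₄ b₁₅ b₁₆ b₂₃ b₂₄ b₂₅ b₂₆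
      b₃₄ b₃₅ b₃₆ b₄₅ b₄₆ b₅₆) (α : Dual ℝ g) :
    dForm b α = -(α b₁₂ • (fm b 0 * fm b 1) + α b₁₃ • (fm b 0 * fm b 2) +
      α b₁₄ • (fm b 0 * fm b 3) + α b₁₅ • (fm b 0 * fm b 4) + α b₁₆ • (fm b 0 * fm b 5) +
      α b₂₃ • (fm b 1 * fm b 2) + α b₂₄ • (fm b 1 * fm b 3) + α b₂₅ • (fm b 1 * fm b 4) +
      α b₂₆ • (fm b 1 * fm b 5) + α b₃₄ • (fm b 2 * fm b 3) + α b₃₅ • (fm b 2 * fm b 4) +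
      α b₃₆ • (fm b 2 * fm b 5) + α b₄₅ • (fm b 3 * fm b 4) + α b₄₆ • (fm b 3 * fm b 5) +
      α b₅₆ • (fm b 4 * fm b 5)) := by
  have R := H.rules
  simp only [dForm, Fin.sum_univ_seven, R, lie_self, map_zero, zero_smul, map_neg, zero_add,
    add_zero]
  rw [fm_anticomm b 1 0, fm_anticomm b 2 0, fm_anticomm b 3 0, fm_anticomm b 4 0,
    fm_anticomm b 5 0, fm_anticomm b 2 1, fm_anticomm b 3 1, fm_anticomm b 4 1,
    fm_anticomm b 5 1, fm_anticomm b 3 2, fm_anticomm b 4 2, fm_anticomm b 5 2,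
    fm_anticomm b 4 3, fm_anticomm b 5 3, fm_anticomm b 5 4]
  module

theorem hasStructure1357E (hdim : finrank ℝ g = 7)
    (H : HasBrackets x₁ x₂ x₃ x₄ x₅ x₆ x₇ (-x₃) 0 0 0 0 (-x₅) (-x₆) (-x₇) 0 0 0 0 0 (-x₇) 0) :
    HasStructure1357E g := by
  obtain ⟨b, rfl, rfl, rfl, rfl, rfl, rfl, rfl⟩ := H.exists_basis_eq hdim
  refine ⟨b, ceOp b, isCEDifferential_ceOp b, ?_⟩
  simp [ef, ceOp_ι, H.dForm_eq, fm, Basis.dualBasis_apply, Finsupp.single_apply]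
  abel

theorem hasStructure1457A (hdim : finrank ℝ g = 7)
    (H : HasBrackets x₁ x₂ x₃ x₄ x₅ x₆ x₇ (-x₃) (-x₄) (-x₇) 0 0 0 0 0 0 0 0 0 0 0 (-x₇)) :
    HasStructure1457A g := by
  obtain ⟨b, rfl, rfl, rfl, rfl, rfl, rfl, rfl⟩ := H.exists_basis_eq hdim
  refine ⟨b, ceOp b, isCEDifferential_ceOp b, ?_⟩
  simp [ef, ceOp_ι, H.dForm_eq, fm, Basis.dualBasis_apply, Finsupp.single_apply]
  abel

theorem hasStructure1457B (hdim : finrank ℝ g = 7)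
    (H : HasBrackets x₁ x₂ x₃ x₄ x₅ x₆ x₇ (-x₃) (-x₄) (-x₇) 0 0 (-x₇) 0 0 0 0 0 0 0 0 (-x₇)) :
    HasStructure1457B g := by
  obtain ⟨b, rfl, rfl, rfl, rfl, rfl, rfl, rfl⟩ := H.exists_basis_eq hdim
  refine ⟨b, ceOp b, isCEDifferential_ceOp b, ?_⟩
  simp [ef, ceOp_ι, H.dForm_eq, fm, Basis.dualBasis_apply, Finsupp.single_apply]
  abel

theorem hasStructure1357Nminus2 (hdim : finrank ℝ g = 7)
    (H : HasBrackets x₁ x₂ x₃ x₄ x₅ x₆ x₇ (-x₃) (-x₅) (-x₆) (-x₇) 0 ((2 : ℝ) • x₇) (-x₅) 0 0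
      (-x₇) 0 0 0 (-x₇) 0) :
    HasStructure1357Nminus2 g := by
  obtain ⟨b, rfl, rfl, rfl, rfl, rfl, rfl, rfl⟩ := H.exists_basis_eq hdim
  refine ⟨b, ceOp b, isCEDifferential_ceOp b, ?_⟩
  simp [ef, ceOp_ι, H.dForm_eq, fm, Basis.dualBasis_apply, Finsupp.single_apply]
  constructor <;> module

theorem hasStructure1457_of (hdim : finrank ℝ g = 7) {s k : ℝ} (hk : k ≠ 0)
    (H : HasBrackets x₁ x₂ x₃ x₄ x₅ x₆ x₇ x₃ x₄ x₇ 0 0 (s • x₇) 0 0 0 0 0 0 0 0 (k • x₇)) :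
    HasStructure1457A g ∨ HasStructure1457B g := by
  have R := H.rules
  by_cases hs : s = 0
  · left
    have key : HasBrackets (-x₁) (-x₂) (-x₃) (-x₄) (-x₅) ((-1 / k) • x₆) (-x₇)
        (- -x₃) (- -x₄) (- -x₇) 0 0 0 0 0 0 0 0 0 0 0 (- -x₇) := by
      refine ⟨?_, ?_, ?_, ?_, ?_, ?_, ?_, ?_, ?_, ?_, ?_, ?_, ?_, ?_, ?_, ?_, ?_⟩
      · intro S s1 s2 s3 s4 s5 s6 s7
        rw [S.neg_mem_iff] at s1 s2 s3 s4 s5 s7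
        rw [S.smul_mem_iff (div_ne_zero (by norm_num) hk)] at s6
        exact H.span S s1 s2 s3 s4 s5 s6 s7
      all_goals simp only [lie_add, add_lie, lie_smul, smul_lie, R, lie_self, smul_zero, zero_smul,
        neg_zero, add_zero, zero_add, sub_zero, sub_self, implies_true, lie_neg, neg_lie, hs,
        neg_neg]
      all_goals clear R H
      all_goals match_scalars
      all_goals field_simp
    exact key.hasStructure1457A hdim
  · right
    have key : HasBrackets (-s • x₁) (-s • x₂) (-s ^ 2 • x₃) (-s ^ 3 • x₄) (-s ^ 2 • x₅)
        ((-s ^ 2 / k) • x₆) (-s ^ 4 • x₇) (-(-s ^ 2 • x₃)) (-(-s ^ 3 • x₄)) (-(-s ^ 4 • x₇)) 0 0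
        (-(-s ^ 4 • x₇)) 0 0 0 0 0 0 0 0 (-(-s ^ 4 • x₇)) := by
      refine ⟨?_, ?_, ?_, ?_, ?_, ?_, ?_, ?_, ?_, ?_, ?_, ?_, ?_, ?_, ?_, ?_, ?_⟩
      · intro S s1 s2 s3 s4 s5 s6 s7
        rw [S.smul_mem_iff (by simp [hs])] at s1 s2 s3 s4 s5 s7
        rw [S.smul_mem_iff (by simp [hs, hk])] at s6
        exact H.span S s1 s2 s3 s4 s5 s6 s7
      all_goals simp only [lie_add, add_lie, lie_smul, smul_lie, R, lie_self, smul_zero, zero_smul,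
        neg_zero, add_zero, zero_add, sub_zero, sub_self, implies_true, lie_neg, neg_lie,
        neg_neg]
      all_goals clear R H
      all_goals match_scalars
      all_goals field_simp
    exact key.hasStructure1457B hdim

theorem admits_or_hasStructure_of_A [LieRing.IsNilpotent g] (hdim : finrank ℝ g = 7)
    {t h a κ w : ℝ}
    (H : HasBrackets x₁ x₂ x₃ x₄ x₅ x₆ x₇ x₄ x₅ x₆ 0 x₇ (t • x₆ + w • x₇) (a • x₇)
      ((h + t) • x₇) 0 (h • x₇) (κ • x₇) 0 0 0 0) :
    AdmitsPurelyCoclosedG2 g ∨ HasStructure1357E g ∨ HasStructure1357Nminus2 g := by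
  by_cases hκ : κ = 0
  · rw [hκ, zero_smul] at H
    exact .inl (H.admits_A_zero hdim)
  obtain ⟨y₁, y₂, y₃, y₄, y₅, y₆, y₇, a', H'⟩ := H.normalize_A hκ
  clear H
  by_cases ha : a' = 0
  · right
    have R := H'.rules
    by_cases ht : t = 0
    · left
      have key : HasBrackets y₂ y₁ y₄ y₃ (-y₆) (-y₅) y₇ (-y₄) 0 0 0 0 (- -y₆) (- -y₅) (-y₇) 0 0 0 0
          0 (-y₇) 0 := by
        refine ⟨?_, ?_, ?_, ?_, ?_, ?_, ?_, ?_, ?_, ?_, ?_, ?_, ?_, ?_, ?_, ?_, ?_⟩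
        · intro S s1 s2 s3 s4 s5 s6 s7
          rw [S.neg_mem_iff] at s5 s6
          exact H'.span S s2 s1 s4 s3 s6 s5 s7
        all_goals simp only [lie_add, add_lie, lie_smul, smul_lie, R, lie_self, smul_zero,
          zero_smul, neg_zero, add_zero, zero_add, sub_zero, sub_self, implies_true, lie_neg,
          neg_lie, neg_neg, ha, ht, mul_zero]
      exact key.hasStructure1357E hdim
    · right
      have key : HasBrackets (-y₁) ((-1 / t ^ 2) • (y₂ + (-2 * t) • y₃))
          ((-1 / t ^ 2) • (y₄ + (-2 * t) • y₅))
          ((-1 / t) • y₃) ((-1 / t ^ 2) • y₆) ((-1 / t) • y₅) ((-1 / t ^ 2) • y₇)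
          (-((-1 / t ^ 2) • (y₄ + (-2 * t) • y₅))) (-((-1 / t ^ 2) • y₆)) (-((-1 / t) • y₅))
          (-((-1 / t ^ 2) • y₇)) 0 ((2 : ℝ) • ((-1 / t ^ 2) • y₇)) (-((-1 / t ^ 2) • y₆)) 0 0
          (-((-1 / t ^ 2) • y₇)) 0 0 0 (-((-1 / t ^ 2) • y₇)) 0 := by
        refine ⟨?_, ?_, ?_, ?_, ?_, ?_, ?_, ?_, ?_, ?_, ?_, ?_, ?_, ?_, ?_, ?_, ?_⟩
        · intro S s1 s2 s3 s4 s5 s6 s7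
          rw [S.neg_mem_iff] at s1
          rw [S.smul_mem_iff (by simp [ht])] at s2 s3 s4 s5 s6 s7
          exact H'.span S s1 (mem_of_add_smul_mem _ s2 s4) s4 (mem_of_add_smul_mem _ s3 s6) s6 s5 s7
        all_goals simp only [lie_add, add_lie, lie_smul, smul_lie, R, lie_self, smul_zero,
          zero_smul, neg_zero, add_zero, zero_add, sub_zero, sub_self, implies_true, lie_neg,
          neg_lie, neg_neg, ha]
        all_goals clear R H'
        all_goals match_scalars
        all_goals field_simp
        all_goals ring1
      exact key.hasStructure1357Nminus2 hdim
  · left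
    refine H'.admits_A₁ hdim (t / a') (-2 * t / a') ((-1 + (1 - 2 * t ^ 2 / a') / a') / 2)
      ((-1 - (1 - 2 * t ^ 2 / a') / a') / 2) ha ?_ ?_ ?_ ?_
    all_goals field_simp
    all_goals ring1

end HasBrackets

section Nonexistence

variable (v : Basis (Fin 7) ℝ g)

/-- The trilinear form on `g*` given by the coefficients of `φ` in the frame `v`. -/
def triple (α β γ : Dual ℝ g) : ℝ :=
  ∑ i, ∑ j, ∑ l, phiCoeff i j l * α (v i) * β (v j) * γ (v l)

/-- Contraction of a 2-form against `φ` and a 1-form `γ`, in the frame `v`. -/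
def pairing (γ : Dual ℝ g) : ExteriorAlgebra ℝ (Dual ℝ g) →ₗ[ℝ] ℝ :=
  ∑ i, ∑ j, ∑ l, (phiCoeff i j l * γ (v l)) •
    (ExteriorAlgebra.algebraMapInv.toLinearMap ∘ₗ contr (v j) ∘ₗ contr (v i))

theorem triple_eq (α β γ : Dual ℝ g) : triple v α β γ =
    (α (v 0) * β (v 1) - α (v 1) * β (v 0) + (α (v 2) * β (v 3) - α (v 3) * β (v 2)) +
      (α (v 4) * β (v 5) - α (v 5) * β (v 4))) * γ (v 6) +
    (α (v 6) * β (v 0) - α (v 0) * β (v 6) - (α (v 2) * β (v 5) - α (v 5) * β (v 2)) -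
      (α (v 3) * β (v 4) - α (v 4) * β (v 3))) * γ (v 1) +
    (α (v 1) * β (v 6) - α (v 6) * β (v 1) + (α (v 2) * β (v 4) - α (v 4) * β (v 2)) -
      (α (v 3) * β (v 5) - α (v 5) * β (v 3))) * γ (v 0) +
    (α (v 3) * β (v 6) - α (v 6) * β (v 3) - (α (v 0) * β (v 4) - α (v 4) * β (v 0)) +
      (α (v 1) * β (v 5) - α (v 5) * β (v 1))) * γ (v 2) +
    (α (v 6) * β (v 2) - α (v 2) * β (v 6) + (α (v 0) * β (v 5) - α (v 5) * β (v 0)) +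
      (α (v 1) * β (v 4) - α (v 4) * β (v 1))) * γ (v 3) +
    (α (v 5) * β (v 6) - α (v 6) * β (v 5) + (α (v 0) * β (v 2) - α (v 2) * β (v 0)) -
      (α (v 1) * β (v 3) - α (v 3) * β (v 1))) * γ (v 4) +
    (α (v 6) * β (v 4) - α (v 4) * β (v 6) - (α (v 0) * β (v 3) - α (v 3) * β (v 0)) -
      (α (v 1) * β (v 2) - α (v 2) * β (v 1))) * γ (v 5) := by
  simp [triple, Fin.sum_univ_seven, phiCoeff]
  ring

theorem triple_self (α β : Dual ℝ g) : triple v α α β = 0 := by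
  rw [triple_eq]
  ring

theorem triple_swap (α β γ : Dual ℝ g) : triple v β α γ = -triple v α β γ := by
  rw [triple_eq, triple_eq]
  ring

theorem triple_rotate (α β γ : Dual ℝ g) : triple v β γ α = triple v α β γ := by
  rw [triple_eq, triple_eq]
  ring

theorem triple_sum_right (α β : Dual ℝ g) (c : Fin 7 → ℝ) (e : Fin 7 → Dual ℝ g) :
    triple v α β (∑ i, c i • e i) = ∑ i, c i * triple v α β (e i) := by
  simp only [triple_eq, Fin.sum_univ_seven, LinearMap.add_apply, LinearMap.smul_apply, smul_eq_mul]
  ring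

theorem triple_combination (α β₁ β₂ β₃ γ : Dual ℝ g) (x y z : ℝ) :
    triple v α (x • β₁ + y • β₂ + z • β₃) γ =
      x * triple v α β₁ γ + y * triple v α β₂ γ + z * triple v α β₃ γ := by
  simp only [triple_eq, LinearMap.add_apply, LinearMap.smul_apply, smul_eq_mul]
  ring

theorem pairing_ι_mul_ι (α β γ : Dual ℝ g) :
    pairing v γ (ExteriorAlgebra.ι ℝ α * ExteriorAlgebra.ι ℝ β) = 2 * triple v α β γ := by
  have h : ∀ x y, ExteriorAlgebra.algebraMapInv (contr x (contr y
      (ExteriorAlgebra.ι ℝ α * ExteriorAlgebra.ι ℝ β))) = α y * β x - α x * β y := fun x y => by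
    simp [contr_ι_mul, contr_ι, contr_algebraMap]
  simp only [pairing, LinearMap.sum_apply, LinearMap.smul_apply, LinearMap.comp_apply,
    AlgHom.toLinearMap_apply, h, smul_eq_mul]
  rw [triple_eq]
  simp [Fin.sum_univ_seven, phiCoeff]
  ring

theorem sum_comm_four {n : ℕ} (F : Fin n → Fin n → Fin n → Fin n → ℝ) :
    ∑ i, ∑ j, ∑ l, ∑ k, F i j l k = ∑ k, ∑ l, ∑ i, ∑ j, F i j l k := by
  have h : ∀ G : Fin n → Fin n → Fin n → ℝ,
      ∑ j, ∑ l, ∑ k, G j l k = ∑ k, ∑ l, ∑ j, G j l k := fun G => by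
    rw [Finset.sum_comm, Finset.sum_congr rfl fun l _ => Finset.sum_comm]
    exact Finset.sum_comm
  rw [Finset.sum_congr rfl fun i _ => h (F i)]
  rw [Finset.sum_comm]
  exact Finset.sum_congr rfl fun k _ => Finset.sum_comm

theorem pairing_ceOp_ι (α β : Dual ℝ g) :
    pairing v β (ceOp v (ExteriorAlgebra.ι ℝ α)) =
      -∑ k, ∑ l, α (v k) * β (v l) * crossCoeff v k l := by
  have hα : ∀ x : g, α x = ∑ k, α (v k) * v.dualBasis k x := fun x => by
    conv_lhs => rw [← v.sum_repr x]
    simp only [map_sum, map_smul, smul_eq_mul, Basis.dualBasis_apply, mul_comm]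
  have h : ∀ i j, ExteriorAlgebra.algebraMapInv (contr (v j) (contr (v i)
      (ceOp v (ExteriorAlgebra.ι ℝ α)))) = -∑ k, α (v k) * v.dualBasis k ⁅v i, v j⁆ := fun i j => by
    rw [ceOp_ι, contr_contr_dForm, ← hα]
    exact ExteriorAlgebra.algebraMap_leftInverse _ _
  simp only [pairing, LinearMap.sum_apply, LinearMap.smul_apply, LinearMap.comp_apply,
    AlgHom.toLinearMap_apply, h, smul_eq_mul, crossCoeff, mul_neg, Finset.sum_neg_distrib,
    Finset.mul_sum]
  congr 1
  rw [sum_comm_four]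
  refine Finset.sum_congr rfl fun k _ => Finset.sum_congr rfl fun l _ => Finset.sum_congr rfl
    fun i _ => Finset.sum_congr rfl fun j _ => ?_
  ring

theorem exists_eq_smul_of_triple {α β : Dual ℝ g} (hα : α ≠ 0) (h : ∀ γ, triple v α β γ = 0) :
    ∃ c : ℝ, β = c • α := by
  obtain ⟨N, hN⟩ : ∃ N, N = ∑ i, α (v i) ^ 2 := ⟨_, rfl⟩
  have hN0 : N ≠ 0 := by
    intro h0
    rw [hN, Finset.sum_eq_zero_iff_of_nonneg fun _ _ => sq_nonneg _] at h0
    exact hα (v.ext fun i => by simpa using h0 i (Finset.mem_univ i))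
  refine ⟨(∑ i, α (v i) * β (v i)) / N, v.ext fun i => ?_⟩
  have h0 := h (v.dualBasis 0)
  have h1 := h (v.dualBasis 1)
  have h2 := h (v.dualBasis 2)
  have h3 := h (v.dualBasis 3)
  have h4 := h (v.dualBasis 4)
  have h5 := h (v.dualBasis 5)
  have h6 := h (v.dualBasis 6)
  simp only [triple_eq, Basis.dualBasis_apply_self, Fin.reduceEq, if_true, if_false, mul_one,
    mul_zero, add_zero, zero_add] at h0 h1 h2 h3 h4 h5 h6
  rw [LinearMap.smul_apply, smul_eq_mul, div_mul_eq_mul_div, eq_div_iff hN0, hN]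
  simp only [Fin.sum_univ_seven]
  fin_cases i <;> simp only [Fin.zero_eta, Fin.mk_one, Fin.reduceFinMk]
  · linear_combination -(α (v 1) * h6) + α (v 6) * h1 - α (v 2) * h4 + α (v 4) * h2 + α (v 3) * h5 -
        α (v 5) * h3
  · linear_combination -(α (v 6) * h0) + α (v 0) * h6 + α (v 2) * h5 - α (v 5) * h2 + α (v 3) * h4 -
        α (v 4) * h3
  · linear_combination -(α (v 3) * h6) + α (v 6) * h3 + α (v 0) * h4 - α (v 4) * h0 - α (v 1) * h5 +
        α (v 5) * h1
  · linear_combination -(α (v 6) * h2) + α (v 2) * h6 - α (v 0) * h5 + α (v 5) * h0 - α (v 1) * h4 +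
        α (v 4) * h1
  · linear_combination -(α (v 5) * h6) + α (v 6) * h5 - α (v 0) * h2 + α (v 2) * h0 + α (v 1) * h3 -
        α (v 3) * h1
  · linear_combination -(α (v 6) * h4) + α (v 4) * h6 + α (v 0) * h3 - α (v 3) * h0 + α (v 1) * h2 -
        α (v 2) * h1
  · linear_combination -(α (v 0) * h1) + α (v 1) * h0 - α (v 2) * h3 + α (v 3) * h2 - α (v 4) * h5 +
        α (v 5) * h4

/-- A basis form `e i` cannot have all its `triple`s with three further basis forms `e j₁`, `e j₂`,
`e j₃` concentrated in only two basis forms `e l₁`, `e l₂`. -/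
theorem not_forall_triple_eq_zero (e : Basis (Fin 7) ℝ (Dual ℝ g)) {i j₁ j₂ j₃ l₁ l₂ : Fin 7}
    (hi : i ≠ j₁ ∧ i ≠ j₂ ∧ i ≠ j₃ ∧ j₁ ≠ j₂ ∧ j₁ ≠ j₃ ∧ j₂ ≠ j₃)
    (h₁ : ∀ l, l ≠ l₁ → l ≠ l₂ → triple v (e i) (e j₁) (e l) = 0)
    (h₂ : ∀ l, l ≠ l₁ → l ≠ l₂ → triple v (e i) (e j₂) (e l) = 0)
    (h₃ : ∀ l, l ≠ l₁ → l ≠ l₂ → triple v (e i) (e j₃) (e l) = 0) : False := by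
  obtain ⟨x, y, z, hxyz, h4, h5⟩ : ∃ x y z : ℝ, ¬(x = 0 ∧ y = 0 ∧ z = 0) ∧
      x * triple v (e i) (e j₁) (e l₁) + y * triple v (e i) (e j₂) (e l₁) +
        z * triple v (e i) (e j₃) (e l₁) = 0 ∧
      x * triple v (e i) (e j₁) (e l₂) + y * triple v (e i) (e j₂) (e l₂) +
        z * triple v (e i) (e j₃) (e l₂) = 0 := by
    obtain ⟨c, hc, hc0⟩ := Matrix.exists_mulVec_eq_zero_iff.2 (show Matrix.det
      !![triple v (e i) (e j₁) (e l₁), triple v (e i) (e j₂) (e l₁), triple v (e i) (e j₃) (e l₁);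
        triple v (e i) (e j₁) (e l₂), triple v (e i) (e j₂) (e l₂), triple v (e i) (e j₃) (e l₂);
        0, 0, 0] = 0 by simp [Matrix.det_fin_three])
    refine ⟨c 0, c 1, c 2, fun h => hc ?_, ?_, ?_⟩
    · ext k
      fin_cases k
      exacts [h.1, h.2.1, h.2.2]
    · have := congrFun hc0 0
      simp [Matrix.mulVec, dotProduct, Fin.sum_univ_three] at this
      linarith
    · have := congrFun hc0 1
      simp [Matrix.mulVec, dotProduct, Fin.sum_univ_three] at this
      linarith
  obtain ⟨c, hc⟩ := exists_eq_smul_of_triple v (e.ne_zero i)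
    (β := x • e j₁ + y • e j₂ + z • e j₃) (fun γ => by
      rw [← e.sum_repr γ, triple_sum_right]
      refine Finset.sum_eq_zero fun l _ => ?_
      rw [triple_combination]
      by_cases hl₁ : l = l₁
      · rw [hl₁, h4, mul_zero]
      by_cases hl₂ : l = l₂
      · rw [hl₂, h5, mul_zero]
      rw [h₁ l hl₁ hl₂, h₂ l hl₁ hl₂, h₃ l hl₁ hl₂]
      ring)
  obtain ⟨a, b, c', d, e', f⟩ := hi
  have hr := fun k => congrArg (fun δ => e.repr δ k) hc
  simp only [map_add, map_smul, Finsupp.add_apply, Finsupp.smul_apply, Basis.repr_self,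
    Finsupp.single_apply, smul_eq_mul] at hr
  refine hxyz ⟨?_, ?_, ?_⟩
  · simpa [*, Ne.symm] using hr j₁
  · simpa [*, Ne.symm] using hr j₂
  · simpa [*, Ne.symm] using hr j₃

theorem pairing_symm (hs : ∀ k l, crossCoeff v k l = crossCoeff v l k) {b : Basis (Fin 7) ℝ g} {d}
    (hd : IsCEDifferential b d) (i j : Fin 7) :
    pairing v (b.dualBasis j) (d (ef b i)) = pairing v (b.dualBasis i) (d (ef b j)) := by
  rw [hd.eq_ceOp v, ef, ef, pairing_ceOp_ι, pairing_ceOp_ι, Finset.sum_comm]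
  refine congrArg Neg.neg (Finset.sum_congr rfl fun k _ => Finset.sum_congr rfl fun l _ => ?_)
  rw [hs, mul_comm (b.dualBasis i _)]

theorem pairing_ef_mul_ef (b : Basis (Fin 7) ℝ g) (i j k : Fin 7) :
    pairing v (b.dualBasis k) (ef b i * ef b j) =
      2 * triple v (b.dualBasis i) (b.dualBasis j) (b.dualBasis k) :=
  pairing_ι_mul_ι v _ _ _

end Nonexistence


theorem exists_triple_eq (v b : Basis (Fin 7) ℝ g) : ∃ t : Fin 7 → Fin 7 → Fin 7 → ℝ,
    (∀ i j k, triple v (b.dualBasis i) (b.dualBasis j) (b.dualBasis k) = t i j k) ∧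
    (∀ i j k, j < i → t i j k = -t j i k) ∧ (∀ i j k, k < j → t i j k = -t i k j) ∧
    (∀ i j, t i i j = 0) ∧ ∀ i j, t i j j = 0 := by
  refine ⟨_, fun _ _ _ => rfl, fun i j k _ => triple_swap v _ _ _, fun i j k _ => ?_,
    fun i j => triple_self v _ _, fun i j => ?_⟩
  · rw [← triple_rotate, triple_swap, triple_rotate]
  · rw [← triple_rotate, triple_self]

theorem not_admits_of_hasStructure1457 [LieRing.IsNilpotent g]
    (h : HasStructure1457A g ∨ HasStructure1457B g) : ¬ AdmitsPurelyCoclosedG2 g := by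
  intro hadm
  obtain ⟨v, hv⟩ := hadm.exists_basis
  obtain ⟨s, b, d, hd, d0, d1, d4, d5, d2, d3, d6⟩ : ∃ (s : ℝ) (b : Basis (Fin 7) ℝ g)
      (d : ExteriorAlgebra ℝ (Dual ℝ g) →ₗ[ℝ] ExteriorAlgebra ℝ (Dual ℝ g)),
      IsCEDifferential b d ∧
      d (ef b 0) = 0 ∧ d (ef b 1) = 0 ∧ d (ef b 4) = 0 ∧ d (ef b 5) = 0 ∧
      d (ef b 2) = ef b 0 * ef b 1 ∧
      d (ef b 3) = ef b 0 * ef b 2 ∧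
      d (ef b 6) = ef b 0 * ef b 3 + s • (ef b 1 * ef b 2) + ef b 4 * ef b 5 := by
    obtain ⟨b, d, hd⟩ | ⟨b, d, hd⟩ := h
    · exact ⟨0, b, d, by simpa using hd⟩
    · exact ⟨1, b, d, by simpa using hd⟩
  have P := pairing_symm v hv hd
  obtain ⟨t, ht, t₁, t₂, t₃, t₄⟩ := exists_triple_eq v b
  have h24 := P 2 4
  have h25 := P 2 5
  have h31 := P 3 1
  have h34 := P 3 4
  have h35 := P 3 5
  have h32 := P 3 2
  have h60 := P 6 0
  simp [d0, d1, d2, d3, d4, d5, d6, pairing_ef_mul_ef, ht, t₁, t₂, t₃, t₄,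
    -Basis.coe_dualBasis] at h24 h25 h31 h34 h35 h32 h60
  rw [h31] at h60
  refine not_forall_triple_eq_zero v b.dualBasis (i := 0) (j₁ := 1) (j₂ := 4) (j₃ := 5)
    (l₁ := 3) (l₂ := 6) (by decide) ?_ ?_ ?_
  all_goals
    intro l hl₁ hl₂
    rw [ht]
    fin_cases l <;> simp [t₂, t₃, t₄] at hl₁ hl₂ ⊢
  all_goals linarith

theorem not_admits_of_hasStructure1357E [LieRing.IsNilpotent g]
    (h : HasStructure1357E g) : ¬ AdmitsPurelyCoclosedG2 g := by
  intro hadm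
  obtain ⟨v, hv⟩ := hadm.exists_basis
  obtain ⟨b, d, hd, d0, d1, d3, d2, d4, d5, d6⟩ := h
  have P := pairing_symm v hv hd
  obtain ⟨t, ht, t₁, t₂, t₃, t₄⟩ := exists_triple_eq v b
  have h40 := P 4 0
  have h50 := P 5 0
  have h23 := P 2 3
  have h43 := P 4 3
  have h52 := P 5 2
  have h42 := P 4 2
  have h54 := P 5 4
  have h61 := P 6 1
  have h63 := P 6 3
  simp [d0, d1, d2, d3, d4, d5, d6, pairing_ef_mul_ef, ht, t₁, t₂, t₃, t₄,
    -Basis.coe_dualBasis] at h40 h50 h23 h43 h52 h42 h54 h61 h63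
  refine not_forall_triple_eq_zero v b.dualBasis (i := 1) (j₁ := 0) (j₂ := 2) (j₃ := 3)
    (l₁ := 4) (l₂ := 6) (by decide) ?_ ?_ ?_
  all_goals
    intro l hl₁ hl₂
    rw [ht]
    fin_cases l <;> simp [t₁, t₂, t₃, t₄] at hl₁ hl₂ ⊢
  all_goals linarith

theorem not_admits_of_hasStructure1357Nminus2 [LieRing.IsNilpotent g]
    (h : HasStructure1357Nminus2 g) : ¬ AdmitsPurelyCoclosedG2 g := by
  intro hadm
  obtain ⟨v, hv⟩ := hadm.exists_basis
  obtain ⟨b, d, hd, d0, d1, d3, d2, d4, d5, d6⟩ := h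
  have P := pairing_symm v hv hd
  obtain ⟨t, ht, t₁, t₂, t₃, t₄⟩ := exists_triple_eq v b
  have h51 := P 5 1
  have h41 := P 4 1
  have h43 := P 4 3
  have h52 := P 5 2
  have h42 := P 4 2
  have h54 := P 5 4
  have h60 := P 6 0
  have h61 := P 6 1
  have h63 := P 6 3
  simp [d0, d1, d2, d3, d4, d5, d6, pairing_ef_mul_ef, ht, t₁, t₂, t₃, t₄,
    -Basis.coe_dualBasis] at h51 h41 h43 h52 h42 h54 h60 h61 h63
  refine not_forall_triple_eq_zero v b.dualBasis (i := 0) (j₁ := 1) (j₂ := 2) (j₃ := 3)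
    (l₁ := 4) (l₂ := 6) (by decide) ?_ ?_ ?_
  all_goals
    intro l hl₁ hl₂
    rw [ht]
    fin_cases l <;> simp [t₂, t₃, t₄] at hl₁ hl₂ ⊢
  all_goals linarith

section LinearAlgebra

variable {V : Type*} [AddCommGroup V] [Module ℝ V] {A B : Submodule ℝ V}

theorem exists_sub_smul_mem {b a : V} (h : A ≤ B ⊔ Submodule.span ℝ {b}) (ha : a ∈ A) :
    ∃ r : ℝ, a - r • b ∈ B := by
  obtain ⟨y, hy, z, hz, rfl⟩ := Submodule.mem_sup.1 (h ha)
  obtain ⟨r, rfl⟩ := Submodule.mem_span_singleton.1 hz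
  exact ⟨r, by simpa using hy⟩

theorem sup_span_le {b : V} (h : B ≤ A) (hb : b ∈ A) : B ⊔ Submodule.span ℝ {b} ≤ A :=
  sup_le h ((Submodule.span_singleton_le_iff_mem b A).2 hb)

theorem mem_sup_span_self (B : Submodule ℝ V) (b : V) : b ∈ B ⊔ Submodule.span ℝ {b} :=
  Submodule.mem_sup_right (Submodule.mem_span_singleton_self b)

variable [FiniteDimensional ℝ V]

theorem finrank_lt_finrank_sup_span {b : V} (hb : b ∉ B) :
    finrank ℝ B < finrank ℝ ↥(B ⊔ Submodule.span ℝ {b}) := by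
  refine Submodule.finrank_lt_finrank_of_lt (lt_of_le_not_ge le_sup_left fun h => hb ?_)
  exact h (mem_sup_span_self B b)

theorem le_sup_span_of_finrank_le {b : V} (hBA : B ≤ A) (h : finrank ℝ A ≤ finrank ℝ B + 1)
    (hb : b ∈ A) (hbB : b ∉ B) : A ≤ B ⊔ Submodule.span ℝ {b} :=
  (Submodule.eq_of_le_of_finrank_le (sup_span_le hBA hb)
    (h.trans (finrank_lt_finrank_sup_span hbB))).ge

theorem finrank_add_two_le {x y : V} (hBA : B ≤ A) (hx : x ∈ A) (hy : y ∈ A) (hxB : x ∉ B)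
    (hyB : y ∉ B ⊔ Submodule.span ℝ {x}) : finrank ℝ B + 2 ≤ finrank ℝ A := by
  have h₁ := finrank_lt_finrank_sup_span hxB
  have h₂ := finrank_lt_finrank_sup_span hyB
  have h₃ := Submodule.finrank_mono (sup_span_le (sup_span_le hBA hx) hy)
  omega

theorem exists_le_sup_span_of_finrank_le_one (hBA : B ≤ A)
    (h : finrank ℝ A ≤ finrank ℝ B + 1) : ∃ u ∈ A, A ≤ B ⊔ Submodule.span ℝ {u} := by
  by_cases hAB : A ≤ B
  · exact ⟨0, A.zero_mem, hAB.trans le_sup_left⟩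
  · obtain ⟨u, hu, huB⟩ := SetLike.not_le_iff_exists.1 hAB
    exact ⟨u, hu, le_sup_span_of_finrank_le hBA h hu huB⟩

theorem exists_le_sup_span_of_finrank_le_succ {n : ℕ} (hBA : B ≤ A)
    (h : finrank ℝ A ≤ finrank ℝ B + (n + 1)) :
    ∃ u ∈ A, B ⊔ Submodule.span ℝ {u} ≤ A ∧
      finrank ℝ A ≤ finrank ℝ ↥(B ⊔ Submodule.span ℝ {u}) + n := by
  by_cases hAB : A ≤ B
  · refine ⟨0, A.zero_mem, by simpa using hBA, ?_⟩
    have := Submodule.finrank_mono (hAB.trans (le_sup_left (b := Submodule.span ℝ {(0 : V)})))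
    omega
  · obtain ⟨u, hu, huB⟩ := SetLike.not_le_iff_exists.1 hAB
    have := finrank_lt_finrank_sup_span huB
    exact ⟨u, hu, sup_span_le hBA hu, by omega⟩

theorem exists_le_sup_span_of_finrank_le_two (hBA : B ≤ A)
    (h : finrank ℝ A ≤ finrank ℝ B + 2) :
    ∃ u ∈ A, ∃ v ∈ A, A ≤ B ⊔ Submodule.span ℝ {u, v} := by
  obtain ⟨u, hu, hB, h⟩ := exists_le_sup_span_of_finrank_le_succ hBA h
  obtain ⟨v, hv, h⟩ := exists_le_sup_span_of_finrank_le_one hB h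
  exact ⟨u, hu, v, hv, by rwa [sup_assoc, ← Submodule.span_insert] at h⟩

theorem exists_le_sup_span_of_finrank_le_three (hBA : B ≤ A)
    (h : finrank ℝ A ≤ finrank ℝ B + 3) :
    ∃ u ∈ A, ∃ v ∈ A, ∃ w ∈ A, A ≤ B ⊔ Submodule.span ℝ {u, v, w} := by
  obtain ⟨u, hu, hB, h⟩ := exists_le_sup_span_of_finrank_le_succ hBA h
  obtain ⟨v, hv, w, hw, h⟩ := exists_le_sup_span_of_finrank_le_two hB h
  exact ⟨u, hu, v, hv, w, hw, by rwa [sup_assoc, ← Submodule.span_insert] at h⟩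

theorem exists_relation_of_finrank_le_two {w₁ w₂ w₃ : V} (hBA : B ≤ A)
    (h : finrank ℝ A ≤ finrank ℝ B + 2) (h₁ : w₁ ∈ A) (h₂ : w₂ ∈ A) (h₃ : w₃ ∈ A) :
    ∃ r s t : ℝ, (r ≠ 0 ∨ s ≠ 0 ∨ t ≠ 0) ∧ r • w₁ + s • w₂ + t • w₃ ∈ B := by
  by_cases h₁B : w₁ ∈ B
  · exact ⟨1, 0, 0, by simp, by simpa using h₁B⟩
  by_cases h₂B : w₂ ∈ B ⊔ Submodule.span ℝ {w₁}
  · obtain ⟨r, hr⟩ := exists_sub_smul_mem le_rfl h₂B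
    exact ⟨-r, 1, 0, by simp, by convert hr using 1; module⟩
  have := finrank_lt_finrank_sup_span h₁B
  obtain ⟨t, ht⟩ := exists_sub_smul_mem
    (le_sup_span_of_finrank_le (sup_span_le hBA h₁) (by omega) h₂ h₂B) h₃
  obtain ⟨r, hr⟩ := exists_sub_smul_mem le_rfl ht
  exact ⟨-r, -t, 1, by simp, by convert hr using 1; module⟩

end LinearAlgebra

theorem lie_mem_submodule_comm {S : Submodule ℝ g} {x y : g} : ⁅x, y⁆ ∈ S ↔ ⁅y, x⁆ ∈ S := by
  rw [← lie_skew, S.neg_mem_iff]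

theorem lie_mem_of_span {X Y : Set g} {A M M' S : Submodule ℝ g}
    (hX : ⊤ ≤ A ⊔ Submodule.span ℝ X) (hY : M ≤ M' ⊔ Submodule.span ℝ Y)
    (hXY : ∀ x ∈ X, ∀ y ∈ Y, ⁅x, y⁆ ∈ S) (hM' : ∀ x : g, ∀ y ∈ M', ⁅x, y⁆ ∈ S)
    (hA : ∀ x ∈ A, ∀ y ∈ M, ⁅x, y⁆ ∈ S) (x : g) {y : g} (hy : y ∈ M) : ⁅x, y⁆ ∈ S := by
  have hx : A ⊔ Submodule.span ℝ X ≤ S.comap (LieModule.toEnd ℝ g g y) := by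
    refine sup_le (fun x hx => ?_) (Submodule.span_le.2 fun x hx => ?_)
    · simpa using lie_mem_submodule_comm.1 (hA x hx y hy)
    · have : M' ⊔ Submodule.span ℝ Y ≤ S.comap (LieModule.toEnd ℝ g g x) :=
        sup_le (fun y hy => by simpa using hM' x y hy)
          (Submodule.span_le.2 fun y hy => by simpa using hXY x hx y hy)
      have := this (hY hy)
      exact (lie_mem_submodule_comm (S := S)).1 (by simpa using this)
  have := hx (hX (Submodule.mem_top (x := x)))
  exact lie_mem_submodule_comm.1 (by simpa using this)

/-- `⊤ ≥ A ≥ B ≥ C` is the lower central series of a 4-step nilpotent Lie algebra, described by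
those properties of it that the classification below uses. -/
structure IsLieFiltration (A B C : Submodule ℝ g) : Prop where
  lie₀ : ∀ x y : g, ⁅x, y⁆ ∈ A
  lie₁ : ∀ x : g, ∀ y ∈ A, ⁅x, y⁆ ∈ B
  lie₂ : ∀ x : g, ∀ y ∈ B, ⁅x, y⁆ ∈ C
  lie₃ : ∀ x : g, ∀ y ∈ C, ⁅x, y⁆ = 0
  lie₁₁ : ∀ x ∈ A, ∀ y ∈ A, ⁅x, y⁆ ∈ C
  lie₁₂ : ∀ x ∈ A, ∀ y ∈ B, ⁅x, y⁆ = 0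
  gen₁ : ∀ S : Submodule ℝ g, (∀ x y : g, ⁅x, y⁆ ∈ S) → A ≤ S
  gen₂ : ∀ S : Submodule ℝ g, (∀ x : g, ∀ y ∈ A, ⁅x, y⁆ ∈ S) → B ≤ S
  gen₃ : ∀ S : Submodule ℝ g, (∀ x : g, ∀ y ∈ B, ⁅x, y⁆ ∈ S) → C ≤ S
  le₁ : B ≤ A
  le₂ : C ≤ B
  not_le₁ : ¬ A ≤ B
  not_le₂ : ¬ B ≤ C
  not_le₃ : ¬ C ≤ ⊥

theorem lie_mem_of_forall_lie_lie_mem {A S : Submodule ℝ g}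
    (hA : ∀ S : Submodule ℝ g, (∀ x y : g, ⁅x, y⁆ ∈ S) → A ≤ S) {y : g}
    (h : ∀ u v : g, ⁅u, ⁅v, y⁆⁆ ∈ S) {x : g} (hx : x ∈ A) : ⁅x, y⁆ ∈ S := by
  have : A ≤ S.comap (LieModule.toEnd ℝ g g y) := hA _ fun u v => by
    have h' : ⁅⁅u, v⁆, y⁆ ∈ S := by
      rw [lie_lie]
      exact S.sub_mem (h u v) (h v u)
    simpa using lie_mem_submodule_comm.1 h'
  exact lie_mem_submodule_comm.1 (by simpa using this hx)

theorem isLieFiltration_lowerCentralSeries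
    (h₄ : LieModule.lowerCentralSeries ℝ g g 4 = ⊥)
    (h₃ : LieModule.lowerCentralSeries ℝ g g 3 ≠ ⊥) :
    IsLieFiltration (LieModule.lowerCentralSeries ℝ g g 1).toSubmodule
      (LieModule.lowerCentralSeries ℝ g g 2).toSubmodule
      (LieModule.lowerCentralSeries ℝ g g 3).toSubmodule := by
  set D := LieModule.lowerCentralSeries ℝ g g with hD
  have hlie : ∀ k, ∀ x : g, ∀ y ∈ D k, ⁅x, y⁆ ∈ D (k + 1) := fun k x y hy => by
    rw [hD, LieModule.lowerCentralSeries_succ]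
    exact LieSubmodule.lie_mem_lie (LieSubmodule.mem_top x) hy
  have hgen : ∀ k, ∀ S : Submodule ℝ g, (∀ x : g, ∀ y ∈ D k, ⁅x, y⁆ ∈ S) →
      (D (k + 1)).toSubmodule ≤ S := fun k S hS => by
    rw [hD, LieModule.lowerCentralSeries_succ, LieSubmodule.lieIdeal_oper_eq_linear_span',
      Submodule.span_le]
    rintro _ ⟨x, -, y, hy, rfl⟩
    exact hS x y hy
  have h₀ : ∀ y : g, y ∈ D 0 := fun y => by simp [hD]
  have hanti : Antitone D := LieModule.antitone_lowerCentralSeries ℝ g g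
  have hz : ∀ x : g, ∀ y ∈ D 3, ⁅x, y⁆ = 0 := fun x y hy => by
    simpa [h₄] using hlie 3 x y hy
  have hgen₁ : ∀ S : Submodule ℝ g, (∀ x y : g, ⁅x, y⁆ ∈ S) → (D 1).toSubmodule ≤ S :=
    fun S hS => hgen 0 S fun x y _ => hS x y
  have hstep : ∀ k, (D k).toSubmodule ≤ (D (k + 1)).toSubmodule →
      (D (k + 1)).toSubmodule ≤ (D (k + 2)).toSubmodule := fun k h =>
    hgen k _ fun x y hy => hlie (k + 1) x y (h hy)
  have h₃' : ¬ (D 3).toSubmodule ≤ (D 4).toSubmodule := fun h => h₃ (by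
    rw [h₄] at h
    exact (LieSubmodule.toSubmodule_eq_bot _).1 (le_bot_iff.1 (by simpa using h)))
  exact
    { lie₀ := fun x y => hlie 0 x y (h₀ y)
      lie₁ := hlie 1
      lie₂ := hlie 2
      lie₃ := hz
      lie₁₁ := fun x hx y hy => lie_mem_of_forall_lie_lie_mem hgen₁
        (fun u v => hlie 2 _ _ (hlie 1 v y hy)) hx
      lie₁₂ := fun x hx y hy => by
        have := lie_mem_of_forall_lie_lie_mem (S := ⊥) hgen₁
          (fun u v => by simpa using hz u _ (hlie 2 v y hy)) hx
        simpa using this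
      gen₁ := hgen₁
      gen₂ := hgen 1
      gen₃ := hgen 2
      le₁ := hanti (by norm_num)
      le₂ := hanti (by norm_num)
      not_le₁ := fun h => h₃' (hstep 2 (hstep 1 h))
      not_le₂ := fun h => h₃' (hstep 2 h)
      not_le₃ := fun h => h₃' (h.trans bot_le) }

namespace IsLieFiltration

variable [FiniteDimensional ℝ g] {A B C : Submodule ℝ g}

theorem finrank_lt (F : IsLieFiltration A B C) :
    finrank ℝ C + 2 ≤ finrank ℝ A ∧ finrank ℝ C + 1 ≤ finrank ℝ B ∧ finrank ℝ B + 1 ≤ finrank ℝ A ∧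
      1 ≤ finrank ℝ C := by
  have h₁ := Submodule.finrank_lt_finrank_of_lt (lt_of_le_not_ge F.le₁ F.not_le₁)
  have h₂ := Submodule.finrank_lt_finrank_of_lt (lt_of_le_not_ge F.le₂ F.not_le₂)
  have h₃ := Submodule.finrank_lt_finrank_of_lt (lt_of_le_not_ge bot_le F.not_le₃)
  rw [finrank_bot] at h₃
  omega

theorem finrank_le_five (F : IsLieFiltration A B C) (hdim : finrank ℝ g = 7) :
    finrank ℝ A ≤ 5 := by
  by_contra! h
  obtain ⟨u, -, hu⟩ := exists_le_sup_span_of_finrank_le_one (le_top (a := A))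
    (by rw [finrank_top]; omega)
  exact F.not_le₁ (F.gen₁ B fun x y => lie_mem_of_span hu hu (by simp) F.lie₁
    (fun x hx y _ => lie_mem_submodule_comm.1 (F.lie₁ y x hx)) x Submodule.mem_top)

end IsLieFiltration

theorem finrank_span_pair_le {V : Type*} [AddCommGroup V] [Module ℝ V] (u v : V) :
    finrank ℝ (Submodule.span ℝ {u, v}) ≤ 2 := by
  classical
  have h := (finrank_span_finset_le_card (R := ℝ) ({u, v} : Finset V)).trans Finset.card_le_two
  rwa [Finset.coe_pair] at h

theorem sup_span_le_of_forall_mem {V : Type*} [AddCommGroup V] [Module ℝ V]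
    {A S : Submodule ℝ V} {X : Set V} (hA : A ≤ S) (hX : ∀ x ∈ X, x ∈ S) :
    A ⊔ Submodule.span ℝ X ≤ S :=
  sup_le hA (Submodule.span_le.2 hX)

theorem lie_lie_lie_swap {L : Type*} [LieRing L] (x y : L) : ⁅y, ⁅x, ⁅x, y⁆⁆⁆ = ⁅x, ⁅y, ⁅x, y⁆⁆⁆ :=
    by
  rw [leibniz_lie y x, ← lie_skew y x, neg_lie, lie_self, neg_zero, zero_add]

namespace IsLieFiltration

variable {A B C : Submodule ℝ g}

/-- The terms of the lower central series of a Lie algebra generated by `x` and `y`. -/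
theorem le_of_two (F : IsLieFiltration A B C) {x y : g}
    (h : ∀ S : Submodule ℝ g, A ≤ S → x ∈ S → y ∈ S → S = ⊤) :
    A ≤ B ⊔ Submodule.span ℝ {⁅x, y⁆} ∧
    B ≤ C ⊔ Submodule.span ℝ {⁅x, ⁅x, y⁆⁆, ⁅y, ⁅x, y⁆⁆} ∧
    C ≤ Submodule.span ℝ {⁅x, ⁅x, ⁅x, y⁆⁆⁆, ⁅x, ⁅y, ⁅x, y⁆⁆⁆, ⁅y, ⁅y, ⁅x, y⁆⁆⁆} := by
  have hX : ⊤ ≤ A ⊔ Submodule.span ℝ {x, y} :=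
    (h _ le_sup_left (Submodule.mem_sup_right (Submodule.subset_span (by simp)))
      (Submodule.mem_sup_right (Submodule.subset_span (by simp)))).ge
  have hb : A ≤ B ⊔ Submodule.span ℝ {⁅x, y⁆} := by
    have hm := mem_sup_span_self B ⁅x, y⁆
    refine F.gen₁ _ fun u v => lie_mem_of_span hX hX ?_
      (fun u v hv => Submodule.mem_sup_left (F.lie₁ u v hv))
      (fun u hu v _ => Submodule.mem_sup_left (lie_mem_submodule_comm.1 (F.lie₁ v u hu))) u
      Submodule.mem_top
    rintro u (rfl | rfl) v (rfl | rfl)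
    · simp
    · exact hm
    · exact lie_mem_submodule_comm.1 hm
    · simp
  have hc : B ≤ C ⊔ Submodule.span ℝ {⁅x, ⁅x, y⁆⁆, ⁅y, ⁅x, y⁆⁆} := by
    refine F.gen₂ _ fun u v hv => lie_mem_of_span hX hb ?_
      (fun u v hv => Submodule.mem_sup_left (F.lie₂ u v hv))
      (fun u hu v hv => Submodule.mem_sup_left (F.lie₁₁ u hu v hv)) u hv
    rintro u (rfl | rfl) v rfl <;>
    exact Submodule.mem_sup_right (Submodule.subset_span (by simp))
  refine ⟨hb, hc, F.gen₃ _ fun u v hv => lie_mem_of_span hX hc ?_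
      (fun u v hv => by simp [F.lie₃ u v hv])
      (fun u hu v hv => by simp [F.lie₁₂ u hu v hv]) u hv⟩
  have hj : ⁅y, ⁅x, ⁅x, y⁆⁆⁆ = ⁅x, ⁅y, ⁅x, y⁆⁆⁆ := lie_lie_lie_swap x y
  rintro u (rfl | rfl) v (rfl | rfl)
  all_goals try rw [hj]
  all_goals exact Submodule.subset_span (by simp)

theorem admits_of_two (F : IsLieFiltration A B C) [LieRing.IsNilpotent g] (hdim : finrank ℝ g = 7)
    {x y : g} (h : ∀ S : Submodule ℝ g, A ≤ S → x ∈ S → y ∈ S → S = ⊤) {k : ℝ}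
    (hk : ⁅y, ⁅y, ⁅x, y⁆⁆⁆ = k • ⁅x, ⁅x, ⁅x, y⁆⁆⁆) : AdmitsPurelyCoclosedG2 g := by
  obtain ⟨hA, hB, hC⟩ := F.le_of_two h
  have hb := F.lie₀ x y
  have hc₁ := F.lie₁ x _ hb
  have hc₂ := F.lie₁ y _ hb
  have hz₁ := F.lie₂ x _ hc₁
  have hz₂ := F.lie₂ x _ hc₂
  have hj : ⁅y, ⁅x, ⁅x, y⁆⁆⁆ = ⁅x, ⁅y, ⁅x, y⁆⁆⁆ := lie_lie_lie_swap x y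
  refine HasBrackets.admits_IV_of (x₁ := x) (x₂ := y) (x₃ := ⁅x, y⁆) (x₄ := ⁅x, ⁅x, y⁆⁆)
    (x₅ := ⁅y, ⁅x, y⁆⁆) (x₆ := ⁅x, ⁅x, ⁅x, y⁆⁆⁆) (x₇ := ⁅x, ⁅y, ⁅x, y⁆⁆⁆) (k := k) hdim
    ⟨fun S h₁ h₂ h₃ h₄ h₅ h₆ h₇ => ?_, rfl, rfl, rfl, rfl, F.lie₃ _ _ hz₁, rfl, hj, hk, F.lie₃ _ _
        hz₁,
      F.lie₁₂ _ hb _ hc₁, F.lie₁₂ _ hb _ hc₂, F.lie₃ _ _ hz₁, F.lie₁₂ _ (F.le₁ hc₁) _ hc₂,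
      F.lie₃ _ _ hz₁, F.lie₃ _ _ hz₁, fun u => F.lie₃ _ _ hz₂⟩
  have hCS : C ≤ S := hC.trans (Submodule.span_le.2 (by
    rintro _ (rfl | rfl | rfl)
    exacts [h₆, h₇, hk ▸ S.smul_mem k h₆]))
  have hBS : B ≤ S := hB.trans (sup_span_le_of_forall_mem hCS (by rintro _ (rfl | rfl) <;>
      assumption))
  exact h S (hA.trans (sup_span_le_of_forall_mem hBS (by rintro _ rfl; assumption))) h₁ h₂

variable [FiniteDimensional ℝ g]

theorem admits_of_finrank_eq_five (F : IsLieFiltration A B C) [LieRing.IsNilpotent g]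
    (hdim : finrank ℝ g = 7) (hA : finrank ℝ A = 5) : AdmitsPurelyCoclosedG2 g := by
  obtain ⟨x, -, y, -, hxy⟩ := exists_le_sup_span_of_finrank_le_two (le_top (a := A))
    (by rw [finrank_top]; omega)
  have h : ∀ S : Submodule ℝ g, A ≤ S → x ∈ S → y ∈ S → S = ⊤ := fun S hA hx hy =>
    top_le_iff.1 (hxy.trans (sup_span_le_of_forall_mem hA (by rintro _ (rfl | rfl) <;> assumption)))
  obtain ⟨hA', hB', hC'⟩ := F.le_of_two h
  have hr := F.finrank_lt
  have hC : finrank ℝ C ≤ 2 := by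
    by_contra! hC
    obtain ⟨w, hw, hwB⟩ := exists_le_sup_span_of_finrank_le_one F.le₂ (by omega)
    have : C ≤ Submodule.span ℝ {⁅x, w⁆, ⁅y, w⁆} := by
      refine F.gen₃ _ fun u v hv => lie_mem_of_span hxy hwB ?_
        (fun u v hv => by simp [F.lie₃ u v hv])
        (fun u hu v hv => by simp [F.lie₁₂ u hu v hv]) u hv
      rintro u (rfl | rfl) v rfl <;> exact Submodule.subset_span (by simp)
    have h₂ := (Submodule.finrank_mono this).trans (finrank_span_pair_le _ _)
    omega
  have hb := F.lie₀ x y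
  have hc₁ := F.lie₁ x _ hb
  have hc₂ := F.lie₁ y _ hb
  have hz₁ := F.lie₂ x _ hc₁
  have hz₂ := F.lie₂ x _ hc₂
  have hz₃ := F.lie₂ y _ hc₂
  have hj : ⁅y, ⁅x, ⁅x, y⁆⁆⁆ = ⁅x, ⁅y, ⁅x, y⁆⁆⁆ := lie_lie_lie_swap x y
  have hyx : ⁅y, x⁆ = -⁅x, y⁆ := (lie_skew y x).symm
  obtain ⟨r, s, t, hrst, e⟩ := exists_relation_of_finrank_le_two (bot_le (a := C))
    (by rw [finrank_bot]; omega) hz₁ hz₂ hz₃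
  rw [Submodule.mem_bot] at e
  by_cases ht : t = 0
  · by_cases hr : r = 0
    · have hs : s ≠ 0 := by simpa [hr, ht] using hrst
      have hz : ⁅x, ⁅y, ⁅x, y⁆⁆⁆ = 0 := by simpa [hr, ht, hs] using e
      refine F.admits_of_two hdim (x := x - y) (y := x + y) (fun S hA hx hy => ?_) (k := 1) ?_
      · have hx' : x ∈ S := by
          convert S.smul_mem (1 / 2 : ℝ) (S.add_mem hx hy) using 1
          module
        exact h S hA hx' (by convert S.sub_mem hy hx' using 1; module)
      · simp only [lie_add, add_lie, lie_sub, sub_lie, lie_self, hyx, hz, hj, lie_neg]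
        module
    · refine F.admits_of_two hdim (x := y) (y := x + (s / (2 * r)) • y)
        (fun S hA hx hy => h S hA (mem_of_add_smul_mem _ hy hx) hx) (k := (s / (2 * r)) ^ 2) ?_
      have hz : ⁅x, ⁅x, ⁅x, y⁆⁆⁆ = (-(s / r)) • ⁅x, ⁅y, ⁅x, y⁆⁆⁆ := by
        rw [ht, zero_smul, add_zero] at e
        rw [← sub_eq_zero, ← smul_zero (1 / r), ← e]
        match_scalars <;> field_simp
      simp only [lie_add, add_lie, lie_self, hyx, hj, lie_smul, smul_lie, smul_zero, add_zero,
        lie_neg, hz]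
      match_scalars <;> field_simp <;> ring
  · refine F.admits_of_two hdim (x := x) (y := y + (s / (2 * t)) • x)
      (fun S hA hx hy => h S hA hx (mem_of_add_smul_mem _ hy hx))
      (k := (s / (2 * t)) ^ 2 - r / t) ?_
    have hz : ⁅y, ⁅y, ⁅x, y⁆⁆⁆ = (-(s / t)) • ⁅x, ⁅y, ⁅x, y⁆⁆⁆ + (-(r / t)) • ⁅x, ⁅x, ⁅x, y⁆⁆⁆ := by
      rw [← sub_eq_zero, ← smul_zero (1 / t), ← e]
      match_scalars <;> field_simp
    simp only [lie_add, add_lie, lie_self, hj, lie_smul, smul_lie, smul_zero, add_zero, hz]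
    match_scalars <;> field_simp <;> ring

end IsLieFiltration

theorem exists_sub_smul_sub_smul_mem {V : Type*} [AddCommGroup V] [Module ℝ V]
    {A B : Submodule ℝ V} {a b c : V} (h : A ≤ B ⊔ Submodule.span ℝ {b, c}) (ha : a ∈ A) :
    ∃ r s : ℝ, a - (r • b + s • c) ∈ B := by
  obtain ⟨y, hy, z, hz, rfl⟩ := Submodule.mem_sup.1 (h ha)
  obtain ⟨r, s, rfl⟩ := Submodule.mem_span_pair.1 hz
  exact ⟨r, s, by simpa using hy⟩

theorem exists_eq_smul_of_finrank_le_one {V : Type*} [AddCommGroup V] [Module ℝ V]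
    [FiniteDimensional ℝ V] {C : Submodule ℝ V} {z : V} (h : finrank ℝ C ≤ 1) (hz : z ∈ C)
    (hz₀ : z ≠ 0) {v : V} (hv : v ∈ C) : ∃ r : ℝ, v = r • z := by
  obtain ⟨r, hr⟩ := exists_sub_smul_mem
    (le_sup_span_of_finrank_le (bot_le (a := C)) (by rwa [finrank_bot]) hz (by simpa using hz₀)) hv
  exact ⟨r, sub_eq_zero.1 (by simpa using hr)⟩

namespace IsLieFiltration

variable {A B C : Submodule ℝ g}

theorem exists_lie_notMem (F : IsLieFiltration A B C) : ∃ x y : g, ⁅x, y⁆ ∉ B := by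
  by_contra! h
  exact F.not_le₁ (F.gen₁ B h)

variable [FiniteDimensional ℝ g]

/-- The case `dim A/B = 1` and `dim g/A = 3`. -/
theorem exists_of_lie_notMem (F : IsLieFiltration A B C) (hdim : finrank ℝ g = 7)
    (hA : finrank ℝ A = 4) (hB : finrank ℝ B = 3) {x y : g} (hxy : ⁅x, y⁆ ∉ B) :
    ∃ u : g, (∀ S : Submodule ℝ g, A ≤ S → x ∈ S → y ∈ S → u ∈ S → S = ⊤) ∧
      ⁅x, u⁆ ∈ B ∧ ⁅y, u⁆ ∈ B ∧ A ≤ B ⊔ Submodule.span ℝ {⁅x, y⁆} ∧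
      B ≤ C ⊔ Submodule.span ℝ {⁅x, ⁅x, y⁆⁆, ⁅y, ⁅x, y⁆⁆} ∧
      C ≤ Submodule.span ℝ {⁅x, ⁅x, ⁅x, y⁆⁆⁆, ⁅x, ⁅y, ⁅x, y⁆⁆⁆, ⁅y, ⁅y, ⁅x, y⁆⁆⁆} := by
  have hAB : A ≤ B ⊔ Submodule.span ℝ {⁅x, y⁆} :=
    le_sup_span_of_finrank_le F.le₁ (by omega) (F.lie₀ x y) hxy
  set L : Submodule ℝ g := B.comap (LieModule.toEnd ℝ g g x) ⊓ B.comap (LieModule.toEnd ℝ g g y)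
    with hL
  have memL : ∀ u, u ∈ L ↔ ⁅x, u⁆ ∈ B ∧ ⁅y, u⁆ ∈ B := fun u => by simp [hL]
  have hAL : A ≤ L := fun u hu => (memL u).2 ⟨F.lie₁ _ _ hu, F.lie₁ _ _ hu⟩
  have hLtop : ∀ S : Submodule ℝ g, L ≤ S → x ∈ S → y ∈ S → S = ⊤ := by
    refine fun S hS hx hy => Submodule.eq_top_iff'.2 fun u => ?_
    obtain ⟨r, hr⟩ := exists_sub_smul_mem hAB (F.lie₀ x u)
    obtain ⟨s, hs⟩ := exists_sub_smul_mem hAB (F.lie₀ y u)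
    have : u - r • y + s • x ∈ L := by
      refine (memL _).2 ⟨by simpa using hr, ?_⟩
      have e : ⁅y, u - r • y + s • x⁆ = ⁅y, u⁆ - s • ⁅x, y⁆ := by
        rw [lie_add, lie_sub, lie_smul, lie_smul, lie_self, ← lie_skew y x]
        module
      rwa [e]
    rw [show u = (u - r • y + s • x) + r • y - s • x by abel]
    exact S.sub_mem (S.add_mem (hS this) (S.smul_mem r hy)) (S.smul_mem s hx)
  have hL5 : finrank ℝ L + 2 ≤ finrank ℝ (⊤ : Submodule ℝ g) := by
    refine finrank_add_two_le le_top (Submodule.mem_top (x := x)) (Submodule.mem_top (x := y))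
      (fun hx => hxy (lie_mem_submodule_comm.1 ((memL x).1 hx).2)) fun hy => ?_
    obtain ⟨r, hr⟩ := exists_sub_smul_mem le_rfl hy
    exact hxy (by simpa using ((memL _).1 hr).1)
  rw [finrank_top] at hL5
  obtain ⟨u, hu, hLu⟩ := exists_le_sup_span_of_finrank_le_one hAL (by omega)
  have htop : ∀ S : Submodule ℝ g, A ≤ S → x ∈ S → y ∈ S → u ∈ S → S = ⊤ :=
    fun S hA hx hy hu => hLtop S (hLu.trans (sup_span_le hA hu)) hx hy
  have hX : ⊤ ≤ A ⊔ Submodule.span ℝ {x, y, u} :=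
    (htop _ le_sup_left (Submodule.mem_sup_right (Submodule.subset_span (by simp)))
      (Submodule.mem_sup_right (Submodule.subset_span (by simp)))
      (Submodule.mem_sup_right (Submodule.subset_span (by simp)))).ge
  obtain ⟨hxu, hyu⟩ := (memL u).1 hu
  have hb := F.lie₀ x y
  have hub : ⁅u, ⁅x, y⁆⁆ ∈ C := by
    rw [leibniz_lie u x y]
    refine C.add_mem (lie_mem_submodule_comm.1 (F.lie₂ _ _ (lie_mem_submodule_comm.1 hxu)))
      (F.lie₂ _ _ (lie_mem_submodule_comm.1 hyu))
  have huc : ∀ v : g, ⁅v, u⁆ ∈ B → ⁅u, ⁅v, ⁅x, y⁆⁆⁆ = 0 := fun v hv => by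
    rw [leibniz_lie u v, F.lie₃ v _ hub, add_zero, ← lie_skew,
      F.lie₁₂ _ hb _ (lie_mem_submodule_comm.1 hv), neg_zero]
  have hc : B ≤ C ⊔ Submodule.span ℝ {⁅x, ⁅x, y⁆⁆, ⁅y, ⁅x, y⁆⁆} := by
    refine F.gen₂ _ fun u v hv => lie_mem_of_span hX hAB ?_
      (fun u v hv => Submodule.mem_sup_left (F.lie₂ u v hv))
      (fun u hu v hv => Submodule.mem_sup_left (F.lie₁₁ u hu v hv)) u hv
    rintro u (rfl | rfl | rfl) v rfl
    · exact Submodule.mem_sup_right (Submodule.subset_span (by simp))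
    · exact Submodule.mem_sup_right (Submodule.subset_span (by simp))
    · exact Submodule.mem_sup_left hub
  have hj := lie_lie_lie_swap x y
  have hux := huc x hxu
  have huy := huc y hyu
  refine ⟨u, htop, hxu, hyu, hAB, hc, F.gen₃ _ fun u v hv => lie_mem_of_span hX hc ?_
      (fun u v hv => by simp [F.lie₃ u v hv])
      (fun u hu v hv => by simp [F.lie₁₂ u hu v hv]) u hv⟩
  rintro u (rfl | rfl | rfl) v (rfl | rfl)
  all_goals try simp only [hj, hux, huy, Submodule.zero_mem]
  all_goals exact Submodule.subset_span (by simp)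

theorem exists_lie_lie_lie_ne_zero (F : IsLieFiltration A B C) (hdim : finrank ℝ g = 7)
    (hA : finrank ℝ A = 4) (hB : finrank ℝ B = 3) :
    ∃ x y : g, ⁅x, y⁆ ∉ B ∧ ⁅x, ⁅x, ⁅x, y⁆⁆⁆ ≠ 0 := by
  obtain ⟨x, y, hxy⟩ := F.exists_lie_notMem
  by_contra! h
  have hyx : ⁅y, x⁆ = -⁅x, y⁆ := (lie_skew y x).symm
  have h₁ := h x y hxy
  have h₂ : ⁅y, ⁅y, ⁅x, y⁆⁆⁆ = 0 := by
    have := h y x (by rwa [hyx, B.neg_mem_iff])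
    rwa [hyx, lie_neg, lie_neg, neg_eq_zero] at this
  have h₃ : ⁅x, ⁅y, ⁅x, y⁆⁆⁆ = 0 := by
    have := h (x + y) y (by simpa using hxy)
    simpa [lie_lie_lie_swap, h₁, h₂, ← two_smul ℝ] using this
  obtain ⟨u, -, -, -, -, -, hC⟩ := F.exists_of_lie_notMem hdim hA hB hxy
  exact F.not_le₃ (by simpa [h₁, h₂, h₃] using hC)

theorem finrank_le_one_of_finrank_eq_three (F : IsLieFiltration A B C) (hdim : finrank ℝ g = 7)
    (hA : finrank ℝ A = 4) (hB : finrank ℝ B = 3) {x y : g} (hxy : ⁅x, y⁆ ∉ B)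
    (hz : ⁅x, ⁅x, ⁅x, y⁆⁆⁆ ≠ 0) : finrank ℝ C ≤ 1 := by
  obtain ⟨u, -, -, -, -, -, hC⟩ := F.exists_of_lie_notMem hdim hA hB hxy
  by_contra! hC2
  have hb := F.lie₀ x y
  obtain ⟨r, hr⟩ := exists_sub_smul_mem (le_sup_span_of_finrank_le F.le₂ (by omega) (F.lie₁ x _ hb)
    fun h => hz (F.lie₃ _ _ h)) (F.lie₁ y _ hb)
  have e₁ : ⁅x, ⁅y, ⁅x, y⁆⁆⁆ = r • ⁅x, ⁅x, ⁅x, y⁆⁆⁆ := by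
    simpa [sub_eq_zero] using F.lie₃ x _ hr
  have e₂ : ⁅y, ⁅y, ⁅x, y⁆⁆⁆ = r • r • ⁅x, ⁅x, ⁅x, y⁆⁆⁆ := by
    simpa [sub_eq_zero, lie_lie_lie_swap, e₁] using F.lie₃ y _ hr
  have h := Submodule.finrank_mono (hC.trans (Submodule.span_le.2 (by
    rintro _ (rfl | rfl | rfl)
    · exact Submodule.mem_span_singleton_self _
    · exact Submodule.mem_span_singleton.2 ⟨r, e₁.symm⟩
    · exact Submodule.mem_span_singleton.2 ⟨r * r, by rw [e₂, smul_smul]⟩)) :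
    C ≤ Submodule.span ℝ {⁅x, ⁅x, ⁅x, y⁆⁆⁆})
  rw [finrank_span_singleton hz] at h
  omega

theorem admits_of_finrank_eq_three (F : IsLieFiltration A B C) [LieRing.IsNilpotent g]
    (hdim : finrank ℝ g = 7) (hA : finrank ℝ A = 4) (hB : finrank ℝ B = 3) :
    AdmitsPurelyCoclosedG2 g := by
  obtain ⟨x, y₀, hxy₀, hz₀⟩ := F.exists_lie_lie_lie_ne_zero hdim hA hB
  have hC1 := F.finrank_le_one_of_finrank_eq_three hdim hA hB hxy₀ hz₀
  obtain ⟨y, hxy, hz, hxc₂⟩ : ∃ y : g, ⁅x, y⁆ ∉ B ∧ ⁅x, ⁅x, ⁅x, y⁆⁆⁆ ≠ 0 ∧ ⁅x, ⁅y, ⁅x, y⁆⁆⁆ = 0 :=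
      by
    have hb := F.lie₀ x y₀
    obtain ⟨r, hr⟩ := exists_eq_smul_of_finrank_le_one hC1 (F.lie₂ x _ (F.lie₁ x _ hb)) hz₀
      (F.lie₂ x _ (F.lie₁ y₀ _ hb))
    exact ⟨y₀ - r • x, by simpa using hxy₀, by simpa using hz₀, by simp [hr]⟩
  obtain ⟨u₀, htop, hxu, hyu, hAB, hBC, -⟩ := F.exists_of_lie_notMem hdim hA hB hxy
  have hb := F.lie₀ x y
  have hc₁ := F.lie₁ x _ hb
  have hc₂ := F.lie₁ y _ hb
  have hzC := F.lie₂ x _ hc₁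
  have hyc₁ : ⁅y, ⁅x, ⁅x, y⁆⁆⁆ = 0 := by rw [lie_lie_lie_swap, hxc₂]
  have hC : ∀ v ∈ C, ∃ r : ℝ, v = r • ⁅x, ⁅x, ⁅x, y⁆⁆⁆ :=
    fun v hv => exists_eq_smul_of_finrank_le_one hC1 hzC hz hv
  have hBv : ∀ v ∈ B, ∃ p q r : ℝ,
      v = p • ⁅x, ⁅x, y⁆⁆ + q • ⁅y, ⁅x, y⁆⁆ + r • ⁅x, ⁅x, ⁅x, y⁆⁆⁆ := fun v hv => by
    obtain ⟨p, q, h⟩ := exists_sub_smul_sub_smul_mem hBC hv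
    obtain ⟨r, hr⟩ := hC _ h
    exact ⟨p, q, r, by rw [← hr]; abel⟩
  obtain ⟨α, β, μ₁, e₁⟩ := hBv _ hxu
  obtain ⟨a, γ, μ, e₂⟩ := hBv _ hyu
  obtain ⟨e, he⟩ := hC _ (F.lie₂ y _ hc₂)
  set u := u₀ - α • ⁅x, y⁆ - μ₁ • ⁅x, ⁅x, y⁆⁆ with hu
  have hxu' : ⁅x, u⁆ = β • ⁅y, ⁅x, y⁆⁆ := by
    simp only [hu, lie_sub, lie_smul, e₁]
    abel
  have hyu' : ⁅y, u⁆ = a • ⁅x, ⁅x, y⁆⁆ + (γ - α) • ⁅y, ⁅x, y⁆⁆ + μ • ⁅x, ⁅x, ⁅x, y⁆⁆⁆ := by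
    simp only [hu, lie_sub, lie_smul, e₂, hyc₁]
    module
  have hub : ⁅u, ⁅x, y⁆⁆ = (e * β - a) • ⁅x, ⁅x, ⁅x, y⁆⁆⁆ := by
    rw [leibniz_lie u x y, ← lie_skew u x, ← lie_skew u y, hxu', hyu']
    simp only [lie_neg, neg_lie, lie_add, lie_smul, smul_lie, hxc₂, F.lie₃ _ _ hzC]
    rw [← lie_skew, he]
    module
  have huc : ∀ v : g, ⁅v, u⁆ ∈ B → ⁅u, ⁅v, ⁅x, y⁆⁆⁆ = 0 := fun v hv => by
    rw [leibniz_lie u v, hub, lie_smul, F.lie₃ v _ hzC, smul_zero, add_zero, ← lie_skew,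
      F.lie₁₂ _ hb _ (lie_mem_submodule_comm.1 hv), neg_zero]
  refine HasBrackets.admits_III_of (x₁ := x) (x₂ := y) (x₃ := u) (x₄ := ⁅x, y⁆)
    (x₅ := ⁅x, ⁅x, y⁆⁆) (x₆ := ⁅y, ⁅x, y⁆⁆) (x₇ := ⁅x, ⁅x, ⁅x, y⁆⁆⁆) (A := a) (B := β) (e := e)
    (γ := γ - α) (μ := μ) hdim
    ⟨fun S h₁ h₂ h₃ h₄ h₅ h₆ h₇ => ?_, rfl, hxu', rfl, rfl, hxc₂, hyu', rfl, hyc₁, he, hub,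
      huc x (hxu' ▸ B.smul_mem _ hc₂), huc y ?_, F.lie₁₂ _ hb _ hc₁, F.lie₁₂ _ hb _ hc₂,
      F.lie₁₂ _ (F.le₁ hc₁) _ hc₂, fun u => F.lie₃ _ _ hzC⟩
  · have hCS : C ≤ S := fun v hv => by
      obtain ⟨r, rfl⟩ := hC v hv
      exact S.smul_mem r h₇
    have hBS : B ≤ S :=
      hBC.trans (sup_span_le_of_forall_mem hCS (by rintro _ (rfl | rfl) <;> assumption))
    refine htop S (hAB.trans (sup_span_le hBS h₄)) h₁ h₂ ?_
    rw [show u₀ = u + α • ⁅x, y⁆ + μ₁ • ⁅x, ⁅x, y⁆⁆ by rw [hu]; abel]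
    exact S.add_mem (S.add_mem h₃ (S.smul_mem _ h₄)) (S.smul_mem _ h₅)
  · rw [hyu']
    exact B.add_mem (B.add_mem (B.smul_mem _ hc₁) (B.smul_mem _ hc₂)) (B.smul_mem _ (F.le₂ hzC))

end IsLieFiltration

/-- The vectors `x`, `y`, `u` span `g` modulo `A`. -/
def SpansModulo (A : Submodule ℝ g) (x y u : g) : Prop :=
  ∀ S : Submodule ℝ g, A ≤ S → x ∈ S → y ∈ S → u ∈ S → S = ⊤

namespace SpansModulo

variable {A B C : Submodule ℝ g} {x y u : g}

theorem top_le (h : SpansModulo A x y u) : ⊤ ≤ A ⊔ Submodule.span ℝ {x, y, u} :=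
  (h _ le_sup_left (Submodule.mem_sup_right (Submodule.subset_span (by simp)))
    (Submodule.mem_sup_right (Submodule.subset_span (by simp)))
    (Submodule.mem_sup_right (Submodule.subset_span (by simp)))).ge

theorem lie_eq_zero (h : SpansModulo A x y u) {w : g} (hA : ∀ v ∈ A, ⁅v, w⁆ = 0)
    (hx : ⁅x, w⁆ = 0) (hy : ⁅y, w⁆ = 0) (hu : ⁅u, w⁆ = 0) (v : g) : ⁅v, w⁆ = 0 := by
  have hm : ∀ {v : g}, v ∈ LinearMap.ker (LieModule.toEnd ℝ g g w) ↔ ⁅v, w⁆ = 0 := fun {v} => by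
    rw [← lie_skew v w, neg_eq_zero]
    simp
  have := h _ (fun v hv => hm.2 (hA v hv)) (hm.2 hx) (hm.2 hy) (hm.2 hu)
  exact hm.1 (this ▸ Submodule.mem_top)

theorem swap (h : SpansModulo A x y u) : SpansModulo A x u y :=
  fun S hA hx hy hu => h S hA hx hu hy

theorem le_of_lie_mem (h : SpansModulo A x y u) (F : IsLieFiltration A B C) (hyu : ⁅y, u⁆ ∈ B) :
    A ≤ B ⊔ Submodule.span ℝ {⁅x, y⁆, ⁅x, u⁆} := by
  have hy : ⁅x, y⁆ ∈ B ⊔ Submodule.span ℝ {⁅x, y⁆, ⁅x, u⁆} :=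
    Submodule.mem_sup_right (Submodule.subset_span (by simp))
  have hu : ⁅x, u⁆ ∈ B ⊔ Submodule.span ℝ {⁅x, y⁆, ⁅x, u⁆} :=
    Submodule.mem_sup_right (Submodule.subset_span (by simp))
  have hyu' : ⁅y, u⁆ ∈ B ⊔ Submodule.span ℝ {⁅x, y⁆, ⁅x, u⁆} := Submodule.mem_sup_left hyu
  have hBS : B ≤ B ⊔ Submodule.span ℝ {⁅x, y⁆, ⁅x, u⁆} := le_sup_left
  generalize B ⊔ Submodule.span ℝ {⁅x, y⁆, ⁅x, u⁆} = S at *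
  have hy' := lie_mem_submodule_comm.1 hy
  have hu' := lie_mem_submodule_comm.1 hu
  have hyu'' := lie_mem_submodule_comm.1 hyu'
  refine F.gen₁ _ fun v w => lie_mem_of_span h.top_le h.top_le ?_ (fun v w hw => hBS (F.lie₁ v w
      hw))
    (fun v hv w _ => hBS (lie_mem_submodule_comm.1 (F.lie₁ w v hv))) v Submodule.mem_top
  rintro v (rfl | rfl | rfl) w (rfl | rfl | rfl) <;> first | assumption | simp

end SpansModulo

namespace IsLieFiltration

variable {A B C : Submodule ℝ g} {x y u : g}

theorem le_of_spansModulo (F : IsLieFiltration A B C) (h : SpansModulo A x y u) (hyu : ⁅y, u⁆ ∈ B)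
    (h₁ : ⁅x, ⁅x, y⁆⁆ ∈ C) (h₂ : ⁅x, ⁅x, u⁆⁆ ∈ C) (h₃ : ⁅y, ⁅x, y⁆⁆ ∈ C) (h₄ : ⁅y, ⁅x, u⁆⁆ ∈ C)
    (h₅ : ⁅u, ⁅x, y⁆⁆ ∈ C) (h₆ : ⁅u, ⁅x, u⁆⁆ ∈ C) : False := by
  refine F.not_le₂ (F.gen₂ _ fun v w hw => lie_mem_of_span h.top_le (h.le_of_lie_mem F hyu) ?_
      F.lie₂
    F.lie₁₁ v hw)
  rintro v (rfl | rfl | rfl) w (rfl | rfl) <;> assumption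

variable [FiniteDimensional ℝ g]

theorem mem_of_forall_lie_eq_zero (F : IsLieFiltration A B C) (hBC : finrank ℝ B ≤ finrank ℝ C + 1)
    {w : g} (hw : w ∈ B) (hc : ∀ v : g, ⁅v, w⁆ = 0) : w ∈ C := by
  by_contra hwC
  have hB := le_sup_span_of_finrank_le F.le₂ hBC hw hwC
  refine F.not_le₃ (F.gen₃ _ fun v y hy => ?_)
  obtain ⟨r, hr⟩ := exists_sub_smul_mem hB hy
  have := F.lie₃ v _ hr
  simpa [hc v] using this

theorem exists_spansModulo (F : IsLieFiltration A B C) (hdim : finrank ℝ g = 7)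
    (hA : finrank ℝ A = 4) (hB : finrank ℝ B = 2) :
    ∃ x y u : g, SpansModulo A x y u ∧ ⁅y, u⁆ ∈ B := by
  obtain ⟨x, -, y, -, u, -, hxyu⟩ := exists_le_sup_span_of_finrank_le_three (le_top (a := A))
    (by rw [finrank_top]; omega)
  have h : SpansModulo A x y u := fun S hA hx hy hu => top_le_iff.1 (hxyu.trans
    (sup_span_le_of_forall_mem hA (by rintro _ (rfl | rfl | rfl) <;> assumption)))
  obtain ⟨r, s, t, hrst, e⟩ := exists_relation_of_finrank_le_two F.le₁ (by omega)
    (F.lie₀ x y) (F.lie₀ x u) (F.lie₀ y u)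
  by_cases ht : t = 0
  · by_cases hs : s = 0
    · have hr : r ≠ 0 := by simpa [hs, ht] using hrst
      exact ⟨u, x, y, fun S hA hu hx hy => h S hA hx hy hu,
        by simpa [hs, ht, B.smul_mem_iff hr] using e⟩
    · refine ⟨y, x, r • y + s • u, fun S hA hy hx hu => h S hA hx hy ?_, by simpa [ht] using e⟩
      rwa [S.add_mem_iff_right (S.smul_mem r hy), S.smul_mem_iff hs] at hu
  · refine ⟨x, y + (s / t) • x, u + (-(r / t)) • x, fun S hA hx hy hu =>
      h S hA hx (mem_of_add_smul_mem _ hy hx) (mem_of_add_smul_mem _ hu hx), ?_⟩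
    convert B.smul_mem (1 / t) e using 1
    simp only [lie_add, add_lie, lie_smul, smul_lie, lie_self]
    rw [← lie_skew y x]
    match_scalars <;> field_simp

end IsLieFiltration

namespace IsLieFiltration

variable {A B C : Submodule ℝ g} {x y u : g}

theorem lie_lie_lie_eq_zero (F : IsLieFiltration A B C) (hyu : ⁅y, u⁆ ∈ B)
    (hy : ∀ v ∈ B, ⁅y, v⁆ = 0) (hu : ∀ v ∈ B, ⁅u, v⁆ = 0) : ⁅⁅x, y⁆, ⁅x, u⁆⁆ = 0 := by
  have e₁ : ⁅x, ⁅y, ⁅x, u⁆⁆⁆ = ⁅⁅x, y⁆, ⁅x, u⁆⁆ := by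
    rw [leibniz_lie x y, hy _ (F.lie₁ x _ (F.lie₀ x u)), add_zero]
  have e₂ : ⁅x, ⁅u, ⁅x, y⁆⁆⁆ = -⁅⁅x, y⁆, ⁅x, u⁆⁆ := by
    rw [leibniz_lie x u, hu _ (F.lie₁ x _ (F.lie₀ x y)), add_zero, lie_skew]
  have e₃ : ⁅y, ⁅x, u⁆⁆ = ⁅u, ⁅x, y⁆⁆ + ⁅x, ⁅y, u⁆⁆ := by
    rw [leibniz_lie y x u, ← lie_skew ⁅y, x⁆, ← lie_skew y x, lie_neg, neg_neg]
  rw [e₃, lie_add, e₂, F.lie₃ x _ (F.lie₂ x _ hyu), add_zero] at e₁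
  rw [neg_eq_iff_add_eq_zero, ← two_smul ℝ] at e₁
  exact (smul_eq_zero.1 e₁).resolve_left two_ne_zero

variable [FiniteDimensional ℝ g]

theorem admits_or_hasStructure_of_lie_eq_zero (F : IsLieFiltration A B C) [LieRing.IsNilpotent g]
    (hdim : finrank ℝ g = 7) (hBC : finrank ℝ B ≤ finrank ℝ C + 1) (hC : finrank ℝ C ≤ 1)
    (h : SpansModulo A x y u) (hyu : ⁅y, u⁆ ∈ B) (hy : ∀ v ∈ B, ⁅y, v⁆ = 0)
    (hu : ∀ v ∈ B, ⁅u, v⁆ = 0) (hc : ⁅x, ⁅x, y⁆⁆ ∉ C) (hxu : ⁅x, ⁅x, u⁆⁆ = 0) :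
    AdmitsPurelyCoclosedG2 g ∨ HasStructure1357E g ∨ HasStructure1357Nminus2 g := by
  have hb₁ := F.lie₀ x y
  have hb₂ := F.lie₀ x u
  have hcB := F.lie₁ x _ hb₁
  have hzC := F.lie₂ x _ hcB
  have hkey : ∀ w ∈ B, ⁅x, w⁆ = 0 → w ∈ C := fun w hw hxw =>
    F.mem_of_forall_lie_eq_zero hBC hw (h.lie_eq_zero (fun v hv => F.lie₁₂ v hv w hw) hxw
      (hy w hw) (hu w hw))
  have hz : ⁅x, ⁅x, ⁅x, y⁆⁆⁆ ≠ 0 := fun e => hc (hkey _ hcB e)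
  have hCz : ∀ v ∈ C, ∃ r : ℝ, v = r • ⁅x, ⁅x, ⁅x, y⁆⁆⁆ :=
    fun v hv => exists_eq_smul_of_finrank_le_one hC hzC hz hv
  have hBc := le_sup_span_of_finrank_le F.le₂ hBC hcB hc
  have hAB := h.le_of_lie_mem F hyu
  have hbb := F.lie_lie_lie_eq_zero (x := x) hyu hy hu
  obtain ⟨a, ha⟩ := hCz _ (hkey _ (F.lie₁ y _ hb₁) (by
    rw [leibniz_lie x y, lie_self, hy _ hcB, add_zero]))
  obtain ⟨k, hk⟩ := hCz _ (hkey _ (F.lie₁ y _ hb₂) (by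
    rw [leibniz_lie x y, hbb, hxu, lie_zero, add_zero]))
  obtain ⟨m, hm⟩ := hCz _ (hkey _ (F.lie₁ u _ hb₁) (by
    rw [leibniz_lie x u, ← lie_skew, hbb, hu _ hcB, neg_zero, add_zero]))
  obtain ⟨κ, hκ⟩ := hCz _ (hkey _ (F.lie₁ u _ hb₂) (by
    rw [leibniz_lie x u, lie_self, hxu, lie_zero, add_zero]))
  obtain ⟨t, ht⟩ := exists_sub_smul_mem hBc hyu
  obtain ⟨w, hw⟩ := hCz _ ht
  rw [sub_eq_iff_eq_add'] at hw
  have hkm : k • ⁅x, ⁅x, ⁅x, y⁆⁆⁆ = (m + t) • ⁅x, ⁅x, ⁅x, y⁆⁆⁆ := by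
    rw [← hk, leibniz_lie y x u, hw, lie_add, lie_smul, lie_smul, F.lie₃ _ _ hzC, smul_zero,
      add_zero, ← lie_skew ⁅y, x⁆, ← lie_skew y x, lie_neg, neg_neg, hm, add_smul]
  refine HasBrackets.admits_or_hasStructure_of_A (x₁ := x) (x₂ := y) (x₃ := u) (x₄ := ⁅x, y⁆)
    (x₅ := ⁅x, u⁆) (x₆ := ⁅x, ⁅x, y⁆⁆) (x₇ := ⁅x, ⁅x, ⁅x, y⁆⁆⁆) (t := t) (h := m) (a := a)
    (κ := κ) (w := w) hdim
    ⟨fun S h₁ h₂ h₃ h₄ h₅ h₆ h₇ => ?_, rfl, rfl, rfl, hxu, rfl, hw, ha, hk.trans hkm, hy _ hcB,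
      hm, hκ, hu _ hcB, hbb, F.lie₁₂ _ hb₁ _ hcB, F.lie₁₂ _ hb₂ _ hcB, fun u => F.lie₃ _ _ hzC⟩
  · have hCS : C ≤ S := fun v hv => by
      obtain ⟨r, rfl⟩ := hCz v hv
      exact S.smul_mem r h₇
    refine h S (hAB.trans (sup_span_le_of_forall_mem (hBc.trans (sup_span_le hCS h₆)) ?_)) h₁ h₂ h₃
    rintro _ (rfl | rfl) <;> assumption

/-- The case in which `y` and `u` centralize `⁅g, ⁅g, g⁆⁆`. -/
theorem admits_or_hasStructure_of_forall_lie_eq_zero (F : IsLieFiltration A B C)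
    [LieRing.IsNilpotent g] (hdim : finrank ℝ g = 7) (hBC : finrank ℝ B ≤ finrank ℝ C + 1)
    (hC : finrank ℝ C ≤ 1) (h : SpansModulo A x y u) (hyu : ⁅y, u⁆ ∈ B) (hy : ∀ v ∈ B, ⁅y, v⁆ = 0)
    (hu : ∀ v ∈ B, ⁅u, v⁆ = 0) (hc : ⁅x, ⁅x, y⁆⁆ ∉ C) :
    AdmitsPurelyCoclosedG2 g ∨ HasStructure1357E g ∨ HasStructure1357Nminus2 g := by
  have hb₁ := F.lie₀ x y
  have hcB := F.lie₁ x _ hb₁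
  have hzC := F.lie₂ x _ hcB
  have hz : ⁅x, ⁅x, ⁅x, y⁆⁆⁆ ≠ 0 := fun e => hc (F.mem_of_forall_lie_eq_zero hBC hcB
    (h.lie_eq_zero (fun v hv => F.lie₁₂ v hv _ hcB) e (hy _ hcB) (hu _ hcB)))
  have hBc := le_sup_span_of_finrank_le F.le₂ hBC hcB hc
  obtain ⟨r, hr⟩ := exists_sub_smul_mem hBc (F.lie₁ x _ (F.lie₀ x u))
  obtain ⟨s, hs⟩ := exists_eq_smul_of_finrank_le_one hC hzC hz hr
  rw [sub_eq_iff_eq_add'] at hs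
  refine F.admits_or_hasStructure_of_lie_eq_zero (u := u - r • y - s • ⁅x, y⁆) hdim hBC hC
    (fun S hA hx hy hu => h S hA hx hy ?_) ?_ hy (fun v hv => ?_) hc ?_
  · rw [show u = (u - r • y - s • ⁅x, y⁆) + r • y + s • ⁅x, y⁆ by abel]
    exact S.add_mem (S.add_mem hu (S.smul_mem _ hy)) (S.smul_mem _ (hA hb₁))
  · simpa using B.sub_mem hyu (B.smul_mem s (F.lie₁ y _ hb₁))
  · simp [hu v hv, hy v hv, F.lie₁₂ _ hb₁ v hv]
  · simp [hs]

end IsLieFiltration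

namespace IsLieFiltration

variable [FiniteDimensional ℝ g] {A B C : Submodule ℝ g} {x y u : g}

theorem lie_lie_notMem_or (F : IsLieFiltration A B C) (hBC : finrank ℝ B ≤ finrank ℝ C + 1)
    (h : SpansModulo A x y u) (hyu : ⁅y, u⁆ ∈ B) (hy : ∀ v ∈ B, ⁅y, v⁆ = 0)
    (hu : ∀ v ∈ B, ⁅u, v⁆ = 0) : ⁅x, ⁅x, y⁆⁆ ∉ C ∨ ⁅x, ⁅x, u⁆⁆ ∉ C := by
  by_contra! hc
  have hb₁ := F.lie₀ x y
  have hb₂ := F.lie₀ x u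
  have hkey : ∀ w ∈ B, ⁅x, w⁆ = 0 → w ∈ C := fun w hw hxw =>
    F.mem_of_forall_lie_eq_zero hBC hw (h.lie_eq_zero (fun v hv => F.lie₁₂ v hv w hw) hxw
      (hy w hw) (hu w hw))
  have hbb := F.lie_lie_lie_eq_zero (x := x) hyu hy hu
  refine F.le_of_spansModulo h hyu hc.1 hc.2 (hkey _ (F.lie₁ y _ hb₁) ?_)
    (hkey _ (F.lie₁ y _ hb₂) ?_) (hkey _ (F.lie₁ u _ hb₁) ?_) (hkey _ (F.lie₁ u _ hb₂) ?_)
  · rw [leibniz_lie x y, lie_self, hy _ (F.lie₁ x _ hb₁), add_zero]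
  · rw [leibniz_lie x y, hbb, hy _ (F.lie₁ x _ hb₂), add_zero]
  · rw [leibniz_lie x u, ← lie_skew, hbb, hu _ (F.lie₁ x _ hb₁), neg_zero, add_zero]
  · rw [leibniz_lie x u, lie_self, hu _ (F.lie₁ x _ hb₂), add_zero]

/-- The case in which `x` and `u` centralize `⁅g, ⁅g, g⁆⁆`. -/
theorem admits_of_forall_lie_eq_zero (F : IsLieFiltration A B C) [LieRing.IsNilpotent g]
    (hdim : finrank ℝ g = 7) (hBC : finrank ℝ B ≤ finrank ℝ C + 1) (hC : finrank ℝ C ≤ 1)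
    (h : SpansModulo A x y u) (hyu : ⁅y, u⁆ ∈ B) (hx : ∀ v ∈ B, ⁅x, v⁆ = 0)
    (hu : ∀ v ∈ B, ⁅u, v⁆ = 0) : AdmitsPurelyCoclosedG2 g := by
  have hkey : ∀ w ∈ B, ⁅y, w⁆ = 0 → w ∈ C := fun w hw hyw =>
    F.mem_of_forall_lie_eq_zero hBC hw (h.lie_eq_zero (fun v hv => F.lie₁₂ v hv w hw) (hx w hw)
      hyw (hu w hw))
  have hxb : ∀ v ∈ B, ∀ w ∈ A, ⁅v, w⁆ = 0 := fun v hv w hw => by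
    rw [← lie_skew, F.lie₁₂ w hw v hv, neg_zero]
  have hxy : ⁅y, x⁆ = -⁅x, y⁆ := (lie_skew y x).symm
  have hb₁ := F.lie₀ x y
  have hb₂ := F.lie₀ x u
  have hcB := F.lie₁ y _ hb₁
  have hbb : ⁅⁅x, y⁆, ⁅x, u⁆⁆ = 0 := by
    rw [leibniz_lie ⁅x, y⁆ x u, ← lie_skew ⁅x, y⁆ u, lie_neg, hx _ (F.lie₁ u _ hb₁),
      ← lie_skew ⁅x, y⁆ x, neg_lie, ← lie_skew _ u, hu _ (F.lie₁ x _ hb₁)]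
    simp
  have h₁ : ⁅x, ⁅x, y⁆⁆ ∈ C := hkey _ (F.lie₁ x _ hb₁) (by
    rw [leibniz_lie y x, hxy, neg_lie, lie_self, hx _ hcB]
    simp)
  have h₂ : ⁅x, ⁅x, u⁆⁆ ∈ C := hkey _ (F.lie₁ x _ hb₂) (by
    rw [leibniz_lie y x, hxy, neg_lie, hbb, hx _ (F.lie₁ y _ hb₂)]
    simp)
  have h₃ : ⁅u, ⁅x, y⁆⁆ ∈ C := hkey _ (F.lie₁ u _ hb₁) (by
    rw [leibniz_lie y u, hxb _ hyu _ hb₁, hu _ hcB, add_zero])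
  have h₄ : ⁅u, ⁅x, u⁆⁆ ∈ C := hkey _ (F.lie₁ u _ hb₂) (by
    rw [leibniz_lie y u, hxb _ hyu _ hb₂, hu _ (F.lie₁ y _ hb₂), add_zero])
  have e₁ : ⁅y, ⁅x, u⁆⁆ = ⁅u, ⁅x, y⁆⁆ := by
    rw [leibniz_lie y x u, hxy, hx _ hyu, neg_lie, lie_skew, add_zero]
  have hc : ⁅y, ⁅x, y⁆⁆ ∉ C := fun hc => F.le_of_spansModulo h hyu h₁ h₂ hc (e₁ ▸ h₃) h₃ h₄
  have hzC := F.lie₂ y _ hcB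
  have hz : ⁅y, ⁅y, ⁅x, y⁆⁆⁆ ≠ 0 := fun e => hc (hkey _ hcB e)
  have hCz : ∀ v ∈ C, ∃ r : ℝ, v = r • ⁅y, ⁅y, ⁅x, y⁆⁆⁆ :=
    fun v hv => exists_eq_smul_of_finrank_le_one hC hzC hz hv
  have hBc := le_sup_span_of_finrank_le F.le₂ hBC hcB hc
  obtain ⟨t, ht⟩ := exists_sub_smul_mem hBc hyu
  obtain ⟨w, hw⟩ := hCz _ ht
  rw [sub_eq_iff_eq_add'] at hw
  set u' := u - t • ⁅x, y⁆ - w • ⁅y, ⁅x, y⁆⁆ with hu'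
  have hxu' : ⁅x, u'⁆ = ⁅x, u⁆ - t • ⁅x, ⁅x, y⁆⁆ := by
    simp [hu', hx _ hcB]
  have hyu' : ⁅y, u'⁆ = 0 := by
    simp [hu', hw]
  have huB : ∀ v ∈ B, ⁅u', v⁆ = 0 := fun v hv => by
    simp [hu', hu v hv, F.lie₁₂ _ hb₁ v hv, F.lie₁₂ _ (F.le₁ hcB) v hv]
  have huC : ∀ v ∈ A, ⁅u, v⁆ ∈ C → ⁅u', v⁆ ∈ C := fun v hv huv => by
    simp only [hu', sub_lie, smul_lie, hxb _ hcB v hv, smul_zero, sub_zero]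
    exact C.sub_mem huv (C.smul_mem _ (F.lie₁₁ _ hb₁ _ hv))
  have e₂ : ⁅y, ⁅x, u'⁆⁆ = ⁅u', ⁅x, y⁆⁆ := by
    rw [leibniz_lie y x u', hxy, hyu', neg_lie, lie_skew, lie_zero, add_zero]
  obtain ⟨p, hp⟩ := hCz _ h₁
  obtain ⟨q, hq⟩ : ∃ r : ℝ, ⁅x, ⁅x, u'⁆⁆ = r • ⁅y, ⁅y, ⁅x, y⁆⁆⁆ := hCz _ (by
    rw [hxu', lie_sub, lie_smul, F.lie₃ x _ h₁, smul_zero, sub_zero]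
    exact h₂)
  obtain ⟨s, hs⟩ := hCz _ (huC _ hb₁ h₃)
  obtain ⟨r, hr⟩ : ∃ r : ℝ, ⁅u', ⁅x, u'⁆⁆ = r • ⁅y, ⁅y, ⁅x, y⁆⁆⁆ := hCz _ (by
    rw [hxu', lie_sub, lie_smul, F.lie₃ u' _ h₁, smul_zero, sub_zero]
    exact huC _ hb₂ h₄)
  have hxuA := F.lie₀ x u'
  have h' : SpansModulo A x y u' := fun S hA hx hy hu => h S hA hx hy (by
    rw [show u = u' + t • ⁅x, y⁆ + w • ⁅y, ⁅x, y⁆⁆ by rw [hu']; abel]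
    exact S.add_mem (S.add_mem hu (S.smul_mem _ (hA hb₁))) (S.smul_mem _ (hA (F.le₁ hcB))))
  have hAB := h'.le_of_lie_mem F (hyu' ▸ B.zero_mem)
  have hbb' : ⁅⁅x, y⁆, ⁅x, u'⁆⁆ = 0 := by
    rw [hxu', lie_sub, lie_smul, hbb, F.lie₃ _ _ h₁, smul_zero, sub_zero]
  refine HasBrackets.admits_B (x₁ := x) (x₂ := y) (x₃ := u') (x₄ := ⁅x, y⁆) (x₅ := ⁅x, u'⁆)
    (x₆ := ⁅y, ⁅x, y⁆⁆) (x₇ := ⁅y, ⁅y, ⁅x, y⁆⁆⁆) (p := p) (q := q) (r := r) (s := s) hdim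
    ⟨fun S h₁ h₂ h₃ h₄ h₅ h₆ h₇ => ?_, rfl, rfl, hp, hq, hx _ hcB, hyu', rfl, e₂.trans hs, rfl, hs,
      hr, huB _ hcB, hbb', F.lie₁₂ _ hb₁ _ hcB, F.lie₁₂ _ hxuA _ hcB, fun u => F.lie₃ _ _ hzC⟩
  have hCS : C ≤ S := fun v hv => by
    obtain ⟨r, rfl⟩ := hCz v hv
    exact S.smul_mem r h₇
  refine h' S (hAB.trans (sup_span_le_of_forall_mem (hBc.trans (sup_span_le hCS h₆)) ?_)) h₁ h₂ h₃
  rintro _ (rfl | rfl) <;> assumption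

theorem admits_or_hasStructure_of_finrank_eq_two (F : IsLieFiltration A B C)
    [LieRing.IsNilpotent g] (hdim : finrank ℝ g = 7) (hA : finrank ℝ A = 4)
    (hB : finrank ℝ B = 2) :
    AdmitsPurelyCoclosedG2 g ∨ HasStructure1357E g ∨ HasStructure1357Nminus2 g := by
  have hr := F.finrank_lt
  have hBC : finrank ℝ B ≤ finrank ℝ C + 1 := by omega
  have hC : finrank ℝ C ≤ 1 := by omega
  obtain ⟨x, y, u, h, hyu⟩ := F.exists_spansModulo hdim hA hB
  have hC0 : ∀ v ∈ C, ∀ w ∈ C, v ≠ 0 → ∃ r : ℝ, w = r • v := fun v hv w hw hv₀ =>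
    exists_eq_smul_of_finrank_le_one hC hv hv₀ hw
  have main : ∀ y u : g, SpansModulo A x y u → ⁅y, u⁆ ∈ B → ∀ c ∈ B, ⁅y, c⁆ ≠ 0 →
      AdmitsPurelyCoclosedG2 g := fun y u h hyu c hc hyc => by
    have hcC : c ∉ C := fun hcC => hyc (F.lie₃ _ _ hcC)
    have hBc := le_sup_span_of_finrank_le F.le₂ hBC hc hcC
    have hkill : ∀ v : g, ⁅v, c⁆ = 0 → ∀ w ∈ B, ⁅v, w⁆ = 0 := fun v hv w hw => by
      obtain ⟨r, hr⟩ := exists_sub_smul_mem hBc hw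
      simpa [hv] using F.lie₃ v _ hr
    obtain ⟨r, hr⟩ := exists_eq_smul_of_finrank_le_one hC (F.lie₂ y c hc) hyc (F.lie₂ x c hc)
    obtain ⟨s, hs⟩ := exists_eq_smul_of_finrank_le_one hC (F.lie₂ y c hc) hyc (F.lie₂ u c hc)
    refine F.admits_of_forall_lie_eq_zero (x := x + (-r) • y) (y := y) (u := u + (-s) • y) hdim hBC
      hC (fun S hA hx hy hu => h S hA (mem_of_add_smul_mem _ hx hy) hy (mem_of_add_smul_mem _ hu
          hy))
      (by simpa using hyu) (hkill _ (by simp [hr])) (hkill _ (by simp [hs]))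
  have huy := lie_mem_submodule_comm.1 hyu
  by_cases hy : ∀ v ∈ B, ⁅y, v⁆ = 0
  · by_cases hu : ∀ v ∈ B, ⁅u, v⁆ = 0
    · rcases F.lie_lie_notMem_or hBC h hyu hy hu with hc | hc
      · exact F.admits_or_hasStructure_of_forall_lie_eq_zero hdim hBC hC h hyu hy hu hc
      · exact F.admits_or_hasStructure_of_forall_lie_eq_zero hdim hBC hC h.swap huy hu hy hc
    · push Not at hu
      obtain ⟨c, hc, huc⟩ := hu
      exact .inl (main u y h.swap huy c hc huc)
  · push Not at hy
    obtain ⟨c, hc, hyc⟩ := hy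
    exact .inl (main y u h hyu c hc hyc)

end IsLieFiltration

namespace HasBrackets

variable {x₁ x₂ x₃ x₄ x₅ x₆ x₇ : g} {b₁₂ b₁₃ b₁₄ b₁₅ b₁₆ b₂₃ b₂₄ b₂₅ b₂₆ b₃₄ b₃₅ b₃₆
    b₄₅ b₄₆ b₅₆ : g}

theorem lie_eq_zero (H : HasBrackets x₁ x₂ x₃ x₄ x₅ x₆ x₇ b₁₂ b₁₃ b₁₄ b₁₅ b₁₆ b₂₃ b₂₄ b₂₅ b₂₆ b₃₄
    b₃₅ b₃₆ b₄₅ b₄₆ b₅₆) {w : g} (h₁ : ⁅x₁, w⁆ = 0) (h₂ : ⁅x₂, w⁆ = 0) (h₃ : ⁅x₃, w⁆ = 0)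
    (h₄ : ⁅x₄, w⁆ = 0) (h₅ : ⁅x₅, w⁆ = 0) (h₆ : ⁅x₆, w⁆ = 0) (v : g) : ⁅v, w⁆ = 0 := by
  have hm : ∀ {v : g}, v ∈ LinearMap.ker (LieModule.toEnd ℝ g g w) ↔ ⁅v, w⁆ = 0 := fun {v} => by
    rw [← lie_skew v w, neg_eq_zero]
    simp
  have := H.span _ (hm.2 h₁) (hm.2 h₂) (hm.2 h₃) (hm.2 h₄) (hm.2 h₅) (hm.2 h₆)
    (by simpa using H.central w)
  exact hm.1 (this ▸ Submodule.mem_top)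

set_option linter.unusedSimpArgs false

section

variable {s m n k p q : ℝ}

theorem hasStructure1457_of_ne_zero (hdim : finrank ℝ g = 7) (hk : k ≠ 0)
    (H : HasBrackets x₁ x₂ x₃ x₄ x₅ x₆ x₇ x₃ x₄ x₇ 0 0 (s • x₇) 0 (m • x₇) (n • x₇) 0 0 0 0 0
      (k • x₇)) : HasStructure1457A g ∨ HasStructure1457B g := by
  have R := H.rules
  refine hasStructure1457_of (x₁ := x₁) (x₂ := x₂ + (-n / k) • x₅ + (m / k) • x₆) (x₃ := x₃)
    (x₄ := x₄) (x₅ := x₅) (x₆ := x₆) (x₇ := x₇) hdim hk (s := s)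
    ⟨?_, ?_, ?_, ?_, ?_, ?_, ?_, ?_, ?_, ?_, ?_, ?_, ?_, ?_, ?_, ?_, ?_⟩
  · intro S s1 s2 s3 s4 s5 s6 s7
    exact H.span S s1 (mem_of_add_smul_mem _ (mem_of_add_smul_mem _ s2 s6) s5) s3 s4 s5 s6 s7
  all_goals simp only [lie_add, add_lie, lie_smul, smul_lie, R, lie_self, smul_zero, zero_smul,
    neg_zero, add_zero, zero_add, sub_zero, sub_self, implies_true, lie_neg, neg_lie, neg_neg]
  all_goals clear R H
  all_goals match_scalars
  all_goals field_simp
  all_goals ring1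

theorem admits_I_of_ne_zero (hdim : finrank ℝ g = 7) [LieRing.IsNilpotent g] (h : k ≠ 0 ∨ n ≠ 0)
    (H : HasBrackets x₁ x₂ x₃ x₄ x₅ x₆ x₇ x₃ x₄ x₇ 0 0 (s • x₇) 0 (x₄ + m • x₇) (n • x₇) 0 x₇ 0 0 0
      (k • x₇)) : AdmitsPurelyCoclosedG2 g := by
  have R := H.rules
  by_cases hk : k = 0
  · have hn : n ≠ 0 := h.resolve_left (not_not.2 hk)
    refine admits_I₀ (x₁ := x₁) (x₂ := x₂) (x₃ := x₃) (x₄ := x₄) (x₅ := x₅ + (-m / n) • x₆)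
      (x₆ := (1 / n) • x₆) (x₇ := x₇) hdim (s := s)
      ⟨?_, ?_, ?_, ?_, ?_, ?_, ?_, ?_, ?_, ?_, ?_, ?_, ?_, ?_, ?_, ?_, ?_⟩
    · intro S s1 s2 s3 s4 s5 s6 s7
      rw [S.smul_mem_iff (div_ne_zero one_ne_zero hn)] at s6
      exact H.span S s1 s2 s3 s4 (mem_of_add_smul_mem _ s5 s6) s6 s7
    all_goals simp only [lie_add, add_lie, lie_smul, smul_lie, R, lie_self, smul_zero, zero_smul,
      neg_zero, add_zero, zero_add, sub_zero, sub_self, implies_true, lie_neg, neg_lie, neg_neg, hk]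
    all_goals clear R H
    all_goals match_scalars
    all_goals field_simp
    all_goals ring1
  · refine admits_I₁ (x₁ := x₁ + (-m / 2) • x₅) (x₂ := x₂ + (-n / k) • x₅)
      (x₃ := x₃ + (m / 2) • x₄ + (m ^ 2 / 2) • x₇) (x₄ := x₄ + m • x₇) (x₅ := x₅)
      (x₆ := (1 / k) • x₆ + (m / 2) • x₄) (x₇ := x₇) hdim (s := s + n / k)
      ⟨?_, ?_, ?_, ?_, ?_, ?_, ?_, ?_, ?_, ?_, ?_, ?_, ?_, ?_, ?_, ?_, ?_⟩
    · intro S s1 s2 s3 s4 s5 s6 s7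
      have h4 := mem_of_add_smul_mem _ s4 s7
      have h6 := mem_of_add_smul_mem _ s6 h4
      rw [S.smul_mem_iff (div_ne_zero one_ne_zero hk)] at h6
      exact H.span S (mem_of_add_smul_mem _ s1 s5) (mem_of_add_smul_mem _ s2 s5)
        (mem_of_add_smul_mem _ (mem_of_add_smul_mem _ s3 s7) h4) h4 s5 h6 s7
    all_goals simp only [lie_add, add_lie, lie_smul, smul_lie, R, lie_self, smul_zero, zero_smul,
      neg_zero, add_zero, zero_add, sub_zero, sub_self, implies_true, lie_neg, neg_lie, neg_neg]
    all_goals clear R H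
    all_goals match_scalars
    all_goals field_simp
    all_goals ring1

theorem admits_I_of_central [LieRing.IsNilpotent g] (hdim : finrank ℝ g = 7) (hp : p ≠ 0)
    (hc : ∀ r t : ℝ, (∀ v : g, ⁅v, r • x₅ + t • x₆⁆ = 0) → r = 0 ∧ t = 0)
    (H : HasBrackets x₁ x₂ x₃ x₄ x₅ x₆ x₇ x₃ x₄ x₇ 0 0 (s • x₇) 0 (-p • x₄ + m • x₇)
      (-q • x₄ + n • x₇) 0 (-p • x₇) (-q • x₇) 0 0 (k • x₇)) : AdmitsPurelyCoclosedG2 g := by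
  have R := H.rules
  refine admits_I_of_ne_zero (x₁ := x₁) (x₂ := x₂) (x₃ := x₃) (x₄ := x₄) (x₅ := (-1 / p) • x₅)
    (x₆ := p • x₆ + (-q) • x₅) (x₇ := x₇) hdim (s := s) (m := -m / p) (n := p * n - q * m)
    (k := -k) ?_ ⟨?_, ?_, ?_, ?_, ?_, ?_, ?_, ?_, ?_, ?_, ?_, ?_, ?_, ?_, ?_, ?_, ?_⟩
  · by_contra! h
    obtain ⟨hk, hn⟩ := h
    rw [neg_eq_zero] at hk
    refine hp (hc (-q) p (H.lie_eq_zero ?_ ?_ ?_ ?_ ?_ ?_)).2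
    all_goals simp only [lie_add, add_lie, lie_smul, smul_lie, R, lie_self, smul_zero, zero_smul,
      neg_zero, add_zero, zero_add, sub_zero, sub_self, implies_true, hk]
    · rw [show (0 : g) = (p * n - q * m) • x₇ by rw [hn, zero_smul]]
      module
    · module
  · intro S s1 s2 s3 s4 s5 s6 s7
    rw [S.smul_mem_iff (div_ne_zero (by norm_num) hp)] at s5
    have h6 := mem_of_add_smul_mem _ s6 s5
    rw [S.smul_mem_iff hp] at h6
    exact H.span S s1 s2 s3 s4 s5 h6 s7
  all_goals simp only [lie_add, add_lie, lie_smul, smul_lie, R, lie_self, smul_zero, zero_smul,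
    neg_zero, add_zero, zero_add, sub_zero, sub_self, implies_true, lie_neg, neg_lie, neg_neg]
  all_goals clear R H hc
  all_goals match_scalars
  all_goals field_simp
  all_goals ring1

theorem admits_or_hasStructure_of_I [LieRing.IsNilpotent g] (hdim : finrank ℝ g = 7)
    (hc : ∀ r t : ℝ, (∀ v : g, ⁅v, r • x₅ + t • x₆⁆ = 0) → r = 0 ∧ t = 0)
    (H : HasBrackets x₁ x₂ x₃ x₄ x₅ x₆ x₇ x₃ x₄ x₇ 0 0 (s • x₇) 0 (-p • x₄ + m • x₇)
      (-q • x₄ + n • x₇) 0 (-p • x₇) (-q • x₇) 0 0 (k • x₇)) :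
    AdmitsPurelyCoclosedG2 g ∨ HasStructure1457A g ∨ HasStructure1457B g := by
  have R := H.rules
  by_cases hp : p = 0
  · by_cases hq : q = 0
    · right
      simp only [hp, hq, neg_zero, zero_smul, zero_add] at H
      refine H.hasStructure1457_of_ne_zero hdim fun hk => ?_
      have R := H.rules
      have h : -n = 0 ∧ m = 0 := by
        refine hc (-n) m (H.lie_eq_zero ?_ ?_ ?_ ?_ ?_ ?_)
        all_goals simp only [lie_add, lie_smul, R, lie_self, smul_zero, zero_smul, neg_zero,
          add_zero, hk]
        module
      have := hc 1 0 (H.lie_eq_zero (by simp [R]) (by simp [R, h]) (by simp [R]) (by simp [R])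
        (by simp [R]) (by simp [R, hk]))
      exact one_ne_zero this.1
    · left
      refine admits_I_of_central (x₁ := x₁) (x₂ := x₂) (x₃ := x₃) (x₄ := x₄) (x₅ := x₆)
        (x₆ := x₅) (x₇ := x₇) hdim hq (fun r t h => ?_) (s := s) (m := n) (n := m) (q := p)
        (k := -k) ⟨fun S s1 s2 s3 s4 s5 s6 s7 => H.span S s1 s2 s3 s4 s6 s5 s7,
          ?_, ?_, ?_, ?_, ?_, ?_, ?_, ?_, ?_, ?_, ?_, ?_, ?_, ?_, ?_, ?_⟩
      · simp only [add_comm (r • x₆)] at h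
        exact (hc t r h).symm
      all_goals simp only [R, neg_smul, implies_true]
  · exact .inl (H.admits_I_of_central hdim hp hc)

end

end HasBrackets

namespace IsLieFiltration

variable {A B C : Submodule ℝ g}

theorem mem_of_not_decomposable (F : IsLieFiltration A B C) (hind : ¬ Decomposable g) {z : g}
    (hz : ∀ v : g, ⁅v, z⁆ = 0) : z ∈ A := by
  by_contra hzA
  have hz₀ : z ≠ 0 := fun h => hzA (h ▸ A.zero_mem)
  have hd : Disjoint A (Submodule.span ℝ {z}) :=
    (Submodule.disjoint_span_singleton' hz₀).2 hzA
  obtain ⟨I, hAI, hI⟩ := hd.exists_isCompl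
  refine hind ⟨{ I with lie_mem := fun {x y} _ => hAI (F.lie₀ x y) },
    { Submodule.span ℝ {z} with lie_mem := fun {x y} hy => ?_ }, fun h => ?_, fun h => ?_, ?_, ?_⟩
  · obtain ⟨r, rfl⟩ := Submodule.mem_span_singleton.1 hy
    simp [hz]
  · have : I = ⊥ := congrArg LieSubmodule.toSubmodule h
    exact F.not_le₁ ((hAI.trans this.le).trans bot_le)
  · have : Submodule.span ℝ {z} = ⊥ := congrArg LieSubmodule.toSubmodule h
    exact hz₀ (Submodule.span_singleton_eq_bot.1 this)
  · rw [← LieSubmodule.toSubmodule_inj]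
    simpa using hI.inf_eq_bot
  · rw [← LieSubmodule.toSubmodule_inj]
    simpa using hI.sup_eq_top

variable [FiniteDimensional ℝ g]

/-- The case `dim g/A = 4`. -/
theorem exists_of_finrank_eq_three (F : IsLieFiltration A B C) (hdim : finrank ℝ g = 7)
    (hA : finrank ℝ A = 3) :
    ∃ x₁ x₂ x₃ x₄ x₅ x₆ x₇ : g, ∃ s p q m n k : ℝ,
      HasBrackets x₁ x₂ x₃ x₄ x₅ x₆ x₇ x₃ x₄ x₇ 0 0 (s • x₇) 0 (-p • x₄ + m • x₇)
        (-q • x₄ + n • x₇) 0 (-p • x₇) (-q • x₇) 0 0 (k • x₇) ∧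
      A ≤ Submodule.span ℝ {x₃, x₄, x₇} := by
  have hr := F.finrank_lt
  have hBC : finrank ℝ B ≤ finrank ℝ C + 1 := by omega
  have hAB : finrank ℝ A ≤ finrank ℝ B + 1 := by omega
  obtain ⟨x, a, ha, hxa⟩ : ∃ x : g, ∃ a ∈ A, ⁅x, a⁆ ∉ C := by
    by_contra! h
    exact F.not_le₂ (F.gen₂ C h)
  have haB : a ∉ B := fun h => hxa (F.lie₂ x a h)
  have hA_le := le_sup_span_of_finrank_le F.le₁ hAB ha haB
  have hB_le := le_sup_span_of_finrank_le F.le₂ hBC (F.lie₁ x a ha) hxa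
  have hmod : ∀ u, ∃ r : ℝ, ⁅u - r • x, a⁆ ∈ C := fun u => by
    obtain ⟨r, hr⟩ := exists_sub_smul_mem hB_le (F.lie₁ u a ha)
    exact ⟨r, by simpa using hr⟩
  have hK : ∀ u, ⁅u, a⁆ ∈ C → ∀ w ∈ A, ⁅u, w⁆ ∈ C := fun u hu w hw => by
    obtain ⟨r, hr⟩ := exists_sub_smul_mem hA_le hw
    have := C.add_mem (F.lie₂ u _ hr) (C.smul_mem r hu)
    simpa using this
  have hKK : ∀ u v, ⁅u, a⁆ ∈ C → ⁅v, a⁆ ∈ C → ⁅u, v⁆ ∈ B := fun u v hu hv => by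
    obtain ⟨r, hr⟩ := exists_sub_smul_mem hA_le (F.lie₀ u v)
    have h₁ : ⁅x, ⁅u, v⁆⁆ ∈ C := by
      rw [leibniz_lie x u v]
      exact C.add_mem (lie_mem_submodule_comm.1 (hK v hv _ (F.lie₀ x u))) (hK u hu _ (F.lie₀ x v))
    have h₂ := C.sub_mem h₁ (F.lie₂ x _ hr)
    by_cases hr₀ : r = 0
    · simpa [hr₀] using hr
    · exact absurd ((C.smul_mem_iff hr₀).1 (by simpa using h₂)) hxa
  obtain ⟨y, hy, hxy⟩ : ∃ y : g, ⁅y, a⁆ ∈ C ∧ ⁅x, y⁆ ∉ B := by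
    by_contra! h
    refine F.not_le₁ (F.gen₁ B fun u v => ?_)
    obtain ⟨r, hr⟩ := hmod u
    obtain ⟨s, hs⟩ := hmod v
    have h₁ := h _ hr
    have h₂ := h _ hs
    have := B.add_mem (hKK _ _ hr hs) (B.sub_mem (B.smul_mem r h₂) (B.smul_mem s h₁))
    convert this using 1
    simp only [lie_sub, sub_lie, lie_smul, smul_lie, lie_self]
    rw [← lie_skew u x]
    module
  have hb := F.lie₀ x y
  have hA_le' := le_sup_span_of_finrank_le F.le₁ hAB hb hxy
  have hc : ⁅x, ⁅x, y⁆⁆ ∉ C := fun h => by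
    obtain ⟨r, hr⟩ := exists_sub_smul_mem hA_le' ha
    have := C.add_mem (F.lie₂ x _ hr) (C.smul_mem r h)
    exact hxa (by simpa using this)
  have hB_le' := le_sup_span_of_finrank_le F.le₂ hBC (F.lie₁ x _ hb) hc
  set L : Submodule ℝ g := C.comap (LieModule.toEnd ℝ g g a) ⊓ B.comap (LieModule.toEnd ℝ g g x)
    with hL
  have memL : ∀ u, u ∈ L ↔ ⁅u, a⁆ ∈ C ∧ ⁅x, u⁆ ∈ B := fun u => by
    rw [lie_mem_submodule_comm]
    simp [hL]
  have hAL : A ≤ L := fun u hu => (memL u).2 ⟨F.lie₁₁ _ hu _ ha, F.lie₁ _ _ hu⟩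
  have hLtop : ∀ S : Submodule ℝ g, L ≤ S → x ∈ S → y ∈ S → S = ⊤ := by
    refine fun S hS hx hy' => Submodule.eq_top_iff'.2 fun u => ?_
    obtain ⟨r, hr⟩ := hmod u
    obtain ⟨s, hs⟩ := exists_sub_smul_mem hA_le' (F.lie₀ x (u - r • x))
    have : u - r • x - s • y ∈ L := by
      refine (memL _).2 ⟨?_, by simpa using hs⟩
      rw [sub_lie, smul_lie]
      exact C.sub_mem hr (C.smul_mem s hy)
    rw [show u = (u - r • x - s • y) + r • x + s • y by abel]
    exact S.add_mem (S.add_mem (hS this) (S.smul_mem r hx)) (S.smul_mem s hy')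
  have hL5 : finrank ℝ L + 2 ≤ finrank ℝ (⊤ : Submodule ℝ g) := by
    refine finrank_add_two_le le_top (Submodule.mem_top (x := x)) (Submodule.mem_top (x := y))
      (fun hx => hxa ((memL x).1 hx).1) fun hy => ?_
    obtain ⟨r, hr⟩ := exists_sub_smul_mem le_rfl hy
    exact hxy (by simpa using ((memL _).1 hr).2)
  rw [finrank_top] at hL5
  obtain ⟨u, hu, v, hv, hLuv⟩ := exists_le_sup_span_of_finrank_le_two hAL (by omega)
  have hC : finrank ℝ C ≤ 1 := by omega
  have hKc : ∀ w, ⁅w, a⁆ ∈ C → ⁅w, ⁅x, ⁅x, y⁆⁆⁆ = 0 := fun w hw => by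
    obtain ⟨r, hr⟩ := exists_sub_smul_mem hA_le' (F.lie₀ w x)
    have := F.lie₁₂ _ hb _ hr
    rw [lie_sub, lie_smul, lie_self, smul_zero, sub_zero] at this
    rw [leibniz_lie w x, F.lie₃ x _ (hK w hw _ hb), ← lie_skew, this, neg_zero, add_zero]
  have hz : ⁅x, ⁅x, ⁅x, y⁆⁆⁆ ≠ 0 := fun h => by
    refine F.not_le₃ (F.gen₃ _ fun w e he => ?_)
    obtain ⟨r, hr⟩ := exists_sub_smul_mem hB_le' he
    obtain ⟨s, hs⟩ := hmod w
    have h₁ : ⁅w, ⁅x, ⁅x, y⁆⁆⁆ = 0 := by simpa [h] using hKc _ hs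
    simpa [h₁] using F.lie₃ w _ hr
  have hzC : ⁅x, ⁅x, ⁅x, y⁆⁆⁆ ∈ C := F.lie₂ x _ (F.lie₁ x _ hb)
  have hCz : ∀ w ∈ C, ∃ r : ℝ, w = r • ⁅x, ⁅x, ⁅x, y⁆⁆⁆ := fun w hw =>
    exists_eq_smul_of_finrank_le_one hC hzC hz hw
  have hBz : ∀ w ∈ B, ∃ r t : ℝ, w = r • ⁅x, ⁅x, y⁆⁆ + t • ⁅x, ⁅x, ⁅x, y⁆⁆⁆ := fun w hw => by
    obtain ⟨r, hr⟩ := exists_sub_smul_mem hB_le' hw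
    obtain ⟨t, ht⟩ := hCz _ hr
    exact ⟨r, t, by rw [← ht]; abel⟩
  have hadj : ∀ u ∈ L, ∃ u', u - u' ∈ A ∧ ⁅u', a⁆ ∈ C ∧ ⁅x, u'⁆ = 0 := fun u hu => by
    obtain ⟨r, t, h⟩ := hBz _ ((memL u).1 hu).2
    have hw : r • ⁅x, y⁆ + t • ⁅x, ⁅x, y⁆⁆ ∈ A :=
      A.add_mem (A.smul_mem r hb) (A.smul_mem t (F.lie₀ _ _))
    refine ⟨u - (r • ⁅x, y⁆ + t • ⁅x, ⁅x, y⁆⁆), by simpa using hw, ?_, ?_⟩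
    · rw [sub_lie]
      exact C.sub_mem ((memL u).1 hu).1 (F.lie₁₁ _ hw _ ha)
    · rw [lie_sub, h, lie_add, lie_smul, lie_smul, sub_self]
  obtain ⟨u', hu', hua, hxu⟩ := hadj u hu
  obtain ⟨v', hv', hva, hxv⟩ := hadj v hv
  have hyw : ∀ w, ⁅w, a⁆ ∈ C → ⁅x, w⁆ = 0 → ∃ p m : ℝ, ⁅y, w⁆ = -p • ⁅x, ⁅x, y⁆⁆ +
      m • ⁅x, ⁅x, ⁅x, y⁆⁆⁆ ∧ ⁅⁅x, y⁆, w⁆ = -p • ⁅x, ⁅x, ⁅x, y⁆⁆⁆ := fun w hw hxw => by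
    obtain ⟨p, m, h⟩ := hBz _ (hKK y w hy hw)
    refine ⟨-p, m, by rw [neg_neg, h], ?_⟩
    rw [lie_lie, hxw, lie_zero, sub_zero, h, lie_add, lie_smul, lie_smul, F.lie₃ x _ hzC]
    module
  obtain ⟨p, m, hyu, hbu⟩ := hyw u' hua hxu
  obtain ⟨q, n, hyv, hbv⟩ := hyw v' hva hxv
  obtain ⟨s, hs⟩ := hCz _ (hK y hy _ hb)
  obtain ⟨e, k, huv⟩ := hBz _ (hKK u' v' hua hva)
  have he : e = 0 := by
    have := leibniz_lie x u' v'
    rw [hxu, hxv, huv] at this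
    simpa [F.lie₃ x _ hzC, hz] using this
  rw [he, zero_smul, zero_add] at huv
  have hcw : ∀ w : g, ⁅w, a⁆ ∈ C → ⁅⁅x, ⁅x, y⁆⁆, w⁆ = 0 := fun w hw => by
    rw [← lie_skew _ w, hKc w hw, neg_zero]
  have hAS : ∀ S : Submodule ℝ g, ⁅x, y⁆ ∈ S → ⁅x, ⁅x, y⁆⁆ ∈ S → ⁅x, ⁅x, ⁅x, y⁆⁆⁆ ∈ S → A ≤ S := by
    refine fun S h₁ h₂ h₃ => hA_le'.trans (sup_span_le (hB_le'.trans (sup_span_le ?_ h₂)) h₁)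
    intro w hw
    obtain ⟨r, rfl⟩ := hCz w hw
    exact S.smul_mem r h₃
  refine ⟨x, y, ⁅x, y⁆, ⁅x, ⁅x, y⁆⁆, u', v', ⁅x, ⁅x, ⁅x, y⁆⁆⁆, s, p, q, m, n, k,
    ⟨fun S h₁ h₂ h₃ h₄ h₅ h₆ h₇ => ?_, rfl, rfl, rfl, hxu, hxv, hs, hKc y hy, hyu, hyv,
      F.lie₁₂ _ hb _ (F.lie₁ x _ hb), hbu, hbv, hcw _ hua, hcw _ hva, huv,
      fun w => F.lie₃ w _ hzC⟩, ?_⟩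
  · have hAS := hAS S h₃ h₄ h₇
    refine hLtop S (hLuv.trans (sup_span_le_of_forall_mem hAS ?_)) h₁ h₂
    rintro w (rfl | rfl)
    · exact (Submodule.sub_mem_iff_left S h₅).1 (hAS hu')
    · exact (Submodule.sub_mem_iff_left S h₆).1 (hAS hv')
  · exact hAS _ (Submodule.subset_span (by simp)) (Submodule.subset_span (by simp))
      (Submodule.subset_span (by simp))

theorem admits_or_hasStructure_of_finrank_eq_three (F : IsLieFiltration A B C)
    [LieRing.IsNilpotent g] (hind : ¬ Decomposable g) (hdim : finrank ℝ g = 7)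
    (hA : finrank ℝ A = 3) :
    AdmitsPurelyCoclosedG2 g ∨ HasStructure1457A g ∨ HasStructure1457B g := by
  obtain ⟨x₁, x₂, x₃, x₄, x₅, x₆, x₇, s, p, q, m, n, k, H, hA_le⟩ :=
    F.exists_of_finrank_eq_three hdim hA
  refine H.admits_or_hasStructure_of_I hdim fun r t h => ?_
  have hA' := hA_le (F.mem_of_not_decomposable hind h)
  obtain ⟨b, rfl, rfl, rfl, rfl, rfl, rfl, rfl⟩ := H.exists_basis_eq hdim
  have hcoord : ∀ i : Fin 7, i = 4 ∨ i = 5 → b.coord i (r • b 4 + t • b 5) = 0 := fun i hi => by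
    have : Submodule.span ℝ {b 2, b 3, b 6} ≤ LinearMap.ker (b.coord i) := by
      rw [Submodule.span_le]
      rcases hi with rfl | rfl <;> rintro _ (rfl | rfl | rfl) <;> simp
    exact this hA'
  exact ⟨by simpa using hcoord 4 (.inl rfl), by simpa using hcoord 5 (.inr rfl)⟩

end IsLieFiltration

/-- Theorem `4step-indecomposable-pure`.  A 7-dimensional indecomposable
4-step real nilpotent Lie algebra admits a purely coclosed G₂-structure if and only if it is
isomorphic to none of `1357E`, `1457A`, `1457B` and `1357N(-2)`. -/
theorem four_step_indecomposable_pure (g : Type*) [LieRing g] [LieAlgebra ℝ g]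
    (hdim : Module.finrank ℝ g = 7)
    (hind : ¬ Decomposable g)
    (hstep4 : LieModule.lowerCentralSeries ℝ g g 4 = ⊥)
    (hstep3 : LieModule.lowerCentralSeries ℝ g g 3 ≠ ⊥) :
    AdmitsPurelyCoclosedG2 g ↔
      ¬ (HasStructure1357E g ∨ HasStructure1457A g ∨ HasStructure1457B g ∨
        HasStructure1357Nminus2 g) := by
  have : LieRing.IsNilpotent g := LieModule.IsNilpotent.mk g hstep4
  have : FiniteDimensional ℝ g := FiniteDimensional.of_finrank_pos (by omega)
  have F := isLieFiltration_lowerCentralSeries hstep4 hstep3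
  constructor
  · rintro h (h' | h' | h' | h')
    · exact not_admits_of_hasStructure1357E h' h
    · exact not_admits_of_hasStructure1457 (.inl h') h
    · exact not_admits_of_hasStructure1457 (.inr h') h
    · exact not_admits_of_hasStructure1357Nminus2 h' h
  · intro h
    have hr := F.finrank_lt
    have h5 := F.finrank_le_five hdim
    by_cases hA₅ : finrank ℝ (LieModule.lowerCentralSeries ℝ g g 1).toSubmodule = 5
    · exact F.admits_of_finrank_eq_five hdim hA₅
    by_cases hA₃ : finrank ℝ (LieModule.lowerCentralSeries ℝ g g 1).toSubmodule = 3
    · have := F.admits_or_hasStructure_of_finrank_eq_three hind hdim hA₃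
      tauto
    by_cases hB : finrank ℝ (LieModule.lowerCentralSeries ℝ g g 2).toSubmodule = 3
    · exact F.admits_of_finrank_eq_three hdim (by omega) hB
    · have := F.admits_or_hasStructure_of_finrank_eq_two hdim (by omega) (by omega)
      tauto
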